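/- arXiv:math/0606391 — 6 statements merged into one kernel-verified Lean document; each statement's English description precedes it below -/
import Mathlib

section
/- For an arbitrary 2m×2m matrix (a_{ij}) over a commutative ring, the Pfaffian of the skew-symmetric matrix (a_{ij} - a_{ji}) equals the sum over all m-element subsets S of {1,...,2m} of (-1)^{χ(S)} times the determinant of the m×m matrix (a_{ij}) with rows indexed by S and columns by the complement of S (both in increasing order), where χ(S) is the number of even elements of S. -/
open Finset

/-- The Pfaffian of a `2m × 2m` matrix, via the standard (division-free) sum over
perfect matchings: `pfaff A = (1/(2^m m!)) Σ_{σ ∈ S_{2m}} sgn(σ) Π_i a_{σ(2i-1),σ(2i)}`,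
where the normalizing factor is accounted for by restricting to canonical
representatives of the matchings. -/
noncomputable def pfaff {R : Type*} [CommRing R] {m : ℕ}
    (A : Matrix (Fin (2 * m)) (Fin (2 * m)) R) : R :=
  ∑ σ ∈ Finset.univ.filter (fun σ : Equiv.Perm (Fin (2 * m)) =>
      (∀ i : Fin m, σ ⟨2 * (i : ℕ), by omega⟩ < σ ⟨2 * (i : ℕ) + 1, by omega⟩) ∧
      StrictMono (fun i : Fin m => σ ⟨2 * (i : ℕ), by omega⟩)),
    (Equiv.Perm.sign σ : ℤ) •
      ∏ i : Fin m, A (σ ⟨2 * (i : ℕ), by omega⟩) (σ ⟨2 * (i : ℕ) + 1, by omega⟩)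

/-- `χ(S)`: the number of even elements of `S ⊆ {1, …, n}` (elements of `Fin n`
being identified with `{1, …, n}` via `i ↦ i + 1`). -/
def chi {n : ℕ} (S : Finset (Fin n)) : ℕ :=
  (S.filter (fun i : Fin n => ((i : ℕ) + 1) % 2 = 0)).card

namespace PfaffianDet

open Equiv

/-- If every `z` satisfying `Q` has exactly one translate satisfying `P`, then summing over the
translates of elements satisfying `P` is the same as summing over the elements satisfying `Q`. -/
lemma sum_translates {G Y Z R : Type*} [Fintype G] [Fintype (Y ≃ Z)]
    [AddCommMonoid R] (u : G → Perm Y) (P Q : (Y ≃ Z) → Prop) [DecidablePred P] [DecidablePred Q]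
    (F : (Y ≃ Z) → R) (h : ∀ x, Q x → ∃! g, P ((u g).symm.trans x)) :
    ∑ x with P x, ∑ g with Q ((u g).trans x), F ((u g).trans x) = ∑ x with Q x, F x := by
  have hx : ∀ x, Q x → F x = ∑ g with P ((u g).symm.trans x), F x := by
    intro x hq
    obtain ⟨g, hg, hu⟩ := h x hq
    have : (univ.filter fun g => P ((u g).symm.trans x)) = {g} := by
      ext k
      simp only [mem_filter, mem_univ, true_and, mem_singleton]
      exact ⟨hu k, fun e => e ▸ hg⟩
    rw [this, sum_singleton]
  rw [sum_congr rfl fun x hq => hx x (mem_filter.1 hq).2, sum_sigma', sum_sigma']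
  refine sum_bij' (fun p _ => ⟨(u p.2).trans p.1, p.2⟩) (fun p _ => ⟨(u p.2).symm.trans p.1, p.2⟩)
    ?_ ?_ ?_ ?_ ?_
  · rintro ⟨x, g⟩ hp
    simp only [mem_sigma, mem_filter, mem_univ, true_and] at hp ⊢
    simpa [← Equiv.trans_assoc, and_comm] using hp
  · rintro ⟨x, g⟩ hp
    simp only [mem_sigma, mem_filter, mem_univ, true_and] at hp ⊢
    simpa [← Equiv.trans_assoc, and_comm] using hp
  · rintro ⟨x, g⟩ hp
    simp [← Equiv.trans_assoc]
  · rintro ⟨x, g⟩ hp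
    simp [← Equiv.trans_assoc]
  · rintro ⟨x, g⟩ hp
    rfl

lemma existsUnique_strictMono_comp {n : ℕ} {α : Type*} [LinearOrder α] {f : Fin n → α}
    (hf : Function.Injective f) : ∃! g : Perm (Fin n), StrictMono (f ∘ g) := by
  refine ⟨Tuple.sort f, (Tuple.monotone_sort f).strictMono_of_injective
    (hf.comp (Tuple.sort f).injective), fun g hg => ?_⟩
  have := Tuple.unique_monotone hg.monotone (Tuple.monotone_sort f)
  exact Equiv.ext fun i => hf (congrFun this i)

/-- The identification of `Fin m × Fin 2` with `Fin (2 * m)`, sending `(i, b)` to `2 * i + b`. -/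
def interleave (m : ℕ) : Fin m × Fin 2 ≃ Fin (2 * m) :=
  finProdFinEquiv.trans (finCongr (mul_comm m 2))

lemma interleave_zero {m : ℕ} (i : Fin m) :
    interleave m (i, 0) = ⟨2 * (i : ℕ), by omega⟩ := by
  ext; simp [interleave]

lemma interleave_one {m : ℕ} (i : Fin m) :
    interleave m (i, 1) = ⟨2 * (i : ℕ) + 1, by omega⟩ := by
  ext; simp [interleave, add_comm]

/-- The sign of an arrangement of `Fin (2 * m)` into ordered pairs. -/
def pairSign {m : ℕ} (ρ : Fin m × Fin 2 ≃ Fin (2 * m)) : ℤˣ :=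
  Perm.sign ((interleave m).symm.trans ρ)

lemma pairSign_trans_left {m : ℕ} (u : Perm (Fin m × Fin 2)) (ρ : Fin m × Fin 2 ≃ Fin (2 * m)) :
    pairSign (u.trans ρ) = Perm.sign u * pairSign ρ := by
  have : (interleave m).symm.trans (u.trans ρ) =
      (interleave m).symm.trans ρ * (interleave m).permCongr u := by
    ext x; simp
  rw [pairSign, this, Perm.sign_mul, Perm.sign_permCongr, mul_comm]; rfl

lemma pairSign_trans_right {m : ℕ} (ρ : Fin m × Fin 2 ≃ Fin (2 * m)) (u : Perm (Fin (2 * m))) :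
    pairSign (ρ.trans u) = Perm.sign u * pairSign ρ := by
  rw [pairSign, ← Equiv.trans_assoc, Perm.sign_trans]; rfl

/-- The signed product of the entries of `a` at an arrangement of `Fin (2 * m)` into pairs. -/
def pairTerm {R : Type*} [CommRing R] {m : ℕ} (a : Matrix (Fin (2 * m)) (Fin (2 * m)) R)
    (ρ : Fin m × Fin 2 ≃ Fin (2 * m)) : R :=
  (pairSign ρ : ℤ) • ∏ i, a (ρ (i, 0)) (ρ (i, 1))

lemma pairTerm_prodCongr {R : Type*} [CommRing R] {m : ℕ}
    (a : Matrix (Fin (2 * m)) (Fin (2 * m)) R) (g : Perm (Fin m))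
    (ρ : Fin m × Fin 2 ≃ Fin (2 * m)) :
    pairTerm a ((prodCongrLeft fun _ : Fin 2 => g).trans ρ) = pairTerm a ρ := by
  have hs : Perm.sign (prodCongrLeft fun _ : Fin 2 => g) = 1 := by
    rw [Perm.sign_prodCongrLeft]
    simp [Int.units_sq]
  rw [pairTerm, pairSign_trans_left, hs, one_mul, pairTerm]
  congr 1
  exact Equiv.prod_comp g fun i => a (ρ (i, 0)) (ρ (i, 1))

lemma sub_eq_sum_perm {R Y : Type*} [CommRing R] (a : Y → Y → R) (f : Fin 2 → Y) :
    a (f 0) (f 1) - a (f 1) (f 0) =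
      ∑ c : Perm (Fin 2), (Perm.sign c : ℤ) • a (f (c 0)) (f (c 1)) := by
  have : (univ : Finset (Perm (Fin 2))) = {1, swap 0 1} := by decide
  rw [this, sum_pair (by decide)]
  simp [sub_eq_add_neg]

lemma signed_prod_sub_eq_sum {R : Type*} [CommRing R] {m : ℕ}
    (a : Matrix (Fin (2 * m)) (Fin (2 * m)) R) (ρ : Fin m × Fin 2 ≃ Fin (2 * m)) :
    (pairSign ρ : ℤ) • ∏ i, (a (ρ (i, 0)) (ρ (i, 1)) - a (ρ (i, 1)) (ρ (i, 0))) =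
      ∑ c : Fin m → Perm (Fin 2), pairTerm a ((prodCongrRight c).trans ρ) := by
  rw [prod_congr rfl fun i _ => sub_eq_sum_perm a fun b => ρ (i, b), Fintype.prod_sum, smul_sum]
  refine sum_congr rfl fun c _ => ?_
  rw [pairTerm, pairSign_trans_left, Perm.sign_prodCongrRight]
  simp only [zsmul_eq_mul, prod_mul_distrib, Equiv.trans_apply, prodCongrRight_apply,
    Units.val_mul, Units.coe_prod, Int.cast_mul, Int.cast_prod]
  ring

lemma sum_canonical_eq {R : Type*} [CommRing R] {m : ℕ}
    (F : (Fin m × Fin 2 ≃ Fin (2 * m)) → R) :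
    ∑ ρ : Fin m × Fin 2 ≃ Fin (2 * m) with
        (∀ i, ρ (i, 0) < ρ (i, 1)) ∧ StrictMono fun i => ρ (i, 0),
      ∑ c : Fin m → Perm (Fin 2), F ((prodCongrRight c).trans ρ) =
    ∑ ρ : Fin m × Fin 2 ≃ Fin (2 * m) with StrictMono fun i => min (ρ (i, 0)) (ρ (i, 1)), F ρ := by
  have key : ∀ (c : Fin m → Perm (Fin 2)) (ρ : Fin m × Fin 2 ≃ Fin (2 * m)) (i : Fin m),
      min (ρ (i, c i 0)) (ρ (i, c i 1)) = min (ρ (i, 0)) (ρ (i, 1)) := by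
    intro c ρ i
    have : ∀ d : Perm (Fin 2), d = 1 ∨ d = swap 0 1 := by decide
    rcases this (c i) with h | h <;> simp [h, min_comm]
  rw [← sum_translates prodCongrRight
    (fun ρ => (∀ i, ρ (i, 0) < ρ (i, 1)) ∧ StrictMono fun i => ρ (i, 0))
    (fun ρ => StrictMono fun i => min (ρ (i, 0)) (ρ (i, 1)))]
  · refine sum_congr rfl fun ρ hρ => ?_
    rw [filter_true_of_mem]
    intro c _
    obtain ⟨h1, h2⟩ := (mem_filter.1 hρ).2
    simpa [key, min_eq_left (h1 _).le] using h2
  · intro ρ hρ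
    have hex := fun i => existsUnique_strictMono_comp
      (f := fun b => ρ (i, b)) fun b b' h => (Prod.mk.inj (ρ.injective h)).2
    choose g hg hu using hex
    have mono_iff : ∀ (d : Perm (Fin 2)) (i : Fin m),
        StrictMono ((fun b => ρ (i, b)) ∘ d) ↔ ρ (i, d 0) < ρ (i, d 1) := by
      intro d i
      rw [Fin.strictMono_iff_lt_succ]
      simp
    have hlt : ∀ i, ρ (i, g i 0) < ρ (i, g i 1) := fun i => (mono_iff _ i).1 (hg i)
    refine ⟨fun i => (g i).symm, ⟨fun i => by simpa [prodCongrRight] using hlt i, ?_⟩, ?_⟩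
    · have : ∀ i, ρ (i, g i 0) = min (ρ (i, 0)) (ρ (i, 1)) := fun i => by
        rw [← key g, min_eq_left (hlt i).le]
      simpa [prodCongrRight, this] using hρ
    · rintro c ⟨hc, -⟩
      funext i
      rw [← hu i (c i).symm ((mono_iff _ i).2 (by simpa [prodCongrRight] using hc i)), symm_symm]

lemma sum_strictMono_min_eq {R : Type*} [CommRing R] {m : ℕ}
    (a : Matrix (Fin (2 * m)) (Fin (2 * m)) R) :
    ∑ ρ : Fin m × Fin 2 ≃ Fin (2 * m) with StrictMono fun i => min (ρ (i, 0)) (ρ (i, 1)),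
      pairTerm a ρ =
    ∑ ρ : Fin m × Fin 2 ≃ Fin (2 * m) with StrictMono fun i => ρ (i, 0), pairTerm a ρ := by
  rw [← sum_translates (fun g : Perm (Fin m) => prodCongrLeft fun _ : Fin 2 => g)
    (fun ρ => StrictMono fun i => min (ρ (i, 0)) (ρ (i, 1)))
    (fun ρ => StrictMono fun i => ρ (i, 0))]
  · refine sum_congr rfl fun ρ _ => ?_
    obtain ⟨g, hg, hu⟩ := existsUnique_strictMono_comp
      (f := fun i => ρ (i, 0)) fun b b' h => (Prod.mk.inj (ρ.injective h)).1
    simp only [pairTerm_prodCongr]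
    have : (univ.filter fun g : Perm (Fin m) =>
        StrictMono fun i => ((prodCongrLeft fun _ : Fin 2 => g).trans ρ) (i, 0)) = {g} := by
      ext k
      simp only [mem_filter, mem_univ, true_and, mem_singleton]
      exact ⟨hu k, fun e => e ▸ hg⟩
    rw [this, sum_singleton]
  · intro ρ _
    have hinj : Function.Injective fun i => min (ρ (i, 0)) (ρ (i, 1)) := by
      intro i j h
      rcases min_choice (ρ (i, 0)) (ρ (i, 1)) with hi | hi <;>
      rcases min_choice (ρ (j, 0)) (ρ (j, 1)) with hj | hj <;>
      · simp only [hi, hj] at h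
        exact (Prod.mk.inj (ρ.injective h)).1
    obtain ⟨g, hg, hu⟩ := existsUnique_strictMono_comp hinj
    refine ⟨g.symm, hg, fun k hk => ?_⟩
    rw [← hu k.symm hk, symm_symm]

lemma pfaff_eq_sum {R : Type*} [CommRing R] {m : ℕ}
    (a : Matrix (Fin (2 * m)) (Fin (2 * m)) R) :
    pfaff (fun i j => a i j - a j i) =
      ∑ ρ : Fin m × Fin 2 ≃ Fin (2 * m) with StrictMono fun i => ρ (i, 0), pairTerm a ρ := by
  rw [← sum_strictMono_min_eq, ← sum_canonical_eq]
  unfold pfaff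
  simp only [← signed_prod_sub_eq_sum]
  refine sum_equiv ((interleave m).symm.equivCongr (Equiv.refl _)) (fun σ => ?_) (fun σ _ => ?_)
  · simp [interleave_zero, interleave_one]
  · have : (interleave m).symm.trans ((interleave m).symm.equivCongr (Equiv.refl _) σ) = σ := by
      ext x; simp
    rw [pairSign, this]
    simp [interleave_zero, interleave_one]

lemma exists_boundary {p : ℕ → Prop} {w v : ℕ} (hwv : w < v) (hw : p w) (hv : ¬ p v) :
    ∃ k, w ≤ k ∧ k < v ∧ p k ∧ ¬ p (k + 1) := by
  by_contra! h
  have : ∀ d, w + d ≤ v → p (w + d) := by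
    intro d
    induction d with
    | zero => exact fun _ => hw
    | succ d ih => exact fun hd => h (w + d) (by omega) (by omega) (ih (by omega))
  exact hv (by simpa [hwv.le] using this (v - w) (by omega))

lemma swap_lt_swap {n : ℕ} {s t x y : Fin n} (hst : (t : ℕ) = s + 1) (hxy : x < y)
    (h : ¬(x = s ∧ y = t)) : swap s t x < swap s t y := by
  simp only [swap_apply_def, Fin.ext_iff, Fin.lt_def] at *
  split_ifs <;> omega

/-- Both rows of the arrangement are increasing. -/
def RowsMono {m : ℕ} (ρ : Fin m × Fin 2 ≃ Fin (2 * m)) : Prop :=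
  (StrictMono fun i => ρ (i, 0)) ∧ StrictMono fun i => ρ (i, 1)

/-- The sign of an arrangement, twisted by the parity of its first row. -/
def twistedSign {m : ℕ} (ρ : Fin m × Fin 2 ≃ Fin (2 * m)) : ℤˣ :=
  pairSign ρ * ∏ i, (-1 : ℤˣ) ^ (ρ (i, 0) : ℕ)

lemma RowsMono.eq_of_separated {m : ℕ} {ρ τ : Fin m × Fin 2 ≃ Fin (2 * m)} (hρ : RowsMono ρ)
    (hτ : RowsMono τ) (h : ∀ i j, ρ (i, 0) < ρ (j, 1)) (h' : ∀ i j, τ (i, 0) < τ (j, 1)) :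
    ρ = τ := by
  have hmono : StrictMono (τ.symm.trans ρ) := by
    intro x y hxy
    obtain ⟨⟨i, b⟩, rfl⟩ := τ.surjective x
    obtain ⟨⟨j, c⟩, rfl⟩ := τ.surjective y
    simp only [Equiv.trans_apply, symm_apply_apply]
    fin_cases b <;> fin_cases c
    · exact hρ.1 (hτ.1.lt_iff_lt.1 hxy)
    · exact h i j
    · exact absurd hxy (h' j i).not_gt
    · exact hρ.2 (hτ.2.lt_iff_lt.1 hxy)
  have h1 : τ.symm.trans ρ = 1 := (Perm.monotone_iff _).1 hmono.monotone
  ext p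
  simpa using congrArg Fin.val (Equiv.congr_fun h1 (τ p))

/-- An arrangement with increasing rows whose first row is not an initial segment can be
changed by an adjacent transposition which lowers the first row. -/
lemma RowsMono.exists_lower {m : ℕ} {ρ : Fin m × Fin 2 ≃ Fin (2 * m)} (hρ : RowsMono ρ)
    (h : ¬ ∀ i j, ρ (i, 0) < ρ (j, 1)) :
    ∃ τ : Fin m × Fin 2 ≃ Fin (2 * m), RowsMono τ ∧ twistedSign τ = twistedSign ρ ∧
      ∑ i, (τ (i, 0) : ℕ) + 1 = ∑ i, (ρ (i, 0) : ℕ) := by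
  push Not at h
  obtain ⟨i₀, j₀, h⟩ := h
  have hlt : ρ (j₀, 1) < ρ (i₀, 0) := lt_of_le_of_ne h fun e => by
    simpa using ρ.injective e
  obtain ⟨k, -, hk, ⟨j, hj⟩, hk1⟩ := exists_boundary
    (p := fun k => ∃ j, (ρ (j, 1) : ℕ) = k) (Fin.lt_def.1 hlt) ⟨j₀, rfl⟩ (by
      rintro ⟨j, hj⟩
      simpa using ρ.injective (Fin.ext hj))
  obtain ⟨i, hi⟩ : ∃ i, (ρ (i, 0) : ℕ) = k + 1 := by
    obtain ⟨⟨i, b⟩, hb⟩ := ρ.surjective ⟨k + 1, by omega⟩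
    fin_cases b
    · exact ⟨i, congrArg Fin.val hb⟩
    · exact absurd ⟨i, congrArg Fin.val hb⟩ hk1
  have hst : (ρ (i, 0) : ℕ) = ρ (j, 1) + 1 := by omega
  have hfix : ∀ l, l ≠ i → swap (ρ (j, 1)) (ρ (i, 0)) (ρ (l, 0)) = ρ (l, 0) := fun l hl =>
    swap_apply_of_ne_of_ne (by simp) (by simpa using hl)
  refine ⟨ρ.trans (swap (ρ (j, 1)) (ρ (i, 0))), ⟨fun x y hxy => ?_, fun x y hxy => ?_⟩, ?_, ?_⟩
  · exact swap_lt_swap hst (hρ.1 hxy) (by simp)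
  · exact swap_lt_swap hst (hρ.2 hxy) (by simp)
  · rw [twistedSign, twistedSign, pairSign_trans_right, Perm.sign_swap (by simp)]
    rw [← mul_prod_erase univ _ (mem_univ i), ← mul_prod_erase univ _ (mem_univ i)]
    rw [prod_congr rfl fun l hl => by rw [Equiv.trans_apply, hfix l (mem_erase.1 hl).1]]
    simp only [Equiv.trans_apply, swap_apply_right]
    rw [hst, pow_succ]
    simp
  · rw [← add_sum_erase univ _ (mem_univ i), ← add_sum_erase univ _ (mem_univ i)]
    rw [sum_congr rfl fun l hl => by rw [Equiv.trans_apply, hfix l (mem_erase.1 hl).1]]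
    simp only [Equiv.trans_apply, swap_apply_right]
    omega

lemma RowsMono.exists_separated {m : ℕ} {ρ : Fin m × Fin 2 ≃ Fin (2 * m)} (hρ : RowsMono ρ) :
    ∃ τ : Fin m × Fin 2 ≃ Fin (2 * m), RowsMono τ ∧ (∀ i j, τ (i, 0) < τ (j, 1)) ∧ twistedSign τ = twistedSign ρ := by
  induction hn : ∑ i, (ρ (i, 0) : ℕ) generalizing ρ with
  | zero =>
    by_cases h : ∀ i j, ρ (i, 0) < ρ (j, 1)
    · exact ⟨ρ, hρ, h, rfl⟩
    · obtain ⟨τ, -, -, h3⟩ := hρ.exists_lower h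
      omega
  | succ n ih =>
    by_cases h : ∀ i j, ρ (i, 0) < ρ (j, 1)
    · exact ⟨ρ, hρ, h, rfl⟩
    · obtain ⟨τ, h1, h2, h3⟩ := hρ.exists_lower h
      obtain ⟨τ', h1', h2', h3'⟩ := ih h1 (by omega)
      exact ⟨τ', h1', h2', h3'.trans h2⟩

lemma RowsMono.twistedSign_eq_one {m : ℕ} {ρ : Fin m × Fin 2 ≃ Fin (2 * m)} (hρ : RowsMono ρ) :
    twistedSign ρ = 1 := by
  have hid : RowsMono (interleave m) := by
    constructor <;> intro i j hij <;>
      simp only [interleave_zero, interleave_one, Fin.lt_def] at * <;> omega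
  obtain ⟨τ, h1, h2, h3⟩ := hρ.exists_separated
  obtain ⟨τ', h1', h2', h3'⟩ := hid.exists_separated
  rw [← h3, h1.eq_of_separated h1' h2 h2', h3', twistedSign, pairSign]
  simp [interleave_zero, pow_mul]

lemma RowsMono.pairSign_eq {m : ℕ} {ρ : Fin m × Fin 2 ≃ Fin (2 * m)} (hρ : RowsMono ρ) :
    pairSign ρ = ∏ i, (-1 : ℤˣ) ^ (ρ (i, 0) : ℕ) := by
  have h := hρ.twistedSign_eq_one
  rw [twistedSign, mul_eq_one_iff_eq_inv] at h
  rw [h, Int.units_inv_eq_self]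

lemma prod_neg_one_pow_eq_chi {n : ℕ} (S : Finset (Fin n)) :
    ∏ x ∈ S, (-1 : ℤˣ) ^ (x : ℕ) = (-1) ^ chi S := by
  rw [chi, ← prod_const, prod_filter]
  refine prod_congr rfl fun x _ => ?_
  split_ifs with h
  · exact Odd.neg_one_pow (Nat.odd_iff.2 (by omega))
  · exact Even.neg_one_pow (Nat.even_iff.2 (by omega))

lemma card_compl_eq {m : ℕ} {S : Finset (Fin (2 * m))} (hS : S.card = m) : Sᶜ.card = m := by
  rw [card_compl, hS, Fintype.card_fin]; omega

/-- The arrangement with rows `S` and `Sᶜ`, both increasing. -/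
noncomputable def rowsOf {m : ℕ} (S : Finset (Fin (2 * m))) (hS : S.card = m) :
    Fin m × Fin 2 ≃ Fin (2 * m) :=
  Equiv.ofBijective
    (fun p => if p.2 = 0 then S.orderEmbOfFin hS p.1
      else Sᶜ.orderEmbOfFin (card_compl_eq hS) p.1) <| by
    rw [Fintype.bijective_iff_injective_and_card]
    refine ⟨?_, by simp [mul_comm]⟩
    rintro ⟨i, b⟩ ⟨j, c⟩ h
    have hne : ∀ i j, S.orderEmbOfFin hS i ≠ Sᶜ.orderEmbOfFin (card_compl_eq hS) j := by
      intro i j e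
      have := Sᶜ.orderEmbOfFin_mem (card_compl_eq hS) j
      rw [← e, mem_compl] at this
      exact this (S.orderEmbOfFin_mem hS i)
    fin_cases b <;> fin_cases c <;> simp_all
    exact hne _ _ h.symm

lemma rowsOf_zero {m : ℕ} (S : Finset (Fin (2 * m))) (hS : S.card = m) (i : Fin m) :
    rowsOf S hS (i, 0) = S.orderEmbOfFin hS i := rfl

lemma rowsOf_one {m : ℕ} (S : Finset (Fin (2 * m))) (hS : S.card = m) (i : Fin m) :
    rowsOf S hS (i, 1) = Sᶜ.orderEmbOfFin (card_compl_eq hS) i := rfl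

lemma pairSign_rowsOf {m : ℕ} (S : Finset (Fin (2 * m))) (hS : S.card = m) :
    pairSign (rowsOf S hS) = (-1) ^ chi S := by
  rw [RowsMono.pairSign_eq ⟨(S.orderEmbOfFin hS).strictMono,
    (Sᶜ.orderEmbOfFin (card_compl_eq hS)).strictMono⟩, ← prod_neg_one_pow_eq_chi]
  conv_rhs => rw [← image_orderEmbOfFin_univ S hS]
  rw [prod_image fun _ _ _ _ h => (S.orderEmbOfFin hS).injective h]
  rfl

/-- Permute the second row of an arrangement. -/
def permSecond {m : ℕ} (π : Perm (Fin m)) : Perm (Fin m × Fin 2) :=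
  prodCongrLeft ![1, π]

lemma sign_permSecond {m : ℕ} (π : Perm (Fin m)) : Perm.sign (permSecond π) = Perm.sign π := by
  rw [permSecond, Perm.sign_prodCongrLeft]
  simp

lemma det_eq_sum {R : Type*} [CommRing R] {m : ℕ} (a : Matrix (Fin (2 * m)) (Fin (2 * m)) R)
    (S : Finset (Fin (2 * m))) (hS : S.card = m) :
    (-1 : R) ^ chi S * Matrix.det (Matrix.of fun i j : Fin m =>
      a (S.orderEmbOfFin hS i) (Sᶜ.orderEmbOfFin (card_compl_eq hS) j)) =
    ∑ π : Perm (Fin m), pairTerm a ((permSecond π).trans (rowsOf S hS)) := by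
  rw [← Matrix.det_transpose, Matrix.det_apply', mul_sum]
  refine sum_congr rfl fun π _ => ?_
  rw [pairTerm, pairSign_trans_left, pairSign_rowsOf, sign_permSecond]
  simp only [Matrix.transpose_apply, Matrix.of_apply, zsmul_eq_mul, Units.val_mul, Int.cast_mul]
  have h0 : ∀ i, ((permSecond π).trans (rowsOf S hS)) (i, 0) = S.orderEmbOfFin hS i := fun _ => rfl
  have h1 : ∀ i, ((permSecond π).trans (rowsOf S hS)) (i, 1) =
    Sᶜ.orderEmbOfFin (card_compl_eq hS) (π i) := fun _ => rfl
  simp only [h0, h1]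
  push_cast
  ring

lemma bijOn_rowsOf {m : ℕ} :
    Set.BijOn (fun p : {S : Finset (Fin (2 * m)) // S.card = m} × Perm (Fin m) =>
      (permSecond p.2).trans (rowsOf p.1.1 p.1.2)) Set.univ
      {ρ | StrictMono fun i => ρ (i, 0)} := by
  refine ⟨fun p _ => (p.1.1.orderEmbOfFin p.1.2).strictMono, ?_, ?_⟩
  · rintro ⟨⟨S, hS⟩, π⟩ - ⟨⟨T, hT⟩, π'⟩ - h
    have h0 : ∀ i, S.orderEmbOfFin hS i = T.orderEmbOfFin hT i := fun i =>
      Equiv.congr_fun h (i, 0)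
    have hST : S = T := by
      rw [← image_orderEmbOfFin_univ S hS, ← image_orderEmbOfFin_univ T hT]
      exact image_congr fun i _ => h0 i
    subst hST
    have h1 : ∀ i, Sᶜ.orderEmbOfFin (card_compl_eq hS) (π i) =
      Sᶜ.orderEmbOfFin (card_compl_eq hS) (π' i) := fun i => Equiv.congr_fun h (i, 1)
    have : π = π' := Equiv.ext fun i => (Sᶜ.orderEmbOfFin _).injective (h1 i)
    rw [this]
  · intro ρ hρ
    have hρ : StrictMono fun i => ρ (i, 0) := hρ
    obtain ⟨S, hSdef⟩ : ∃ S, S = univ.image fun i => ρ (i, 0) := ⟨_, rfl⟩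
    have hS : S.card = m := by rw [hSdef, card_image_of_injective _ hρ.injective]; simp
    have h0 : (fun i => ρ (i, 0)) = S.orderEmbOfFin hS :=
      orderEmbOfFin_unique hS (fun i => by simp [hSdef]) hρ
    have hmem : ∀ i, ρ (i, 1) ∈ Sᶜ := fun i => by simp [hSdef]
    let e := Sᶜ.orderIsoOfFin (card_compl_eq hS)
    have hinj : Function.Injective fun i => e.symm ⟨ρ (i, 1), hmem i⟩ := by
      intro i j h
      simpa using h
    refine ⟨⟨⟨S, hS⟩, Equiv.ofBijective _ (Finite.injective_iff_bijective.1 hinj)⟩, trivial, ?_⟩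
    refine Equiv.ext ?_
    rintro ⟨i, b⟩
    fin_cases b
    · exact (congrFun h0 i).symm
    · exact congrArg Subtype.val (e.apply_symm_apply ⟨ρ (i, 1), hmem i⟩)

lemma sum_det_eq_sum {R : Type*} [CommRing R] {m : ℕ}
    (a : Matrix (Fin (2 * m)) (Fin (2 * m)) R) :
    ∑ S : {S : Finset (Fin (2 * m)) // S.card = m},
      ∑ π : Perm (Fin m), pairTerm a ((permSecond π).trans (rowsOf S.1 S.2)) =
    ∑ ρ : Fin m × Fin 2 ≃ Fin (2 * m) with StrictMono fun i => ρ (i, 0), pairTerm a ρ := by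
  rw [← Fintype.sum_prod_type']
  exact sum_nbij (fun p : {S : Finset (Fin (2 * m)) // S.card = m} × Perm (Fin m) =>
      (permSecond p.2).trans (rowsOf p.1.1 p.1.2))
    (fun p _ => mem_filter.2 ⟨mem_univ _, bijOn_rowsOf.mapsTo trivial⟩)
    (by simpa using bijOn_rowsOf.injOn) (by simpa using bijOn_rowsOf.surjOn) fun _ _ => rfl

end PfaffianDet

theorem pfaffian_as_sum_of_determinants {R : Type*} [CommRing R] (m : ℕ)
    (a : Matrix (Fin (2 * m)) (Fin (2 * m)) R) :
    pfaff (fun i j => a i j - a j i) =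
      ∑ S : {S : Finset (Fin (2 * m)) // S.card = m},
        (-1 : R) ^ chi S.1 *
          Matrix.det (Matrix.of fun i j : Fin m =>
            a (S.1.orderEmbOfFin S.2 i)
              ((S.1ᶜ).orderEmbOfFin
                (by rw [Finset.card_compl, S.2, Fintype.card_fin]; omega) j)) := by
  rw [PfaffianDet.pfaff_eq_sum, ← PfaffianDet.sum_det_eq_sum]
  exact sum_congr rfl fun S _ => (PfaffianDet.det_eq_sum a S.1 S.2).symm
end

section
/- For elements a, b, c, x_i in a field (1 ≤ i ≤ 2m) with a + b(x_i + x_j) + c x_i x_j ≠ 0 for all i < j, the Pfaffian of the skew-symmetric matrix with entries (x_j − x_i)/(a + b(x_i + x_j) + c x_i x_j) equals (b² − ac)^{m(m−1)} · Π_{1≤i<j≤2m} (x_j − x_i)/(a + b(x_i + x_j) + c x_i x_j). -/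
open Finset

/-- The product of `g i j` over all pairs `i < j`. -/
def prodPairs {R : Type*} [CommRing R] {n : ℕ} (g : Fin n → Fin n → R) : R :=
  ∏ p ∈ Finset.univ.filter (fun p : Fin n × Fin n => p.1 < p.2), g p.1 p.2

/-- The symmetric bilinear polynomial `a + b (x + y) + c x y`. -/
def symForm {R : Type*} [CommRing R] (a b c x y : R) : R := a + b * (x + y) + c * x * y

section prodPairs

variable {R : Type*} [CommRing R]

theorem symForm_comm (a b c x y : R) : symForm a b c x y = symForm a b c y x := by
  unfold symForm; ring

theorem prodPairs_eq_prod_prod {n : ℕ} (g : Fin n → Fin n → R) :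
    prodPairs g = ∏ i, ∏ j, if i < j then g i j else 1 := by
  rw [prodPairs, Finset.prod_filter, Fintype.prod_prod_type]

theorem map_prodPairs {S : Type*} [CommRing S] (φ : R →+* S) {n : ℕ} (g : Fin n → Fin n → R) :
    φ (prodPairs g) = prodPairs fun i j => φ (g i j) :=
  map_prod φ _ _

theorem prodPairs_succ {n : ℕ} (g : Fin (n + 1) → Fin (n + 1) → R) :
    prodPairs g = (∏ k : Fin n, g 0 k.succ) * prodPairs fun i k => g i.succ k.succ := by
  simp [prodPairs_eq_prod_prod, Fin.prod_univ_succ]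

theorem prodPairs_succAbove {n : ℕ} (g : Fin (n + 1) → Fin (n + 1) → R) (j : Fin (n + 1)) :
    prodPairs g = (∏ k : Fin n, if k.castSucc < j then g (j.succAbove k) j
      else g j (j.succAbove k)) * prodPairs fun i k => g (j.succAbove i) (j.succAbove k) := by
  simp only [prodPairs_eq_prod_prod]
  rw [Fin.prod_univ_succAbove _ j]
  simp only [Fin.prod_univ_succAbove _ j, lt_irrefl, if_false, one_mul,
    Fin.succAbove_lt_succAbove_iff, Finset.prod_mul_distrib]
  rw [← mul_assoc, ← Finset.prod_mul_distrib]
  congr 1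
  refine Finset.prod_congr rfl fun k _ => ?_
  simp only [Fin.succAbove_lt_iff_castSucc_lt, Fin.lt_succAbove_iff_le_castSucc]
  by_cases hk : k.castSucc < j
  · simp [hk, not_le.mpr hk]
  · simp [hk, not_lt.mp hk]

theorem prodPairs_succAbove_of_symm {n : ℕ} (g : Fin (n + 1) → Fin (n + 1) → R)
    (hg : ∀ i k, g i k = g k i) (j : Fin (n + 1)) :
    prodPairs g = (∏ k : Fin n, g j (j.succAbove k)) *
      prodPairs fun i k => g (j.succAbove i) (j.succAbove k) := by
  rw [prodPairs_succAbove g j]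
  congr 1
  exact Finset.prod_congr rfl fun k _ => by rw [hg (j.succAbove k) j, ite_self]

theorem prodPairs_succAbove_of_antisymm {n : ℕ} (g : Fin (n + 1) → Fin (n + 1) → R)
    (hg : ∀ i k, g i k = -g k i) (j : Fin (n + 1)) :
    prodPairs g = (-1) ^ (j : ℕ) * (∏ k : Fin n, g j (j.succAbove k)) *
      prodPairs fun i k => g (j.succAbove i) (j.succAbove k) := by
  rw [prodPairs_succAbove g j]
  congr 1
  have hcard : (Finset.univ.filter fun k : Fin n => k.castSucc < j).card = j := by
    have h := Fin.card_filter_val_lt (n := n) (m := j)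
    rw [min_eq_right (Nat.lt_succ_iff.mp j.isLt)] at h
    exact h
  calc _ = ∏ k : Fin n, (if k.castSucc < j then (-1 : R) else 1) * g j (j.succAbove k) :=
        Finset.prod_congr rfl fun k _ => by
          split_ifs
          · rw [hg (j.succAbove k) j]; ring
          · ring
    _ = _ := by
        rw [Finset.prod_mul_distrib, Finset.prod_ite, Finset.prod_const_one,
          Finset.prod_const, hcard, mul_one]

end prodPairs

section interpolation

open Polynomial

theorem coeff_eq_sum_succAbove {F : Type*} [Field F] {n : ℕ} {v : Fin (n + 1) → F}
    (hv : Function.Injective v) {P : F[X]} (hP : P.natDegree ≤ n) :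
    P.coeff n = ∑ i, P.eval (v i) / ∏ k, (v i - v (i.succAbove k)) := by
  have h := Lagrange.coeff_eq_sum (s := Finset.univ) hv.injOn (P := P)
    (Polynomial.degree_le_natDegree.trans_lt (by
      rw [Finset.card_univ, Fintype.card_fin]
      exact_mod_cast Nat.lt_succ_of_le hP))
  rw [Finset.card_univ, Fintype.card_fin, Nat.add_sub_cancel] at h
  rw [h]
  refine Finset.sum_congr rfl fun i _ => ?_
  congr 1
  rw [← Finset.compl_singleton, ← Fin.image_succAbove_univ,
    Finset.prod_image fun _ _ _ _ h => Fin.succAbove_right_injective h]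

variable {F : Type*} [Field F] (a b c : F)

theorem symForm_dvd_prod_symForm_add {R : Type*} [CommRing R] (a b c t : R) {m : ℕ}
    (y : Fin (2 * m + 1) → R) :
    symForm a b c t t ∣ (∏ k, symForm a b c t (y k)) +
      (b ^ 2 - a * c) ^ m * (b + c * t) * ∏ k, (t - y k) := by
  rw [← Ideal.mem_span_singleton, ← Ideal.Quotient.eq_zero_iff_mem]
  set π := Ideal.Quotient.mk (Ideal.span {symForm a b c t t})
  have hQ : π (symForm a b c t t) = 0 :=
    Ideal.Quotient.eq_zero_iff_mem.mpr (Ideal.mem_span_singleton_self _)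
  have h1 : ∀ k, π (symForm a b c t (y k)) = -π (b + c * t) * π (t - y k) := fun k => by
    have : symForm a b c t (y k) = -(b + c * t) * (t - y k) + symForm a b c t t := by
      unfold symForm; ring
    rw [this, map_add, hQ, add_zero, map_mul, map_neg]
  have h2 : π (b ^ 2 - a * c) = π (b + c * t) ^ 2 := by
    have : b ^ 2 - a * c = (b + c * t) ^ 2 - c * symForm a b c t t := by
      unfold symForm; ring
    rw [this, map_sub, map_mul, hQ, mul_zero, sub_zero, map_pow]
  rw [map_add, map_mul, map_mul]
  simp only [map_prod, map_pow, h1, h2, Finset.prod_mul_distrib,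
    Finset.prod_const, Finset.card_univ, Fintype.card_fin]
  rw [(odd_two_mul_add_one m).neg_pow]
  ring

/-- The quotient in `symForm_dvd_prod_symForm_add`, as a polynomial in `t`, has degree at most
`2 * m`, with coefficient `(b ^ 2 - a * c) ^ m` there. -/
theorem exists_interpolant (hc : c ≠ 0) {m : ℕ} (y : Fin (2 * m + 1) → F) :
    ∃ q : F[X], q.natDegree ≤ 2 * m ∧ q.coeff (2 * m) = (b ^ 2 - a * c) ^ m ∧
      ∀ t, symForm a b c t t * q.eval t = (∏ k, symForm a b c t (y k)) +
        (b ^ 2 - a * c) ^ m * (b + c * t) * ∏ k, (t - y k) := by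
  obtain ⟨q, hq⟩ := symForm_dvd_prod_symForm_add (C a) (C b) (C c) (X : F[X]) fun k => C (y k)
  have hQ : symForm (C a) (C b) (C c) (X : F[X]) X = C c * X ^ 2 + C (2 * b) * X + C a := by
    simp only [symForm, C_mul, C_ofNat]; ring
  have heval : ∀ t, symForm a b c t t * q.eval t = (∏ k, symForm a b c t (y k)) +
      (b ^ 2 - a * c) ^ m * (b + c * t) * ∏ k, (t - y k) := fun t => by
    have h := congrArg (eval t) hq
    rw [eval_mul, eval_add, eval_mul, eval_mul, eval_prod, eval_prod] at h
    simpa [symForm] using h.symm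
  have hprod : (∏ k, symForm (C a) (C b) (C c) (X : F[X]) (C (y k))).natDegree ≤ 2 * m + 1 := by
    refine (natDegree_prod_le _ _).trans ?_
    refine (Finset.sum_le_card_nsmul _ _ 1 fun k _ => ?_).trans (by simp)
    unfold symForm
    compute_degree
  have hnodal : (∏ k, (X - C (y k)) : F[X]).natDegree = 2 * m + 1 := by
    rw [natDegree_finsetProd_X_sub_C_eq_card]; simp
  have hmonic : (∏ k, (X - C (y k)) : F[X]).coeff (2 * m + 1) = 1 := by
    have h := monic_prod_X_sub_C y Finset.univ
    rwa [Monic, leadingCoeff, hnodal] at h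
  have hlin : (C b + C c * X : F[X]).natDegree ≤ 1 := by compute_degree
  have hK : ((C b ^ 2 - C a * C c) ^ m : F[X]) = C ((b ^ 2 - a * c) ^ m) := by simp
  rw [hK, mul_assoc] at hq
  set N : F[X] := ∏ k, (X - C (y k))
  set D : F[X] := ∏ k, symForm (C a) (C b) (C c) (X : F[X]) (C (y k))
  have hdeg : (D + C ((b ^ 2 - a * c) ^ m) * ((C b + C c * X) * N)).natDegree ≤
      1 + (2 * m + 1) := by
    refine natDegree_add_le_of_degree_le (hprod.trans (by omega)) ?_
    exact (natDegree_C_mul_le _ _).trans (natDegree_mul_le_of_le hlin hnodal.le)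
  have hcoeff : (D + C ((b ^ 2 - a * c) ^ m) * ((C b + C c * X) * N)).coeff (1 + (2 * m + 1)) =
      c * (b ^ 2 - a * c) ^ m := by
    rw [coeff_add, coeff_C_mul, coeff_mul_add_eq_of_natDegree_le hlin hnodal.le, hmonic,
      coeff_eq_zero_of_natDegree_lt (hprod.trans_lt (by omega))]
    have hlinc : (C b + C c * X : F[X]).coeff 1 = c := by simp
    rw [hlinc, zero_add, mul_one, mul_comm]
  have hQdeg : (symForm (C a) (C b) (C c) (X : F[X]) X).natDegree = 2 := by
    rw [hQ]; exact natDegree_quadratic hc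
  have hqdeg : q.natDegree ≤ 2 * m := by
    by_cases hq0 : q = 0
    · simp [hq0]
    have hQ0 : symForm (C a) (C b) (C c) (X : F[X]) X ≠ 0 := fun h0 => by
      simp [h0] at hQdeg
    rw [hq, natDegree_mul hQ0 hq0, hQdeg] at hdeg
    omega
  refine ⟨q, hqdeg, ?_, fun t => ?_⟩
  · rw [hq, show 1 + (2 * m + 1) = 2 + 2 * m by ring,
      coeff_mul_add_eq_of_natDegree_le hQdeg.le hqdeg] at hcoeff
    have hQc : (symForm (C a) (C b) (C c) (X : F[X]) X).coeff 2 = c := by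
      rw [hQ]; simp
    rw [hQc] at hcoeff
    exact mul_left_cancel₀ hc hcoeff
  · exact heval t

theorem sum_interpolation (hc : c ≠ 0) (hK : b ^ 2 - a * c ≠ 0) {m : ℕ} (z : F)
    (y : Fin (2 * m + 1) → F) (hy : Function.Injective y) (hbz : b + c * z ≠ 0)
    (hzy : ∀ j, symForm a b c z (y j) ≠ 0)
    (hyy : ∀ j, symForm a b c (y j) (y j) ≠ 0) :
    ∑ j, (z - y j) / symForm a b c z (y j) *
        ∏ k, symForm a b c (y j) (y (j.succAbove k)) / (y j - y (j.succAbove k)) =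
      (b ^ 2 - a * c) ^ (2 * m) * ∏ j, (z - y j) / symForm a b c z (y j) := by
  obtain ⟨q, hqdeg, hqcoeff, hq⟩ := exists_interpolant a b c hc y
  set K := b ^ 2 - a * c with hKdef
  set w : F := -(a + b * z) / (b + c * z)
  have hsw : (b + c * z) * w = -(a + b * z) := mul_div_cancel₀ _ hbz
  have hzt : ∀ t, symForm a b c z t = (b + c * z) * (t - w) := fun t => by
    rw [symForm]; linear_combination hsw
  have hwt : ∀ t, symForm a b c w t = K * (t - z) / (b + c * z) := fun t => by
    rw [symForm, eq_div_iff hbz]; linear_combination (b + c * t) * hsw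
  have hbw : b + c * w = K / (b + c * z) := by
    rw [eq_div_iff hbz]; linear_combination c * hsw
  clear_value w
  generalize b + c * z = s at hbz hzt hwt hbw
  have hyw : ∀ j, y j - w ≠ 0 := fun j h0 => hzy j (by rw [hzt, h0, mul_zero])
  have hv : Function.Injective (Fin.cons w y : Fin (2 * m + 2) → F) := by
    rw [Fin.cons_injective_iff]
    exact ⟨fun ⟨j, hj⟩ => hyw j (by rw [hj, sub_self]), hy⟩
  have hlin : (C z - X : F[X]).natDegree ≤ 1 := by compute_degree
  have hsum := coeff_eq_sum_succAbove hv (P := q * (C z - X))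
    (natDegree_mul_le_of_le hqdeg hlin)
  have hX : (C z - X : F[X]).coeff 1 = -1 := by simp [coeff_X]
  rw [coeff_mul_add_eq_of_natDegree_le hqdeg hlin, hqcoeff, hX, Fin.sum_univ_succ] at hsum
  simp only [Fin.cons_zero, Fin.cons_succ, Fin.zero_succAbove, eval_mul, eval_sub, eval_C,
    eval_X] at hsum
  have hterm : ∀ j : Fin (2 * m + 1), eval (y j) q * (z - y j) /
      ∏ k : Fin (2 * m + 1), (y j - (Fin.cons w y : Fin (2 * m + 2) → F) (j.succ.succAbove k)) =
      s * ((z - y j) / symForm a b c z (y j) *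
        ∏ k, symForm a b c (y j) (y (j.succAbove k)) / (y j - y (j.succAbove k))) := fun j => by
    have hqj : eval (y j) q = ∏ k, symForm a b c (y j) (y (j.succAbove k)) := by
      have h := hq (y j)
      rw [Finset.prod_eq_zero (f := fun k => y j - y k) (Finset.mem_univ j) (sub_self (y j)),
        mul_zero, add_zero, Fin.prod_univ_succAbove _ j] at h
      exact mul_left_cancel₀ (hyy j) h
    have hne : ∏ k, (y j - y (j.succAbove k)) ≠ 0 := Finset.prod_ne_zero_iff.mpr fun k _ =>
      sub_ne_zero.mpr fun h => Fin.succAbove_ne j k (hy h).symm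
    rw [Fin.prod_univ_succ]
    simp only [Fin.succ_succAbove_zero, Fin.succ_succAbove_succ, Fin.cons_zero, Fin.cons_succ]
    rw [hqj, hzt, Finset.prod_div_distrib]
    have := hyw j
    field_simp
  rw [Finset.sum_congr rfl fun j _ => hterm j, ← Finset.mul_sum] at hsum
  have hN : ∏ k, (w - y k) ≠ 0 := Finset.prod_ne_zero_iff.mpr fun k _ h =>
    hyw k (by rw [← neg_sub, h, neg_zero])
  have hqw : eval w q * (z - w) = K ^ (2 * m) * (∏ k, (z - y k)) / s ^ (2 * m) -
      K ^ m * ∏ k, (w - y k) := by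
    have h := hq w
    have hp : ∏ k, symForm a b c w (y k) =
        -(K ^ (2 * m + 1) * ∏ k, (z - y k)) / s ^ (2 * m + 1) := by
      have : ∀ k, symForm a b c w (y k) = (-K / s) * (z - y k) := fun k => by
        rw [hwt]; ring
      simp only [this, Finset.prod_mul_distrib, Finset.prod_const, Finset.card_univ,
        Fintype.card_fin]
      rw [div_pow, (odd_two_mul_add_one m).neg_pow]
      ring
    rw [hp, hwt, hbw] at h
    have hKs : -K / s ≠ 0 := div_ne_zero (neg_ne_zero.mpr hK) hbz
    refine mul_left_cancel₀ hKs ?_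
    refine Eq.trans ?_ (h.trans ?_)
    · ring
    · field_simp
      ring
  have hR : ∏ j, (z - y j) / symForm a b c z (y j) =
      -(∏ k, (z - y k)) / (s ^ (2 * m + 1) * ∏ k, (w - y k)) := by
    have : ∀ k, symForm a b c z (y k) = -s * (w - y k) := fun k => by
      rw [hzt]; ring
    simp only [this, Finset.prod_div_distrib, Finset.prod_mul_distrib, Finset.prod_const,
      Finset.card_univ, Fintype.card_fin]
    rw [(odd_two_mul_add_one m).neg_pow, neg_mul, div_neg, neg_div]
  rw [hqw] at hsum
  refine mul_left_cancel₀ hbz ?_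
  rw [← sub_eq_iff_eq_add'.mpr hsum, hR]
  field_simp
  ring

end interpolation

section pfaff

variable {R : Type*} [CommRing R]

theorem exists_decomposeFin_symm_zero {n : ℕ} (σ : Equiv.Perm (Fin (n + 1))) (h : σ 0 = 0) :
    ∃ τ, Equiv.Perm.decomposeFin.symm (0, τ) = σ := by
  refine ⟨(Equiv.Perm.decomposeFin σ).2, ?_⟩
  obtain ⟨⟨p, τ⟩, rfl⟩ := Equiv.Perm.decomposeFin.symm.surjective σ
  rw [Equiv.Perm.decomposeFin_symm_apply_zero] at h
  simp [h]

/-- The permutation of `Fin (n + 2)` with first two values `0` and `j.succ`, followed by the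
remaining values in the order prescribed by `ρ`. -/
def permCons {n : ℕ} (j : Fin (n + 1)) (ρ : Equiv.Perm (Fin n)) : Equiv.Perm (Fin (n + 2)) :=
  Equiv.Perm.decomposeFin.symm
    (0, j.cycleRange.symm * Equiv.Perm.decomposeFin.symm (0, ρ))

theorem permCons_zero {n : ℕ} (j : Fin (n + 1)) (ρ : Equiv.Perm (Fin n)) :
    permCons j ρ 0 = 0 := by
  simp [permCons]

theorem permCons_one {n : ℕ} (j : Fin (n + 1)) (ρ : Equiv.Perm (Fin n)) :
    permCons j ρ (Fin.succ 0) = j.succ := by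
  rw [permCons, Equiv.Perm.decomposeFin_symm_apply_succ]
  simp

theorem permCons_succ_succ {n : ℕ} (j : Fin (n + 1)) (ρ : Equiv.Perm (Fin n)) (k : Fin n) :
    permCons j ρ k.succ.succ = (j.succAbove (ρ k)).succ := by
  rw [permCons, Equiv.Perm.decomposeFin_symm_apply_succ, Equiv.Perm.mul_apply,
    Equiv.Perm.decomposeFin_symm_apply_succ]
  simp

theorem sign_permCons {n : ℕ} (j : Fin (n + 1)) (ρ : Equiv.Perm (Fin n)) :
    (Equiv.Perm.sign (permCons j ρ) : ℤ) = (-1) ^ (j : ℕ) * Equiv.Perm.sign ρ := by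
  simp [permCons, Equiv.Perm.decomposeFin.symm_sign, Fin.sign_cycleRange]

theorem permCons_injective {n : ℕ} {j j' : Fin (n + 1)} {ρ ρ' : Equiv.Perm (Fin n)}
    (h : permCons j ρ = permCons j' ρ') : j = j' ∧ ρ = ρ' := by
  have hj : j = j' := by
    have := congrArg (fun σ => σ (Fin.succ 0)) h
    simp only [permCons_one] at this
    exact Fin.succ_injective _ this
  subst hj
  refine ⟨rfl, ?_⟩
  ext1 k
  have := congrArg (fun σ => σ k.succ.succ) h
  simpa [permCons_succ_succ] using this

theorem exists_permCons {n : ℕ} (σ : Equiv.Perm (Fin (n + 2))) (h : σ 0 = 0) :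
    ∃ j ρ, permCons j ρ = σ := by
  obtain ⟨τ, rfl⟩ := exists_decomposeFin_symm_zero σ h
  obtain ⟨ρ, hρ⟩ := exists_decomposeFin_symm_zero ((τ 0).cycleRange * τ) (by simp)
  refine ⟨τ 0, ρ, ?_⟩
  rw [permCons, hρ]
  congr 2
  ext1 k
  simp

/-- The permutations that represent perfect matchings in the definition of `pfaff`. -/
def IsMatchingPerm {m : ℕ} (σ : Equiv.Perm (Fin (2 * m))) : Prop :=
  (∀ i : Fin m, σ ⟨2 * (i : ℕ), by omega⟩ < σ ⟨2 * (i : ℕ) + 1, by omega⟩) ∧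
    StrictMono (fun i : Fin m => σ ⟨2 * (i : ℕ), by omega⟩)

theorem IsMatchingPerm.apply_zero {m : ℕ} {σ : Equiv.Perm (Fin (2 * (m + 1)))}
    (h : IsMatchingPerm σ) : σ (0 : Fin (2 * m + 2)) = (0 : Fin (2 * m + 2)) := by
  obtain ⟨p, hp⟩ := σ.surjective (0 : Fin (2 * m + 2))
  have hle : ∀ i : Fin (m + 1), σ (0 : Fin (2 * m + 2)) ≤ σ ⟨2 * (i : ℕ), by omega⟩ := fun i =>
    h.2.monotone (Fin.zero_le i)
  have hle' : σ (0 : Fin (2 * m + 2)) ≤ σ p := by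
    rcases Nat.even_or_odd' (p : ℕ) with ⟨k, hk | hk⟩
    · have : p = ⟨2 * k, by omega⟩ := Fin.ext hk
      rw [this]
      exact hle ⟨k, by omega⟩
    · have : p = ⟨2 * k + 1, by omega⟩ := Fin.ext hk
      rw [this]
      exact (hle ⟨k, by omega⟩).trans (h.1 ⟨k, by omega⟩).le
  rw [hp] at hle'
  exact le_antisymm hle' (Fin.zero_le _)

theorem isMatchingPerm_permCons {m : ℕ} (j : Fin (2 * m + 1)) (ρ : Equiv.Perm (Fin (2 * m))) :
    IsMatchingPerm (m := m + 1) (permCons j ρ) ↔ IsMatchingPerm ρ := by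
  have hev : ∀ i : Fin m, permCons j ρ ⟨2 * ((i.succ : Fin (m + 1)) : ℕ), by simp; omega⟩ =
      (j.succAbove (ρ ⟨2 * (i : ℕ), by omega⟩)).succ := fun i =>
    permCons_succ_succ j ρ ⟨2 * (i : ℕ), by omega⟩
  have hodd : ∀ i : Fin m,
      permCons j ρ ⟨2 * ((i.succ : Fin (m + 1)) : ℕ) + 1, by simp⟩ =
      (j.succAbove (ρ ⟨2 * (i : ℕ) + 1, by omega⟩)).succ := fun i =>
    permCons_succ_succ j ρ ⟨2 * (i : ℕ) + 1, by omega⟩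
  have hzero : permCons j ρ ⟨2 * ((0 : Fin (m + 1)) : ℕ), by simp⟩ = 0 := permCons_zero j ρ
  have hone : permCons j ρ ⟨2 * ((0 : Fin (m + 1)) : ℕ) + 1, by simp⟩ = j.succ :=
    permCons_one j ρ
  constructor
  · rintro ⟨h1, h2⟩
    refine ⟨fun i => ?_, fun i i' hi => ?_⟩
    · have := (hev i).symm.trans_lt ((h1 i.succ).trans_eq (hodd i))
      simpa using this
    · have := (hev i).symm.trans_lt ((h2 (Fin.succ_lt_succ_iff.mpr hi)).trans_eq (hev i'))
      simpa using this
  · rintro ⟨h1, h2⟩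
    refine ⟨fun i => ?_, fun i i' hi => ?_⟩
    · induction i using Fin.cases with
      | zero => exact hzero.trans_lt ((Fin.succ_pos j).trans_eq hone.symm)
      | succ i => exact (hev i).trans_lt (lt_of_lt_of_eq (by simpa using h1 i) (hodd i).symm)
    · induction i' using Fin.cases with
      | zero => exact absurd hi (Fin.not_lt_zero i)
      | succ i' =>
        induction i using Fin.cases with
        | zero => exact hzero.trans_lt ((Fin.succ_pos _).trans_eq (hev i').symm)
        | succ i =>
          exact (hev i).trans_lt
            (lt_of_lt_of_eq (by simpa using h2 (Fin.succ_lt_succ_iff.mp hi)) (hev i').symm)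

/-- Expansion of the Pfaffian along the first row. -/
theorem pfaff_succ {m : ℕ} (A : Matrix (Fin (2 * m + 2)) (Fin (2 * m + 2)) R) :
    pfaff (m := m + 1) A = ∑ j : Fin (2 * m + 1), (-1) ^ (j : ℕ) * A 0 j.succ *
      pfaff (m := m) fun i k => A (j.succAbove i).succ (j.succAbove k).succ := by
  classical
  simp only [pfaff, Finset.mul_sum]
  rw [← Finset.sum_product']
  symm
  refine Finset.sum_bij (fun q _ => permCons q.1 q.2) ?_ ?_ ?_ ?_
  · rintro ⟨j, ρ⟩ h
    rw [Finset.mem_product, Finset.mem_filter] at h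
    exact Finset.mem_filter.mpr ⟨Finset.mem_univ _, (isMatchingPerm_permCons j ρ).mpr h.2.2⟩
  · rintro ⟨j, ρ⟩ _ ⟨j', ρ'⟩ _ h
    obtain ⟨rfl, rfl⟩ := permCons_injective h
    rfl
  · intro σ hσ
    have hσ' : IsMatchingPerm σ := (Finset.mem_filter.mp hσ).2
    obtain ⟨j, ρ, rfl⟩ := exists_permCons (n := 2 * m) σ hσ'.apply_zero
    refine ⟨(j, ρ), ?_, rfl⟩
    rw [Finset.mem_product, Finset.mem_filter]
    exact ⟨Finset.mem_univ _, Finset.mem_univ _, (isMatchingPerm_permCons j ρ).mp hσ'⟩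
  · rintro ⟨j, ρ⟩ _
    have hprod : ∏ i : Fin (m + 1), A (permCons j ρ ⟨2 * (i : ℕ), by omega⟩)
          (permCons j ρ ⟨2 * (i : ℕ) + 1, by omega⟩) =
        A 0 j.succ * ∏ i : Fin m, A (j.succAbove (ρ ⟨2 * (i : ℕ), by omega⟩)).succ
          (j.succAbove (ρ ⟨2 * (i : ℕ) + 1, by omega⟩)).succ := by
      rw [Fin.prod_univ_succ]
      refine congrArg₂ _ (congrArg₂ A (permCons_zero j ρ) (permCons_one j ρ))
        (Finset.prod_congr rfl fun i _ => congrArg₂ A ?_ ?_)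
      · exact permCons_succ_succ j ρ ⟨2 * (i : ℕ), by omega⟩
      · exact permCons_succ_succ j ρ ⟨2 * (i : ℕ) + 1, by omega⟩
    refine Eq.trans ?_ (congrArg₂ (fun (s : ℤ) (t : R) => s • t) (sign_permCons j ρ) hprod).symm
    simp only [zsmul_eq_mul]
    push_cast
    ring

end pfaff

section rowIdentity

/-- The difference of the two sides of the polynomial identity that expresses the recursion of
the Pfaffian along its first row. -/
def rowDefect {R : Type*} [CommRing R] (a b c z : R) {m : ℕ} (y : Fin (2 * m + 1) → R) : R :=
  (∑ j : Fin (2 * m + 1), (-1) ^ (j : ℕ) * (y j - z) * (∏ k, symForm a b c z (y (j.succAbove k))) *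
      (∏ k, symForm a b c (y j) (y (j.succAbove k))) *
      prodPairs fun i k => y (j.succAbove k) - y (j.succAbove i)) -
    (b ^ 2 - a * c) ^ (2 * m) * (∏ j, (y j - z)) * prodPairs fun i k => y k - y i

theorem map_symForm {R S : Type*} [CommRing R] [CommRing S] (φ : R →+* S) (a b c x y : R) :
    φ (symForm a b c x y) = symForm (φ a) (φ b) (φ c) (φ x) (φ y) := by
  simp [symForm]

theorem map_rowDefect {R S : Type*} [CommRing R] [CommRing S] (φ : R →+* S) (a b c z : R)
    {m : ℕ} (y : Fin (2 * m + 1) → R) :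
    φ (rowDefect a b c z y) = rowDefect (φ a) (φ b) (φ c) (φ z) fun j => φ (y j) := by
  simp only [rowDefect, map_sub, map_sum, map_mul, map_prod, map_pow, map_neg, map_one,
    map_symForm, map_prodPairs]

theorem rowDefect_eq_zero_of_ne {F : Type*} [Field F] (a b c : F) (hc : c ≠ 0)
    (hK : b ^ 2 - a * c ≠ 0) {m : ℕ} (z : F) (y : Fin (2 * m + 1) → F)
    (hy : Function.Injective y) (hbz : b + c * z ≠ 0)
    (hzy : ∀ j, symForm a b c z (y j) ≠ 0) (hyy : ∀ j, symForm a b c (y j) (y j) ≠ 0) :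
    rowDefect a b c z y = 0 := by
  have hsum := sum_interpolation a b c hc hK z y hy hbz hzy hyy
  have hD : ∏ j, symForm a b c z (y j) ≠ 0 := Finset.prod_ne_zero_iff.mpr fun j _ => hzy j
  have hterm : ∀ j : Fin (2 * m + 1),
      (-1) ^ (j : ℕ) * (y j - z) * (∏ k, symForm a b c z (y (j.succAbove k))) *
        (∏ k, symForm a b c (y j) (y (j.succAbove k))) *
        (prodPairs fun i k => y (j.succAbove k) - y (j.succAbove i)) =
      (-((∏ j, symForm a b c z (y j)) * prodPairs fun i k => y k - y i)) *
        ((z - y j) / symForm a b c z (y j) *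
        ∏ k, symForm a b c (y j) (y (j.succAbove k)) / (y j - y (j.succAbove k))) := fun j => by
    have hne : ∏ k, (y j - y (j.succAbove k)) ≠ 0 := Finset.prod_ne_zero_iff.mpr fun k _ =>
      sub_ne_zero.mpr fun h => Fin.succAbove_ne j k (hy h).symm
    have hneg : ∏ k, (y (j.succAbove k) - y j) = ∏ k, (y j - y (j.succAbove k)) := by
      simp only [← neg_sub (y j)]
      rw [Finset.prod_neg, Finset.card_univ, Fintype.card_fin, (even_two_mul m).neg_one_pow,
        one_mul]
    rw [prodPairs_succAbove_of_antisymm (fun i k => y k - y i) (fun _ _ => (neg_sub _ _).symm) j,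
      hneg, Fin.prod_univ_succAbove _ j, Finset.prod_div_distrib]
    have := hzy j
    field_simp
    ring
  rw [rowDefect, Finset.sum_congr rfl fun j _ => hterm j, ← Finset.mul_sum, hsum,
    Finset.prod_div_distrib]
  have hneg : ∏ j, (z - y j) = -∏ j, (y j - z) := by
    simp only [← neg_sub _ z]
    rw [Finset.prod_neg, Finset.card_univ, Fintype.card_fin,
      (odd_two_mul_add_one m).neg_one_pow, neg_one_mul]
  rw [hneg]
  field_simp
  ring

theorem rowDefect_eq_zero {R : Type*} [CommRing R] (a b c z : R) {m : ℕ}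
    (y : Fin (2 * m + 1) → R) : rowDefect a b c z y = 0 := by
  let S := MvPolynomial (Fin 4 ⊕ Fin (2 * m + 1)) ℤ
  let ι : S →+* FractionRing S := algebraMap S (FractionRing S)
  have hι : Function.Injective ι := IsFractionRing.injective S (FractionRing S)
  let X : Fin 4 ⊕ Fin (2 * m + 1) → S := MvPolynomial.X
  have hne : ∀ (p : S) (v : Fin 4 ⊕ Fin (2 * m + 1) → ℤ), MvPolynomial.eval v p ≠ 0 →
      ι p ≠ 0 := fun p v hv h0 => hv (by rw [(map_eq_zero_iff ι hι).mp h0, map_zero])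
  have hX : ∀ v i, MvPolynomial.eval v (X i) = v i := fun v i => MvPolynomial.eval_X i
  have hgen : rowDefect (X (.inl 0)) (X (.inl 1)) (X (.inl 2)) (X (.inl 3))
      (fun j => X (.inr j)) = 0 := by
    apply hι
    rw [map_rowDefect, map_zero]
    apply rowDefect_eq_zero_of_ne
    · exact hne _ (fun _ => 1) (by simp [hX])
    · simp only [← map_mul, ← map_pow, ← map_sub]
      exact hne _ (Sum.elim ![0, 1, 0, 0] 0) (by simp [hX])
    · intro i j h
      simpa using MvPolynomial.X_injective (hι h)
    · simp only [← map_mul, ← map_add]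
      exact hne _ (Sum.elim ![0, 1, 0, 0] 0) (by simp [hX])
    · intro j
      rw [← map_symForm]
      exact hne _ (Sum.elim ![1, 0, 0, 0] 0) (by simp [hX, symForm])
    · intro j
      rw [← map_symForm]
      exact hne _ (Sum.elim ![1, 0, 0, 0] 0) (by simp [hX, symForm])
  have h := congrArg (MvPolynomial.eval₂Hom (Int.castRingHom R) (Sum.elim ![a, b, c, z] y)) hgen
  rw [map_rowDefect, map_zero] at h
  simpa [X] using h

end rowIdentity

theorem prodPairs_div {F : Type*} [Field F] {n : ℕ} (f g : Fin n → Fin n → F) :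
    (prodPairs fun i k => f i k / g i k) = prodPairs f / prodPairs g :=
  Finset.prod_div_distrib _ _

theorem prodPairs_ne_zero {F : Type*} [Field F] {n : ℕ} {g : Fin n → Fin n → F}
    (hg : ∀ i k, i < k → g i k ≠ 0) : prodPairs g ≠ 0 :=
  Finset.prod_ne_zero_iff.mpr fun p hp => hg p.1 p.2 (Finset.mem_filter.mp hp).2

theorem sum_row {F : Type*} [Field F] (a b c z : F) {m : ℕ} (y : Fin (2 * m + 1) → F)
    (hzy : ∀ j, symForm a b c z (y j) ≠ 0)
    (hyy : ∀ i j, i < j → symForm a b c (y i) (y j) ≠ 0) :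
    ∑ j : Fin (2 * m + 1), (-1) ^ (j : ℕ) * ((y j - z) / symForm a b c z (y j)) *
        (prodPairs fun i k => (y (j.succAbove k) - y (j.succAbove i)) /
          symForm a b c (y (j.succAbove i)) (y (j.succAbove k))) =
      (b ^ 2 - a * c) ^ (2 * m) * (∏ j, (y j - z) / symForm a b c z (y j)) *
        prodPairs fun i k => (y k - y i) / symForm a b c (y i) (y k) := by
  have hrow := sub_eq_zero.mp (rowDefect_eq_zero a b c z y)
  have hD : ∏ j, symForm a b c z (y j) ≠ 0 := Finset.prod_ne_zero_iff.mpr fun j _ => hzy j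
  have hP : (prodPairs fun i k => symForm a b c (y i) (y k)) ≠ 0 := prodPairs_ne_zero hyy
  rw [prodPairs_div, Finset.prod_div_distrib]
  refine mul_right_cancel₀ (mul_ne_zero hD hP) (Eq.trans ?_ (hrow.trans ?_))
  · rw [Finset.sum_mul]
    refine Finset.sum_congr rfl fun j _ => ?_
    have hP' := hP
    rw [prodPairs_succAbove_of_symm (fun i k => symForm a b c (y i) (y k))
      (fun _ _ => symForm_comm _ _ _ _ _) j] at hP' ⊢
    have h1 := left_ne_zero_of_mul hP'
    have h2 := right_ne_zero_of_mul hP'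
    rw [prodPairs_div, Fin.prod_univ_succAbove _ j]
    have := hzy j
    field_simp
  · field_simp

theorem pfaff_eq_prodPairs {F : Type*} [Field F] (m : ℕ) (a b c : F) (x : Fin (2 * m) → F)
    (h : ∀ i j, i < j → symForm a b c (x i) (x j) ≠ 0) :
    (pfaff fun i j => (x j - x i) / symForm a b c (x i) (x j)) =
      (b ^ 2 - a * c) ^ (m * (m - 1)) *
        prodPairs fun i j => (x j - x i) / symForm a b c (x i) (x j) := by
  induction m with
  | zero => simp [pfaff, prodPairs, Subsingleton.strictMono]
  | succ m ih =>
    have hexp : (m + 1) * (m + 1 - 1) = m * (m - 1) + 2 * m := by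
      cases m <;> simp; ring
    have hz : ∀ j : Fin (2 * m + 1),
        symForm a b c (x (0 : Fin (2 * m + 2))) (x j.succ) ≠ 0 := fun j =>
      h _ _ (Fin.succ_pos j)
    have hy : ∀ i j : Fin (2 * m + 1), i < j → symForm a b c (x i.succ) (x j.succ) ≠ 0 :=
      fun i j hij => h _ _ (Fin.succ_lt_succ_iff.mpr hij)
    have hrow := sum_row a b c (x (0 : Fin (2 * m + 2)))
      (fun j : Fin (2 * m + 1) => x j.succ) hz hy
    refine (pfaff_succ _).trans ?_
    have hmul := congrArg ((b ^ 2 - a * c) ^ (m * (m - 1)) * ·) hrow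
    simp only [Finset.mul_sum] at hmul
    refine Eq.trans (Finset.sum_congr rfl fun j _ => ?_) (hmul.trans ?_)
    · rw [ih (fun i => x (j.succAbove i).succ) fun i k hik =>
        hy _ _ ((Fin.strictMono_succAbove j) hik)]
      ring
    · rw [hexp, pow_add]
      refine Eq.trans ?_ (congrArg (_ * ·) (prodPairs_succ (n := 2 * m + 1) _).symm)
      ring

theorem pfaffian_evaluation {F : Type*} [Field F] (m : ℕ) (a b c : F)
    (x : Fin (2 * m) → F)
    (h : ∀ i j : Fin (2 * m), i < j → a + b * (x i + x j) + c * x i * x j ≠ 0) :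
    pfaff (fun i j => (x j - x i) / (a + b * (x i + x j) + c * x i * x j)) =
      (b ^ 2 - a * c) ^ (m * (m - 1)) *
        ∏ p ∈ Finset.univ.filter (fun p : Fin (2 * m) × Fin (2 * m) => p.1 < p.2),
          (x p.2 - x p.1) / (a + b * (x p.1 + x p.2) + c * x p.1 * x p.2) := by
  exact pfaff_eq_prodPairs m a b c x h
end

section
/- For elements a, b, c and x_1,...,x_{2m} in a commutative ring, the following identity holds: Σ_{S ⊆ [2m], |S| = m} (-1)^{χ(S)} · Π_{j∉S} x_j · Π_{i<j, both in S or both in S^c} (x_j − x_i)(a + b(x_i + x_j) + c x_i x_j) = (b² − ac)^{m(m−1)/2} · Π_{1≤i<j≤2m} (x_j − x_i). -/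
open Finset

theorem det_eq_zero_of_card_ne {ι κ₁ κ₂ R : Type*} [CommRing R] [Fintype ι] [DecidableEq ι]
    [Fintype κ₁] [Fintype κ₂] (e₀ : κ₁ ⊕ κ₂ ≃ ι) (S : Finset ι) (hS : #S ≠ Fintype.card κ₁)
    (A : Matrix ι ι R) (h₁ : ∀ i ∈ S, ∀ k, A i (e₀ (.inr k)) = 0)
    (h₂ : ∀ i ∉ S, ∀ k, A i (e₀ (.inl k)) = 0) : A.det = 0 := by
  rw [Matrix.det_apply']
  refine sum_eq_zero fun σ _ ↦ ?_
  suffices ∃ r, A (σ r) r = 0 by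
    obtain ⟨r, hr⟩ := this
    exact mul_eq_zero_of_right _ (prod_eq_zero (mem_univ r) hr)
  by_contra! hne
  refine hS ?_
  have hmem : ∀ k, σ (e₀ (.inl k)) ∈ S := fun k ↦ by
    by_contra hk
    exact hne _ (h₂ _ hk k)
  have hnmem : ∀ k, σ (e₀ (.inr k)) ∉ S := fun k hk ↦ hne _ (h₁ _ hk k)
  rw [← card_univ]
  symm
  refine card_bij (fun k _ ↦ σ (e₀ (.inl k))) (fun k _ ↦ hmem k) (by simp) fun i hi ↦ ?_
  rcases hk : e₀.symm (σ.symm i) with k | k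
  · exact ⟨k, mem_univ _, by simp [← hk]⟩
  · exact absurd hi (by simpa [← hk] using hnmem k)

/-- Laplace expansion along several columns. -/
theorem det_eq_sum_laplace {ι κ₁ κ₂ R : Type*} [CommRing R] [Fintype ι] [DecidableEq ι]
    [Fintype κ₁] [Fintype κ₂] [DecidableEq κ₁] [DecidableEq κ₂]
    {p : ℕ} (hp : Fintype.card κ₁ = p) (A : Matrix ι ι R) (e₀ : κ₁ ⊕ κ₂ ≃ ι)
    (e : {S : Finset ι // #S = p} → κ₁ ⊕ κ₂ ≃ ι)
    (h₁ : ∀ S k, e S (.inl k) ∈ S.1) (h₂ : ∀ S k, e S (.inr k) ∉ S.1) :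
    A.det = ∑ S, (Equiv.Perm.sign (e₀.symm.trans (e S)) : R) *
      ((A.submatrix (fun k ↦ e S (.inl k)) (fun k ↦ e₀ (.inl k))).det *
        (A.submatrix (fun k ↦ e S (.inr k)) (fun k ↦ e₀ (.inr k))).det) := by
  let N (S : Finset ι) : Matrix ι ι R :=
    .of fun i r ↦ if i ∈ S ↔ (e₀.symm r).isLeft then A i r else 0
  have hexp : A.det = ∑ S : Finset ι, (N S).det := by
    have h := (Matrix.detRowAlternating (n := ι) (R := R)).map_add_univ
      (fun i r ↦ if (e₀.symm r).isLeft then A i r else 0)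
      (fun i r ↦ if (e₀.symm r).isLeft then 0 else A i r)
    convert h using 1
    · refine congrArg Matrix.det ?_
      ext i r
      by_cases h : (e₀.symm r).isLeft <;> simp [h]
    · refine sum_congr rfl fun S _ ↦ congrArg Matrix.det ?_
      ext i r
      by_cases hi : i ∈ S <;> by_cases h : (e₀.symm r).isLeft <;> simp [N, hi, h]
  rw [hexp]
  refine Eq.trans (sum_subset (subset_univ (univ.filter fun S ↦ #S = p))
    fun S _ hS ↦ ?_).symm ?_
  · refine det_eq_zero_of_card_ne e₀ S (by simpa [hp] using hS) _ (fun i hi k ↦ ?_) fun i hi k ↦ ?_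
    · simp [hi, N]
    · simp [hi, N]
  rw [← sum_subtype_eq_sum_filter, ← Finset.subtype_univ]
  refine sum_congr rfl fun S _ ↦ ?_
  have hdet : ((N S).submatrix (e S) e₀).det =
      Equiv.Perm.sign (e₀.symm.trans (e S)) * (N S).det := by
    rw [← Matrix.det_permute, ← Matrix.det_submatrix_equiv_self e₀]
    congr 1
    ext i j
    simp
  have hblock : (N S).submatrix (e S) e₀ = Matrix.fromBlocks
      (A.submatrix (fun k ↦ e S (.inl k)) (fun k ↦ e₀ (.inl k))) 0 0
      (A.submatrix (fun k ↦ e S (.inr k)) (fun k ↦ e₀ (.inr k))) := by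
    ext (i | i) (j | j) <;> simp [N, h₁, h₂]
  rw [hblock, Matrix.det_fromBlocks_zero₂₁] at hdet
  rw [hdet, ← mul_assoc, ← Int.cast_mul, ← Units.val_mul, Int.units_mul_self]
  simp

theorem sign_sumEquiv {p q : ℕ} (e : Fin p ⊕ Fin q ≃ Fin (p + q))
    (h₁ : StrictMono fun k ↦ e (.inl k)) (h₂ : StrictMono fun k ↦ e (.inr k)) :
    Equiv.Perm.sign (finSumFinEquiv.symm.trans e) =
      (∏ k : Fin p, (-1) ^ (k : ℕ)) * ∏ k : Fin p, (-1) ^ (e (.inl k) : ℕ) := by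
  have hcard (s : Fin p) :
      (e (.inl s) : ℕ) = s + #{t : Fin q | e (.inr t) < e (.inl s)} := by
    have h := Fin.card_Iio (e (.inl s))
    rw [← h, ← Fin.card_Iio s, ← card_disjSum, ← card_map e.toEmbedding]
    congr 1
    ext i
    obtain ⟨k | k, rfl⟩ := e.surjective i <;> simp [h₁.lt_iff_lt]
  have hprod (s : Fin p) : (∏ t : Fin q, if e (.inl s) < e (.inr t) then 1 else (-1 : ℤˣ)) =
      (-1) ^ #{t : Fin q | e (.inr t) < e (.inl s)} := by
    rw [← prod_const, prod_filter]
    refine prod_congr rfl fun t _ ↦ ?_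
    have : e (.inl s) ≠ e (.inr t) := by simp
    rcases this.lt_or_gt with h | h <;> simp [h, h.not_gt]
  have hIio (j : Fin (p + q)) (f : Fin (p + q) → ℤˣ) :
      ∏ i ∈ Iio j, f i = ∏ i, if i < j then f i else 1 := by
    rw [← prod_filter]
    congr 1
    ext; simp
  rw [Equiv.Perm.sign_eq_prod_prod_Iio]
  simp_rw [hIio]
  simp only [Fin.prod_univ_add]
  have hA (j : Fin p) : ((∏ i : Fin p, if i < j then
      (if e (.inl i) < e (.inl j) then 1 else (-1 : ℤˣ)) else 1)) = 1 :=
    prod_eq_one fun i _ ↦ by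
      by_cases h : i < j <;> simp [h, h₁.lt_iff_lt]
  have hB (j : Fin q) : ((∏ i : Fin q, if i < j then
      (if e (.inr i) < e (.inr j) then 1 else (-1 : ℤˣ)) else 1)) = 1 :=
    prod_eq_one fun i _ ↦ by
      by_cases h : i < j <;> simp [h, h₂.lt_iff_lt]
  have hC (j : Fin p) (i : Fin q) : ¬ Fin.natAdd p i < Fin.castAdd q j := by
    simp [Fin.lt_def]; omega
  have hD (j : Fin p) (i : Fin q) : Fin.castAdd q j < Fin.natAdd p i := by
    simp [Fin.lt_def]; omega
  have hE (i j : Fin p) : Fin.castAdd q i < Fin.castAdd q j ↔ i < j := Iff.rfl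
  simp only [Equiv.trans_apply, finSumFinEquiv_symm_apply_castAdd,
    finSumFinEquiv_symm_apply_natAdd, Fin.natAdd_lt_natAdd_iff, hE, hA, hB, hC, hD, if_true,
    if_false, prod_const_one, mul_one, one_mul]
  rw [prod_comm]
  simp_rw [hprod, hcard, ← prod_mul_distrib, ← pow_add]
  refine prod_congr rfl fun s _ ↦ ?_
  rw [← add_assoc, pow_add _ (_ + _), ← two_mul, pow_mul]
  simp

theorem sign_symm_trans {p q n : ℕ} (e₀ e : Fin p ⊕ Fin q ≃ Fin n)
    (h₀₁ : StrictMono fun k ↦ e₀ (.inl k)) (h₀₂ : StrictMono fun k ↦ e₀ (.inr k))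
    (h₁ : StrictMono fun k ↦ e (.inl k)) (h₂ : StrictMono fun k ↦ e (.inr k)) :
    Equiv.Perm.sign (e₀.symm.trans e) =
      (∏ k : Fin p, (-1) ^ (e₀ (.inl k) : ℕ)) * ∏ k : Fin p, (-1) ^ (e (.inl k) : ℕ) := by
  obtain rfl : p + q = n := by simpa using Fintype.card_congr e
  have : e₀.symm.trans e =
      (finSumFinEquiv.symm.trans e) * (finSumFinEquiv.symm.trans e₀)⁻¹ := by
    ext i; simp [Equiv.Perm.inv_def]
  rw [this, map_mul, map_inv, sign_sumEquiv e h₁ h₂, sign_sumEquiv e₀ h₀₁ h₀₂, Int.units_inv_eq_self,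
    mul_mul_mul_comm, Int.units_mul_self, one_mul, mul_comm]

/-- The equivalence `(ε, k) ↦ 2 * k + ε`. -/
def finTwoProdEquiv (m : ℕ) : Fin 2 × Fin m ≃ Fin (2 * m) :=
  (Equiv.prodComm _ _).trans (finProdFinEquiv.trans (finCongr (mul_comm m 2)))

theorem val_finTwoProdEquiv {m : ℕ} (p : Fin 2 × Fin m) :
    (finTwoProdEquiv m p : ℕ) = p.1 + 2 * p.2 := rfl

/-- The equivalence sending the `k`-th left element to `2 * k` and the `k`-th right element to
`2 * k + 1`. -/
def interleave (m : ℕ) : Fin m ⊕ Fin m ≃ Fin (2 * m) :=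
  (Equiv.boolProdEquivSum _).symm.trans
    ((Equiv.prodCongrLeft fun _ ↦ finTwoEquiv.symm).trans (finTwoProdEquiv m))

theorem val_interleave_inl {m : ℕ} (k : Fin m) : (interleave m (.inl k) : ℕ) = 2 * k := by
  simp [interleave, val_finTwoProdEquiv, finTwoEquiv]

theorem val_interleave_inr {m : ℕ} (k : Fin m) : (interleave m (.inr k) : ℕ) = 2 * k + 1 := by
  simp [interleave, val_finTwoProdEquiv, finTwoEquiv, add_comm]

section Coefficients

open Polynomial

variable {R : Type*} [CommRing R] (a b c : R)

/-- The polynomials `X ^ ε * P ^ k * L ^ (m - 1 - k)`, where `r = 2 * k + ε`,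
`P = X * (a + b * X)` and `L = b + c * X`. -/
noncomputable def pencilPoly (m r : ℕ) : R[X] :=
  X ^ (r % 2) * (X * (C a + C b * X)) ^ (r / 2) * (C b + C c * X) ^ (m - 1 - r / 2)

/-- The matrix whose `r`-th column lists the coefficients of the `r`-th `pencilPoly`. -/
noncomputable def pencilMatrix (m : ℕ) : Matrix (Fin (2 * m)) (Fin (2 * m)) R :=
  .of fun j r ↦ (pencilPoly a b c m r).coeff j

theorem natDegree_pencilPoly_le (m r : ℕ) :
    (pencilPoly a b c m r).natDegree ≤ r % 2 + 2 * (r / 2) + (m - 1 - r / 2) := by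
  have h₁ (u v : R) : (C u + C v * X).natDegree ≤ 1 := by compute_degree
  have h₂ : (X * (C a + C b * X)).natDegree ≤ 2 := by compute_degree
  refine natDegree_mul_le_of_le (natDegree_mul_le_of_le (natDegree_X_pow_le _) ?_) ?_
  · exact (natDegree_pow_le_of_le (r / 2) h₂).trans_eq (mul_comm _ _)
  · simpa using natDegree_pow_le_of_le (m - 1 - r / 2) (h₁ b c)

theorem coeff_zero_pencilPoly (m r : ℕ) :
    (pencilPoly a b c (m + 1) r).coeff 0 = if r = 0 then b ^ m else 0 := by
  rw [coeff_zero_eq_eval_zero, pencilPoly]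
  split_ifs with h
  · simp [h]
  · obtain h | h : r % 2 ≠ 0 ∨ r / 2 ≠ 0 := by omega
    · rw [eval_mul, eval_mul, eval_pow, eval_X, zero_pow h, zero_mul, zero_mul]
    · rw [eval_mul, eval_mul, eval_pow (n := r / 2), eval_mul, eval_X, zero_mul, zero_pow h,
        mul_zero, zero_mul]

theorem coeff_last_pencilPoly (m r : ℕ) (hr : r < 2 * (m + 1)) :
    (pencilPoly a b c (m + 1) r).coeff (2 * m + 1) = if r = 2 * m + 1 then b ^ m else 0 := by
  split_ifs with h
  · have h₁ : r % 2 = 1 := by omega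
    have h₂ : r / 2 = m := by omega
    have h₃ : (C a + C b * X).natDegree ≤ 1 := by compute_degree
    have h₄ := coeff_pow_of_natDegree_le h₃ (m := m)
    rw [pencilPoly, h₁, h₂, mul_pow, ← mul_assoc, ← pow_add, Nat.add_sub_cancel, Nat.sub_self,
      pow_zero, mul_one, show 2 * m + 1 = m + (1 + m) by ring, coeff_X_pow_mul]
    simpa using h₄
  · refine coeff_eq_zero_of_natDegree_lt ((natDegree_pencilPoly_le a b c _ r).trans_lt ?_)
    omega

theorem coeff_succ_pencilPoly_odd (m k j : ℕ) (hk : k < m) :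
    (pencilPoly a b c (m + 1) (2 * k + 1)).coeff (j + 1) =
      (pencilPoly a b c m (2 * k)).coeff j * b + (pencilPoly a b c m (2 * k + 1)).coeff j * c := by
  have : pencilPoly a b c (m + 1) (2 * k + 1) =
      X * (pencilPoly a b c m (2 * k) * C b + pencilPoly a b c m (2 * k + 1) * C c) := by
    simp only [pencilPoly, show (2 * k + 1) % 2 = 1 by omega, show (2 * k + 1) / 2 = k by omega,
      show (2 * k) % 2 = 0 by omega, show (2 * k) / 2 = k by omega,
      show m + 1 - 1 - k = m - 1 - k + 1 by omega]
    ring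
  rw [this, coeff_X_mul, coeff_add, coeff_mul_C, coeff_mul_C]

theorem coeff_succ_pencilPoly_even (m k j : ℕ) (hk : k < m) :
    (pencilPoly a b c (m + 1) (2 * k + 2)).coeff (j + 1) =
      (pencilPoly a b c m (2 * k)).coeff j * a + (pencilPoly a b c m (2 * k + 1)).coeff j * b := by
  have : pencilPoly a b c (m + 1) (2 * k + 2) =
      X * (pencilPoly a b c m (2 * k) * C a + pencilPoly a b c m (2 * k + 1) * C b) := by
    simp only [pencilPoly, show (2 * k + 1) % 2 = 1 by omega, show (2 * k + 1) / 2 = k by omega,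
      show (2 * k) % 2 = 0 by omega, show (2 * k) / 2 = k by omega,
      show (2 * k + 2) % 2 = 0 by omega, show (2 * k + 2) / 2 = k + 1 by omega,
      show m + 1 - 1 - (k + 1) = m - 1 - k by omega]
    ring
  rw [this, coeff_X_mul, coeff_add, coeff_mul_C, coeff_mul_C]

theorem det_inner_pencilMatrix (m : ℕ) :
    (Matrix.of fun j r : Fin (2 * m) ↦ (pencilPoly a b c (m + 1) (r + 1)).coeff (j + 1)).det =
      (b ^ 2 - a * c) ^ m * (pencilMatrix a b c m).det := by
  let φ := finTwoProdEquiv m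
  have h : (Matrix.of fun j r : Fin (2 * m) ↦
        (pencilPoly a b c (m + 1) (r + 1)).coeff (j + 1)).submatrix φ φ =
      (pencilMatrix a b c m).submatrix φ φ *
        Matrix.blockDiagonal fun _ : Fin m ↦ !![b, a; c, b] := by
    ext p ⟨ε, k⟩
    rw [Matrix.mul_apply, Fintype.sum_prod_type, Fin.sum_univ_two]
    simp only [Matrix.blockDiagonal_apply, Matrix.submatrix_apply, Matrix.of_apply, pencilMatrix,
      mul_ite, mul_zero, sum_ite_eq', mem_univ, if_true, φ, val_finTwoProdEquiv]
    fin_cases ε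
    · simpa [add_comm] using coeff_succ_pencilPoly_odd a b c m k (p.1 + 2 * p.2) k.2
    · have h := coeff_succ_pencilPoly_even a b c m k (p.1 + 2 * p.2) k.2
      rw [show 2 * (k : ℕ) + 2 = 1 + 2 * k + 1 by ring] at h
      simpa [add_comm (2 * (k : ℕ)) 1] using h
  rw [← Matrix.det_submatrix_equiv_self φ, h, Matrix.det_mul, Matrix.det_submatrix_equiv_self,
    Matrix.det_blockDiagonal]
  simp [Matrix.det_fin_two, mul_comm, pow_two]

theorem det_pencilMatrix_succ (m : ℕ) :
    (pencilMatrix a b c (m + 1)).det =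
      b ^ m * (b ^ m * ((b ^ 2 - a * c) ^ m * (pencilMatrix a b c m).det)) := by
  have h0 : (pencilMatrix a b c (m + 1)).det = b ^ m * (Matrix.of fun j r : Fin (2 * m + 1) ↦
      (pencilPoly a b c (m + 1) (r + 1)).coeff (j + 1)).det := by
    change (Matrix.of fun j r : Fin (2 * m + 1 + 1) ↦ (pencilPoly a b c (m + 1) r).coeff j).det = _
    rw [Matrix.det_succ_row_zero, sum_eq_single 0]
    · simp [coeff_zero_pencilPoly, Matrix.submatrix]
    · intro r _ hr
      have hr' : (r : ℕ) ≠ 0 := fun h ↦ hr (Fin.ext h)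
      simp [coeff_zero_pencilPoly, hr']
    · simp
  have h1 : (Matrix.of fun j r : Fin (2 * m + 1) ↦
      (pencilPoly a b c (m + 1) (r + 1)).coeff (j + 1)).det =
      b ^ m * (Matrix.of fun j r : Fin (2 * m) ↦
        (pencilPoly a b c (m + 1) (r + 1)).coeff (j + 1)).det := by
    rw [Matrix.det_succ_row _ (Fin.last (2 * m)), sum_eq_single (Fin.last (2 * m))]
    · have h := coeff_last_pencilPoly a b c m (2 * m + 1) (by omega)
      rw [if_pos rfl] at h
      simp [h, ← two_mul, pow_mul, Matrix.submatrix]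
    · intro r _ hr
      have : (r : ℕ) ≠ 2 * m := by simpa [Fin.ext_iff] using hr
      have h := coeff_last_pencilPoly a b c m (r + 1) (by omega)
      rw [if_neg (by omega)] at h
      simp [h]
    · simp
  rw [h0, h1, det_inner_pencilMatrix]

theorem det_pencilMatrix (m : ℕ) :
    (pencilMatrix a b c m).det =
      (b ^ (m * (m - 1) / 2)) ^ 2 * (b ^ 2 - a * c) ^ (m * (m - 1) / 2) := by
  induction m with
  | zero => simp
  | succ m ih =>
    rw [det_pencilMatrix_succ, ih, Nat.triangle_succ]
    ring

theorem det_eval_pencilPoly (m : ℕ) (x : Fin (2 * m) → R) :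
    (Matrix.of fun i r : Fin (2 * m) ↦ (pencilPoly a b c m r).eval (x i)).det =
      (b ^ (m * (m - 1) / 2)) ^ 2 * (b ^ 2 - a * c) ^ (m * (m - 1) / 2) *
        ∏ i, ∏ j ∈ Ioi i, (x j - x i) := by
  rw [← det_pencilMatrix, ← Matrix.det_vandermonde, mul_comm (Matrix.det _), ← Matrix.det_mul]
  congr 1
  ext i r
  have hdeg : (pencilPoly a b c m r).natDegree < 2 * m :=
    (natDegree_pencilPoly_le a b c m r).trans_lt (by omega)
  rw [Matrix.of_apply, eval_eq_sum_range' hdeg, ← Fin.sum_univ_eq_sum_range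
    fun j ↦ (pencilPoly a b c m r).coeff j * x i ^ j, Matrix.mul_apply]
  exact sum_congr rfl fun j _ ↦ mul_comm _ _

end Coefficients

theorem neg_one_pow_chi {n : ℕ} (S : Finset (Fin n)) :
    (-1 : ℤˣ) ^ chi S = ∏ i ∈ S, (-1) ^ (i : ℕ) := by
  rw [chi, ← prod_const, prod_filter]
  refine prod_congr rfl fun i _ ↦ ?_
  split_ifs with h
  · exact (Odd.neg_one_pow (Nat.odd_iff.2 (by omega))).symm
  · exact (Even.neg_one_pow (Nat.even_iff.2 (by omega))).symm

theorem sign_interleave_symm_trans {m : ℕ} {S : Finset (Fin (2 * m))}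
    (hS : #S = m) (hSc : #Sᶜ = m) :
    Equiv.Perm.sign ((interleave m).symm.trans (finSumEquivOfFinset hS hSc)) = (-1) ^ chi S := by
  rw [sign_symm_trans (interleave m), neg_one_pow_chi]
  · simp_rw [val_interleave_inl, pow_mul]
    simp only [finSumEquivOfFinset_inl, even_two, Even.neg_pow, one_pow, prod_const_one, one_mul]
    conv_rhs => rw [← map_orderEmbOfFin_univ S hS, prod_map]
    rfl
  · intro i j h
    rw [Fin.lt_def] at h ⊢
    simpa only [val_interleave_inl] using (by omega)
  · intro i j h
    rw [Fin.lt_def] at h ⊢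
    simpa only [val_interleave_inr] using (by omega)
  · exact fun i j h ↦ by simpa using h
  · exact fun i j h ↦ by simpa using h

theorem prod_pairs_same_side {n p q : ℕ} {M : Type*} [CommMonoid M] {S : Finset (Fin n)}
    (hS : #S = p) (hSc : #Sᶜ = q) (F : Fin n → Fin n → M) :
    ∏ r ∈ univ.filter (fun r : Fin n × Fin n ↦
        r.1 < r.2 ∧ ((r.1 ∈ S ∧ r.2 ∈ S) ∨ (r.1 ∉ S ∧ r.2 ∉ S))), F r.1 r.2 =
      (∏ i, ∏ j ∈ Ioi i, F (S.orderEmbOfFin hS i) (S.orderEmbOfFin hS j)) *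
        ∏ i, ∏ j ∈ Ioi i, F (Sᶜ.orderEmbOfFin hSc i) (Sᶜ.orderEmbOfFin hSc j) := by
  have hIoi (k : ℕ) (i : Fin k) (f : Fin k → M) :
      ∏ j ∈ Ioi i, f j = ∏ j, if i < j then f j else 1 := by
    rw [← prod_filter]
    congr 1
    ext; simp
  have h₁ (i : Fin p) : S.orderEmbOfFin hS i ∈ S := S.orderEmbOfFin_mem hS i
  have h₂ (i : Fin q) : Sᶜ.orderEmbOfFin hSc i ∉ S :=
    mem_compl.1 (Sᶜ.orderEmbOfFin_mem hSc i)
  rw [prod_filter, Fintype.prod_prod_type]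
  simp_rw [← (finSumEquivOfFinset hS hSc).prod_comp, Fintype.prod_sum_type, hIoi]
  simp [h₁, h₂]

theorem prod_pairs_lt {n : ℕ} {M : Type*} [CommMonoid M] (F : Fin n → Fin n → M) :
    ∏ r ∈ univ.filter (fun r : Fin n × Fin n ↦ r.1 < r.2), F r.1 r.2 =
      ∏ i, ∏ j ∈ Ioi i, F i j := by
  rw [prod_filter, Fintype.prod_prod_type]
  refine prod_congr rfl fun i _ ↦ ?_
  rw [← prod_filter]
  congr 1
  ext; simp

theorem prod_prod_Ioi_const {M : Type*} [CommMonoid M] (m : ℕ) (b : M) :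
    ∏ i : Fin m, ∏ _j ∈ Ioi i, b = b ^ (m * (m - 1) / 2) := by
  simp only [prod_const, Fin.card_Ioi, prod_pow_eq_pow_sum]
  rw [← sum_range_id, ← sum_range_reflect, ← Fin.sum_univ_eq_sum_range fun i ↦ m - 1 - i]

section

variable {R : Type*} [CommRing R] (a b c : R)

theorem det_projVandermonde_pencil (m : ℕ) (y : Fin m → R) :
    (Matrix.projVandermonde (fun i ↦ y i * (a + b * y i)) fun i ↦ b + c * y i).det =
      b ^ (m * (m - 1) / 2) * ∏ i, ∏ j ∈ Ioi i,
        (y j - y i) * (a + b * (y i + y j) + c * y i * y j) := by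
  rw [Matrix.det_projVandermonde, ← prod_prod_Ioi_const]
  simp_rw [← prod_mul_distrib]
  refine prod_congr rfl fun i _ ↦ prod_congr rfl fun j _ ↦ ?_
  ring

theorem sum_over_subsets_identity_scaled (m : ℕ) (x : Fin (2 * m) → R) :
    (b ^ (m * (m - 1) / 2)) ^ 2 * (∑ S : {S : Finset (Fin (2 * m)) // S.card = m},
      (-1 : R) ^ chi S.1 * (∏ j ∈ S.1ᶜ, x j) *
        ∏ p ∈ univ.filter (fun p : Fin (2 * m) × Fin (2 * m) =>
            p.1 < p.2 ∧ ((p.1 ∈ S.1 ∧ p.2 ∈ S.1) ∨ (p.1 ∉ S.1 ∧ p.2 ∉ S.1))),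
          (x p.2 - x p.1) * (a + b * (x p.1 + x p.2) + c * x p.1 * x p.2)) =
      (b ^ (m * (m - 1) / 2)) ^ 2 * ((b ^ 2 - a * c) ^ (m * (m - 1) / 2) *
        ∏ p ∈ univ.filter (fun p : Fin (2 * m) × Fin (2 * m) => p.1 < p.2),
          (x p.2 - x p.1)) := by
  have hSc (S : {S : Finset (Fin (2 * m)) // #S = m}) : #S.1ᶜ = m := by
    rw [card_compl, S.2, Fintype.card_fin]
    omega
  rw [prod_pairs_lt fun i j ↦ x j - x i, ← mul_assoc, ← det_eval_pencilPoly,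
    det_eq_sum_laplace (Fintype.card_fin m) _ (interleave m)
      (fun S ↦ finSumEquivOfFinset S.2 (hSc S)) (fun S k ↦ by simp)
      (fun S k ↦ mem_compl.1 (by simp)), mul_sum]
  refine sum_congr rfl fun S _ ↦ ?_
  set s := S.1.orderEmbOfFin S.2
  set t := S.1ᶜ.orderEmbOfFin (hSc S)
  have hs : (Matrix.of fun i r : Fin (2 * m) ↦ (pencilPoly a b c m r).eval (x i)).submatrix
      (fun k ↦ finSumEquivOfFinset S.2 (hSc S) (.inl k)) (fun k ↦ interleave m (.inl k)) =
      Matrix.projVandermonde (fun i ↦ x (s i) * (a + b * x (s i))) fun i ↦ b + c * x (s i) := by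
    ext i k
    have h : m - 1 - (k : ℕ) = m - (k + 1) := by omega
    simp [pencilPoly, val_interleave_inl, Matrix.projVandermonde_apply, h, s]
  have ht : (Matrix.of fun i r : Fin (2 * m) ↦ (pencilPoly a b c m r).eval (x i)).submatrix
      (fun k ↦ finSumEquivOfFinset S.2 (hSc S) (.inr k)) (fun k ↦ interleave m (.inr k)) =
      Matrix.of fun i k ↦ x (t i) * Matrix.projVandermonde
        (fun i ↦ x (t i) * (a + b * x (t i))) (fun i ↦ b + c * x (t i)) i k := by
    ext i k
    have h : m - 1 - (k : ℕ) = m - (k + 1) := by omega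
    have h₁ : (2 * (k : ℕ) + 1) % 2 = 1 := by omega
    have h₂ : (2 * (k : ℕ) + 1) / 2 = k := by omega
    simp [pencilPoly, val_interleave_inr, Matrix.projVandermonde_apply, h, h₁, h₂, t, mul_assoc]
  have hx : ∏ j ∈ S.1ᶜ, x j = ∏ i, x (t i) := by
    conv_lhs => rw [← map_orderEmbOfFin_univ S.1ᶜ (hSc S), prod_map]
    rfl
  rw [hs, ht, Matrix.det_mul_column, sign_interleave_symm_trans,
    det_projVandermonde_pencil a b c m fun i ↦ x (s i),
    det_projVandermonde_pencil a b c m fun i ↦ x (t i), hx, prod_pairs_same_side S.2 (hSc S)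
      fun i j ↦ (x j - x i) * (a + b * (x i + x j) + c * x i * x j)]
  push_cast
  ring

end

theorem sum_over_subsets_identity {R : Type*} [CommRing R] (m : ℕ)
    (a b c : R) (x : Fin (2 * m) → R) :
    (∑ S : {S : Finset (Fin (2 * m)) // S.card = m},
      (-1 : R) ^ chi S.1 * (∏ j ∈ S.1ᶜ, x j) *
        ∏ p ∈ Finset.univ.filter (fun p : Fin (2 * m) × Fin (2 * m) =>
            p.1 < p.2 ∧ ((p.1 ∈ S.1 ∧ p.2 ∈ S.1) ∨ (p.1 ∉ S.1 ∧ p.2 ∉ S.1))),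
          (x p.2 - x p.1) * (a + b * (x p.1 + x p.2) + c * x p.1 * x p.2)) =
      (b ^ 2 - a * c) ^ (m * (m - 1) / 2) *
        ∏ p ∈ Finset.univ.filter (fun p : Fin (2 * m) × Fin (2 * m) => p.1 < p.2),
          (x p.2 - x p.1) := by
  -- Perturb `b` to the regular element `X + C b` of `R[X]`, cancel it, and specialize `X` to `0`.
  have hreg := ((Polynomial.monic_X_add_C b).pow (m * (m - 1) / 2)).pow 2 |>.isRegular
  have h := hreg.left (sum_over_subsets_identity_scaled (Polynomial.C a)
    (Polynomial.X + Polynomial.C b) (Polynomial.C c) m fun i ↦ Polynomial.C (x i))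
  simpa [Polynomial.eval_finsetSum, Polynomial.eval_prod] using congrArg (Polynomial.eval 0) h
end

section
/- For free variables a_1,...,a_{2m} and z_1,...,z_{2m} in a field, and any square roots √z_i (i.e., elements whose squares are z_i, assumed pairwise distinct so that the sums √z_i + √z_j are nonzero), and any m-element subset S ⊆ [2m]: (-1)^{m(m+1)/2 + Σ_{s∈S} s} · Π_{i∈S, j∉S}(z_j − z_i) · det_{i∈S, j∉S}((a_j − a_i)/(z_j − z_i)) = Π_{1≤i<j≤2m}(√z_i + √z_j) · pfaff_{1≤i,j≤2m}((a_j − a_i)/(√z_j + √z_i)). -/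
open Finset

/-- The square matrix whose rows are `(1, z, …, z ^ (m - 1), a, a * z, …, a * z ^ (m - 1))`. -/
def twoVandermonde {R : Type*} [CommRing R] {m : ℕ} (z a : Fin m ⊕ Fin m → R) :
    Matrix (Fin m ⊕ Fin m) (Fin m ⊕ Fin m) R :=
  Matrix.of fun p => Sum.elim (fun k => z p ^ (k : ℕ)) (fun k => a p * z p ^ (k : ℕ))

theorem prod_prod_Ioi_neg_one {R : Type*} [CommRing R] (m : ℕ) :
    ∏ i : Fin m, ∏ _j ∈ Ioi i, (-1 : R) = (-1) ^ (m * (m - 1) / 2) := by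
  simp only [prod_const, Fin.card_Ioi, prod_pow_eq_pow_sum]
  rw [Fin.sum_univ_eq_sum_range (fun i => m - 1 - i), sum_range_reflect (fun i => i),
    sum_range_id]

theorem prod_erase_sub_eq {R : Type*} [CommRing R] {m : ℕ} (x : Fin m → R) :
    ∏ i, ∏ j ∈ univ.erase i, (x i - x j) =
      (-1) ^ (m * (m - 1) / 2) * (Matrix.vandermonde x).det ^ 2 := by
  have h1 : ∀ i : Fin m, ∏ j ∈ univ.erase i, (x i - x j) =
      (∏ j ∈ Ioi i, (x i - x j)) * ∏ j ∈ Iio i, (x i - x j) := by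
    intro i
    rw [← prod_union]
    · congr 1
      ext j
      simp only [mem_erase, mem_univ, and_true, mem_union, mem_Ioi, mem_Iio]
      exact ⟨fun h => h.symm.lt_or_gt, fun h => h.elim ne_of_gt ne_of_lt⟩
    · rw [disjoint_left]
      intro j hj hj'
      simp only [mem_Ioi, mem_Iio] at hj hj'
      exact lt_asymm hj hj'
  have h2 : ∏ i, ∏ j ∈ Iio i, (x i - x j) = ∏ i, ∏ j ∈ Ioi i, (x j - x i) :=
    prod_comm' (by simp)
  have h3 : ∏ i, ∏ j ∈ Ioi i, (x i - x j) =
      (-1) ^ (m * (m - 1) / 2) * ∏ i, ∏ j ∈ Ioi i, (x j - x i) := by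
    rw [← prod_prod_Ioi_neg_one, ← prod_mul_distrib]
    refine prod_congr rfl fun i _ => ?_
    rw [← prod_mul_distrib]
    exact prod_congr rfl fun j _ => by ring
  simp_rw [h1]
  rw [prod_mul_distrib, h2, h3, Matrix.det_vandermonde]
  ring

theorem det_vandermonde_neg {R : Type*} [CommRing R] {m : ℕ} (x : Fin m → R) :
    (Matrix.vandermonde (fun i => -x i)).det =
      (-1) ^ (m * (m - 1) / 2) * (Matrix.vandermonde x).det := by
  rw [Matrix.det_vandermonde, Matrix.det_vandermonde, ← prod_prod_Ioi_neg_one, ← prod_mul_distrib]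
  refine prod_congr rfl fun i _ => ?_
  rw [← prod_mul_distrib]
  exact prod_congr rfl fun j _ => by ring

theorem vandermonde_eq_lagrange_mul {F : Type*} [Field F] {m : ℕ} {x : Fin m → F}
    (hx : Function.Injective x) (y : Fin m → F) :
    Matrix.vandermonde y =
      Matrix.of (fun j i => (Lagrange.basis univ x i).eval (y j)) * Matrix.vandermonde x := by
  ext j k
  have h := Lagrange.eq_interpolate (s := univ) (v := x) (f := (Polynomial.X : Polynomial F) ^ (k : ℕ))
    hx.injOn (by
      rw [Polynomial.degree_X_pow, card_univ, Fintype.card_fin]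
      exact_mod_cast k.2)
  have h2 := congrArg (Polynomial.eval (y j)) h
  simp only [Polynomial.eval_pow, Polynomial.eval_X, Lagrange.interpolate_apply,
    Polynomial.eval_finsetSum, Polynomial.eval_mul, Polynomial.eval_C] at h2
  rw [Matrix.vandermonde_apply, h2, Matrix.mul_apply]
  exact sum_congr rfl fun i _ => by simp [mul_comm]

theorem det_twoVandermonde {F : Type*} [Field F] {m : ℕ} {x y : Fin m → F}
    (hx : Function.Injective x) (hxy : ∀ i j, y j ≠ x i) (α β : Fin m → F) :
    (twoVandermonde (Sum.elim x y) (Sum.elim α β)).det =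
      (-1) ^ (m * (m - 1) / 2) * (∏ i, ∏ j, (y j - x i)) *
        (Matrix.of fun i j => (β j - α i) / (y j - x i)).det := by
  set V := Matrix.vandermonde x with hV
  set L : Matrix (Fin m) (Fin m) F :=
    Matrix.of (fun j i => (Lagrange.basis univ x i).eval (y j)) with hL
  set N : Matrix (Fin m) (Fin m) F := Matrix.of fun i j => (β j - α i) / (y j - x i) with hN
  have hyV : Matrix.vandermonde y = L * V := vandermonde_eq_lagrange_mul hx y
  have hfac : twoVandermonde (Sum.elim x y) (Sum.elim α β) =
      Matrix.fromBlocks 1 (Matrix.diagonal α) L (Matrix.diagonal β * L) *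
        Matrix.fromBlocks V 0 0 V := by
    rw [Matrix.fromBlocks_multiply]
    simp only [Matrix.mul_zero, Matrix.one_mul, add_zero, zero_add, Matrix.mul_assoc, ← hyV]
    ext p q
    rcases p with p | p <;> rcases q with q | q <;>
      simp [twoVandermonde, hV, Matrix.vandermonde_apply]
  have hS : Matrix.diagonal β * L - L * Matrix.diagonal α =
      Matrix.diagonal (fun j => ∏ i, (y j - x i)) * N.transpose *
        Matrix.diagonal (fun i => Lagrange.nodalWeight univ x i) := by
    ext j i
    rw [Matrix.sub_apply, Matrix.diagonal_mul, Matrix.mul_diagonal, Matrix.mul_diagonal,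
      Matrix.diagonal_mul]
    simp only [hL, hN, Matrix.of_apply, Matrix.transpose_apply]
    rw [Lagrange.eval_basis_not_at_node (mem_univ i) (hxy i j), Lagrange.eval_nodal, div_eq_mul_inv]
    ring
  have hw : (∏ i, Lagrange.nodalWeight univ x i) * V.det ^ 2 = (-1) ^ (m * (m - 1) / 2) := by
    have h0 : V.det ≠ 0 := Matrix.det_vandermonde_ne_zero_iff.2 hx
    have h1 : (∏ i, Lagrange.nodalWeight univ x i) = (∏ i, ∏ j ∈ univ.erase i, (x i - x j))⁻¹ := by
      simp [Lagrange.nodalWeight]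
    rw [h1, prod_erase_sub_eq, mul_inv, mul_assoc, inv_mul_cancel₀ (pow_ne_zero 2 h0), mul_one,
      ← inv_pow, inv_neg, inv_one]
  rw [hfac, Matrix.det_mul, Matrix.det_fromBlocks_one₁₁, hS, Matrix.det_mul, Matrix.det_mul,
    Matrix.det_diagonal, Matrix.det_diagonal, Matrix.det_transpose, Matrix.det_fromBlocks_zero₂₁,
    prod_comm, ← hw]
  ring

theorem det_twoVandermonde_zero_one {R : Type*} [CommRing R] {m : ℕ} (x y : Fin m → R) :
    (twoVandermonde (Sum.elim x y) (Sum.elim (fun _ => 0) (fun _ => 1))).det =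
      (Matrix.vandermonde x).det * (Matrix.vandermonde y).det := by
  rw [← Matrix.det_fromBlocks_zero₁₂ _ (Matrix.vandermonde y)]
  congr 1
  ext p q
  rcases p with p | p <;> rcases q with q | q <;>
    simp [twoVandermonde, Matrix.vandermonde_apply]

/-- Cauchy's determinant. -/
theorem prod_mul_det_one_div_add {F : Type*} [Field F] {m : ℕ} {x y : Fin m → F}
    (hx : Function.Injective x) (hxy : ∀ i j, y j + x i ≠ 0) :
    (∏ i, ∏ j, (y j + x i)) * (Matrix.of fun i j => 1 / (y j + x i)).det =
      (Matrix.vandermonde x).det * (Matrix.vandermonde y).det := by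
  have h := det_twoVandermonde (x := fun i => -x i) (y := y) (neg_injective.comp hx)
    (fun i j h => hxy i j (by rw [h]; ring)) (fun _ => 0) (fun _ => 1)
  rw [det_twoVandermonde_zero_one, det_vandermonde_neg] at h
  simp only [sub_neg_eq_add, sub_zero] at h
  rw [mul_assoc, mul_assoc] at h
  exact (mul_left_cancel₀ (pow_ne_zero _ (neg_ne_zero.2 one_ne_zero)) h).symm

theorem sign_finSumFinEquiv_symm_trans {m : ℕ} (e : Fin m ⊕ Fin m ≃ Fin (m + m))
    (hl : StrictMono fun i => e (Sum.inl i)) (hr : StrictMono fun i => e (Sum.inr i)) :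
    Equiv.Perm.sign (finSumFinEquiv.symm.trans e) =
      (-1) ^ (∑ i : Fin m, (e (Sum.inl i) : ℕ) + ∑ i : Fin m, (i : ℕ)) := by
  have hcount : ∀ i : Fin m, (i : ℕ) + #{j | e (Sum.inr j) < e (Sum.inl i)} = e (Sum.inl i) := by
    intro i
    have h1 : ∑ q, (if q < e (Sum.inl i) then 1 else 0) = (e (Sum.inl i) : ℕ) := by
      rw [← card_filter, filter_gt_eq_Iio, Fin.card_Iio]
    rw [← Equiv.sum_comp e, Fintype.sum_sum_type, ← card_filter, ← card_filter] at h1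
    have h2 : #{j | e (Sum.inl j) < e (Sum.inl i)} = (i : ℕ) := by
      simp only [hl.lt_iff_lt, filter_gt_eq_Iio, Fin.card_Iio]
    rw [h2] at h1
    exact h1
  rw [Equiv.Perm.sign_eq_prod_prod_Ioi]
  simp_rw [← filter_lt_eq_Ioi, prod_filter]
  have hll : ∀ i j : Fin m, Fin.castAdd m i < Fin.castAdd m j ↔ i < j := fun i j => Iff.rfl
  have hlr : ∀ i j : Fin m, Fin.castAdd m i < Fin.natAdd m j := fun i j => by
    simp only [Fin.lt_def, Fin.val_castAdd, Fin.val_natAdd]; omega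
  rw [Fin.prod_univ_add]
  simp only [Fin.prod_univ_add, Equiv.trans_apply, finSumFinEquiv_symm_apply_castAdd,
    finSumFinEquiv_symm_apply_natAdd, hl.lt_iff_lt, hr.lt_iff_lt, hlr, hll, Fin.natAdd_lt_natAdd_iff,
    (hlr _ _).not_gt, if_false, if_true, prod_const_one, one_mul]
  have hone : ∀ i j : Fin m, (if i < j then if i < j then (1 : ℤˣ) else -1 else 1) = 1 := by
    intro i j; split_ifs <;> rfl
  simp only [hone, prod_const_one, one_mul, mul_one]
  have hrow : ∀ i : Fin m, (∏ j : Fin m, if e (Sum.inl i) < e (Sum.inr j) then (1 : ℤˣ) else -1) =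
      (-1) ^ ((e (Sum.inl i) : ℕ) + i) := by
    intro i
    have hne : ∀ j, e (Sum.inl i) ≠ e (Sum.inr j) := fun j h => by simpa using e.injective h
    have hite : ∀ j, (if e (Sum.inl i) < e (Sum.inr j) then (1 : ℤˣ) else -1) =
        if e (Sum.inr j) < e (Sum.inl i) then -1 else 1 := by
      intro j
      rcases (hne j).lt_or_gt with h | h
      · rw [if_pos h, if_neg h.not_gt]
      · rw [if_neg h.not_gt, if_pos h]
    simp_rw [hite]
    rw [← prod_filter, prod_const, ← hcount i, add_right_comm, pow_add, Even.neg_one_pow ⟨_, rfl⟩,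
      one_mul]
  simp_rw [hrow]
  rw [prod_pow_eq_pow_sum, sum_add_distrib]

theorem sign_trans_symm {m n : ℕ} (hn : n = m + m) (e f : Fin m ⊕ Fin m ≃ Fin n)
    (hel : StrictMono fun i => e (Sum.inl i)) (her : StrictMono fun i => e (Sum.inr i))
    (hfl : StrictMono fun i => f (Sum.inl i)) (hfr : StrictMono fun i => f (Sum.inr i)) :
    Equiv.Perm.sign (e.trans f.symm) =
      (-1) ^ (∑ i : Fin m, (e (Sum.inl i) : ℕ) + ∑ i : Fin m, (f (Sum.inl i) : ℕ)) := by
  subst hn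
  have h := Equiv.Perm.sign_symm_trans_trans (e.trans f.symm) finSumFinEquiv
  have h2 : (finSumFinEquiv.symm.trans (e.trans f.symm)).trans finSumFinEquiv =
      (finSumFinEquiv.symm.trans f)⁻¹ * (finSumFinEquiv.symm.trans e) := rfl
  rw [← h, h2, Equiv.Perm.sign_mul, Equiv.Perm.sign_inv, sign_finSumFinEquiv_symm_trans e hel her,
    sign_finSumFinEquiv_symm_trans f hfl hfr, ← pow_add]
  generalize ∑ i : Fin m, (e (Sum.inl i) : ℕ) = p
  generalize ∑ i : Fin m, (f (Sum.inl i) : ℕ) = q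
  generalize ∑ i : Fin m, (i : ℕ) = t
  rw [show q + t + (p + t) = p + q + (t + t) by ring, pow_add _ (p + q),
    Even.neg_one_pow ⟨t, rfl⟩, mul_one]

theorem prod_lt_eq_of_strictMono {R ι : Type*} [CommMonoid R] [LinearOrder ι] [Fintype ι] {m : ℕ}
    (e : Fin m ⊕ Fin m ≃ ι) (hl : StrictMono fun i => e (Sum.inl i))
    (hr : StrictMono fun i => e (Sum.inr i)) (g : ι → ι → R) (hg : ∀ x y, g x y = g y x) :
    ∏ p ∈ univ.filter (fun p : ι × ι => p.1 < p.2), g p.1 p.2 =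
      (∏ i, ∏ j ∈ Ioi i, g (e (Sum.inl i)) (e (Sum.inl j))) *
        (∏ i, ∏ j ∈ Ioi i, g (e (Sum.inr i)) (e (Sum.inr j))) *
          ∏ i, ∏ j, g (e (Sum.inl i)) (e (Sum.inr j)) := by
  have hcross : (∏ i, ∏ j, g (e (Sum.inl i)) (e (Sum.inr j))) =
      (∏ i, ∏ j, if e (Sum.inl i) < e (Sum.inr j) then g (e (Sum.inl i)) (e (Sum.inr j)) else 1) *
      ∏ j, ∏ i, if e (Sum.inr j) < e (Sum.inl i) then
        g (e (Sum.inr j)) (e (Sum.inl i)) else 1 := by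
    rw [prod_comm (f := fun j i => if e (Sum.inr j) < e (Sum.inl i) then
        g (e (Sum.inr j)) (e (Sum.inl i)) else 1), ← prod_mul_distrib]
    refine prod_congr rfl fun i _ => ?_
    rw [← prod_mul_distrib]
    refine prod_congr rfl fun j _ => ?_
    have hne : e (Sum.inl i) ≠ e (Sum.inr j) := fun h => by simpa using e.injective h
    rcases hne.lt_or_gt with h | h
    · rw [if_pos h, if_neg h.not_gt, mul_one]
    · rw [if_neg h.not_gt, if_pos h, one_mul, hg]
  rw [hcross, prod_filter, Fintype.prod_prod_type]
  simp_rw [← Equiv.prod_comp e, Fintype.prod_sum_type]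
  simp only [hl.lt_iff_lt, hr.lt_iff_lt, ← prod_filter, filter_lt_eq_Ioi, prod_mul_distrib]
  ac_rfl

/-- The signed monomial `sgn s * ∏ i, A (s (inl i)) (s (inr i))`, signs being relative to `b`. -/
def matchingTerm {ι R : Type*} [CommRing R] {m : ℕ} (b : Fin m ⊕ Fin m ≃ ι) (A : Matrix ι ι R)
    (s : Fin m ⊕ Fin m ≃ ι) : R :=
  (Equiv.Perm.sign (s.trans b.symm) : ℤ) • ∏ i, A (s (Sum.inl i)) (s (Sum.inr i))

/-- The fixed-point-free involution exchanging `s (inl i)` and `s (inr i)`. -/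
def partner {ι : Type*} {m : ℕ} (s : Fin m ⊕ Fin m ≃ ι) : Equiv.Perm ι :=
  s.symm.trans ((Equiv.sumComm _ _).trans s)

/-- The labellings of a perfect matching listing each pair, and the smallest elements of the pairs,
in increasing order. -/
def IsCanonicalMatching {ι : Type*} [LinearOrder ι] {m : ℕ} (s : Fin m ⊕ Fin m ≃ ι) : Prop :=
  (∀ i, s (Sum.inl i) < s (Sum.inr i)) ∧ StrictMono fun i => s (Sum.inl i)

section Matching

variable {ι R : Type*} [CommRing R] {m : ℕ}

theorem partner_inl (s : Fin m ⊕ Fin m ≃ ι) (i : Fin m) :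
    partner s (s (Sum.inl i)) = s (Sum.inr i) := by simp [partner]

theorem partner_inr (s : Fin m ⊕ Fin m ≃ ι) (i : Fin m) :
    partner s (s (Sum.inr i)) = s (Sum.inl i) := by simp [partner]

theorem partner_trans (s : Fin m ⊕ Fin m ≃ ι) (π : Equiv.Perm (Fin m ⊕ Fin m))
    (hπ : ∀ p, π (Sum.swap p) = Sum.swap (π p)) : partner (π.trans s) = partner s := by
  ext x
  obtain ⟨p, rfl⟩ := (π.trans s).surjective x
  simp [partner, hπ]

theorem sign_trans_trans_symm (b s : Fin m ⊕ Fin m ≃ ι) (π : Equiv.Perm (Fin m ⊕ Fin m)) :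
    Equiv.Perm.sign ((π.trans s).trans b.symm) =
      Equiv.Perm.sign π * Equiv.Perm.sign (s.trans b.symm) := by
  rw [mul_comm, ← Equiv.Perm.sign_mul]
  rfl

theorem matchingTerm_swap_trans (b : Fin m ⊕ Fin m ≃ ι) {A : Matrix ι ι R}
    (hA : ∀ x y, A x y = -A y x) (s : Fin m ⊕ Fin m ≃ ι) (i : Fin m) :
    matchingTerm b A ((Equiv.swap (Sum.inl i) (Sum.inr i)).trans s) = matchingTerm b A s := by
  have hne : (Sum.inl i : Fin m ⊕ Fin m) ≠ Sum.inr i := by simp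
  have hrest : ∏ k ∈ univ.erase i, A (((Equiv.swap (Sum.inl i) (Sum.inr i)).trans s) (Sum.inl k))
      (((Equiv.swap (Sum.inl i) (Sum.inr i)).trans s) (Sum.inr k)) =
      ∏ k ∈ univ.erase i, A (s (Sum.inl k)) (s (Sum.inr k)) := by
    refine prod_congr rfl fun k hk => ?_
    have hk : k ≠ i := (mem_erase.1 hk).1
    rw [Equiv.trans_apply, Equiv.trans_apply, Equiv.swap_apply_of_ne_of_ne (by simpa) (by simp),
      Equiv.swap_apply_of_ne_of_ne (by simp) (by simpa)]
  rw [matchingTerm, matchingTerm, sign_trans_trans_symm, Equiv.Perm.sign_swap hne,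
    ← mul_prod_erase univ _ (mem_univ i), hrest, ← mul_prod_erase univ (a := i) _ (mem_univ i)]
  simp only [Equiv.trans_apply, Equiv.swap_apply_left, Equiv.swap_apply_right]
  rw [hA (s (Sum.inr i))]
  simp

theorem matchingTerm_sumCongr_trans (b : Fin m ⊕ Fin m ≃ ι) (A : Matrix ι ι R)
    (s : Fin m ⊕ Fin m ≃ ι) (π : Equiv.Perm (Fin m)) :
    matchingTerm b A ((Equiv.sumCongr π π).trans s) = matchingTerm b A s := by
  have hsign : Equiv.Perm.sign (Equiv.sumCongr π π) = 1 :=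
    (Equiv.Perm.sign_sumCongr π π).trans (Int.units_mul_self _)
  rw [matchingTerm, matchingTerm, sign_trans_trans_symm, hsign, one_mul]
  congr 1
  simp only [Equiv.trans_apply, Equiv.sumCongr_apply, Sum.map_inl, Sum.map_inr]
  exact Equiv.prod_comp π fun i => A (s (Sum.inl i)) (s (Sum.inr i))

theorem exists_isCanonicalMatching [LinearOrder ι] (b : Fin m ⊕ Fin m ≃ ι) {A : Matrix ι ι R}
    (hA : ∀ x y, A x y = -A y x) (s : Fin m ⊕ Fin m ≃ ι) :
    ∃ c, IsCanonicalMatching c ∧ matchingTerm b A c = matchingTerm b A s ∧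
      partner c = partner s := by
  have horient : ∀ t : Finset (Fin m), ∃ c : Fin m ⊕ Fin m ≃ ι,
      (∀ i ∈ t, c (Sum.inl i) < c (Sum.inr i)) ∧ matchingTerm b A c = matchingTerm b A s ∧
        partner c = partner s := by
    intro t
    induction t using Finset.induction_on with
    | empty => exact ⟨s, by simp, rfl, rfl⟩
    | insert i t hi ih =>
      obtain ⟨c, hc, hterm, hpart⟩ := ih
      have hne : c (Sum.inl i) ≠ c (Sum.inr i) := fun h => by simpa using c.injective h
      rcases hne.lt_or_gt with h | h
      · refine ⟨c, fun k hk => ?_, hterm, hpart⟩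
        rcases mem_insert.1 hk with rfl | hk
        · exact h
        · exact hc k hk
      · refine ⟨(Equiv.swap (Sum.inl i) (Sum.inr i)).trans c, fun k hk => ?_, ?_, ?_⟩
        · rcases mem_insert.1 hk with rfl | hk
          · simpa using h
          · have hki : k ≠ i := fun h => hi (h ▸ hk)
            rw [Equiv.trans_apply, Equiv.trans_apply,
              Equiv.swap_apply_of_ne_of_ne (by simpa) (by simp),
              Equiv.swap_apply_of_ne_of_ne (by simp) (by simpa)]
            exact hc k hk
        · rw [matchingTerm_swap_trans b hA, hterm]
        · rw [partner_trans _ _ ?_, hpart]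
          intro p
          rcases p with k | k <;> rcases eq_or_ne k i with rfl | hki
          · simp
          · simp [Equiv.swap_apply_of_ne_of_ne, hki]
          · simp
          · simp [Equiv.swap_apply_of_ne_of_ne, hki]
  obtain ⟨c, hc, hterm, hpart⟩ := horient univ
  let π := Tuple.sort fun i => c (Sum.inl i)
  refine ⟨(Equiv.sumCongr π π).trans c, ⟨fun i => ?_, ?_⟩, ?_, ?_⟩
  · simpa using hc (π i) (mem_univ _)
  · refine (Tuple.monotone_sort fun i => c (Sum.inl i)).strictMono_of_injective ?_
    exact (c.injective.comp Sum.inl_injective).comp π.injective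
  · rw [matchingTerm_sumCongr_trans, hterm]
  · rw [partner_trans _ _ ?_, hpart]
    rintro (p | p) <;> simp

theorem IsCanonicalMatching.eq_of_partner_eq [LinearOrder ι] {c d : Fin m ⊕ Fin m ≃ ι}
    (hc : IsCanonicalMatching c) (hd : IsCanonicalMatching d) (h : partner c = partner d) :
    c = d := by
  have hrange : ∀ c : Fin m ⊕ Fin m ≃ ι, IsCanonicalMatching c →
      Set.range (fun i => c (Sum.inl i)) = {x | x < partner c x} := by
    intro c hc
    ext x
    obtain ⟨p | p, rfl⟩ := c.surjective x
    · simp [partner_inl, hc.1 p]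
    · simp [partner_inr, (hc.1 p).le]
  have hl : (fun i => c (Sum.inl i)) = fun i => d (Sum.inl i) :=
    (hc.2.range_inj hd.2).1 (by rw [hrange c hc, hrange d hd, h])
  ext (i | i)
  · exact congrFun hl i
  · rw [← partner_inl, ← partner_inl, h]
    exact congrArg _ (congrFun hl i)

/-- The sum over canonical matchings may be computed from any other set of representatives of the
matchings with non-zero contribution. -/
theorem sum_matchingTerm_eq [LinearOrder ι] [Fintype ι] {κ : Type*} [Fintype κ]
    (b : Fin m ⊕ Fin m ≃ ι) {A : Matrix ι ι R} (hA : ∀ x y, A x y = -A y x)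
    (C : Finset (Fin m ⊕ Fin m ≃ ι)) (hC : ∀ s, s ∈ C ↔ IsCanonicalMatching s)
    (f : κ → (Fin m ⊕ Fin m ≃ ι)) (hf : Function.Injective fun k => partner (f k))
    (hsurj : ∀ s : Fin m ⊕ Fin m ≃ ι, ∏ i, A (s (Sum.inl i)) (s (Sum.inr i)) ≠ 0 → ∃ k, partner (f k) = partner s) :
    ∑ s ∈ C, matchingTerm b A s = ∑ k, matchingTerm b A (f k) := by
  choose c hcan hterm hpart using exists_isCanonicalMatching b hA
  symm
  refine sum_of_injOn (fun k => c (f k)) ?_ ?_ ?_ ?_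
  · intro k _ l _ h
    apply hf
    simpa [hpart] using congrArg partner h
  · intro k _
    exact (hC _).2 (hcan _)
  · intro s hs hs'
    by_contra hne
    obtain ⟨k, hk⟩ := hsurj s fun h => hne (by rw [matchingTerm, h, smul_zero])
    refine hs' ⟨k, by simp, ?_⟩
    exact (hcan _).eq_of_partner_eq ((hC _).1 hs) (by rw [hpart, hk])
  · intro k _
    exact (hterm _).symm

theorem sum_matchingTerm_eq_sign_mul_det [LinearOrder ι] [Fintype ι]
    (b : Fin m ⊕ Fin m ≃ ι) {A : Matrix ι ι R} (hA : ∀ x y, A x y = -A y x)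
    (C : Finset (Fin m ⊕ Fin m ≃ ι)) (hC : ∀ s, s ∈ C ↔ IsCanonicalMatching s)
    (e : Fin m ⊕ Fin m ≃ ι) (hl : ∀ i j, A (e (Sum.inl i)) (e (Sum.inl j)) = 0) :
    ∑ s ∈ C, matchingTerm b A s = (Equiv.Perm.sign (e.trans b.symm) : ℤ) •
      (Matrix.of fun i j => A (e (Sum.inl i)) (e (Sum.inr j))).det := by
  rw [sum_matchingTerm_eq b hA C hC
    (fun π : Equiv.Perm (Fin m) => (Equiv.sumCongr (Equiv.refl _) π).trans e)]
  · rw [← Matrix.det_transpose, Matrix.det_apply, smul_sum]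
    refine sum_congr rfl fun π _ => ?_
    rw [matchingTerm, sign_trans_trans_symm]
    have hsign : Equiv.Perm.sign (Equiv.sumCongr (Equiv.refl (Fin m)) π) = Equiv.Perm.sign π :=
      (Equiv.Perm.sign_sumCongr 1 π).trans (by rw [Equiv.Perm.sign_one, one_mul])
    rw [hsign, mul_comm, Units.val_mul, mul_smul]
    rfl
  · intro π ρ h
    refine Equiv.ext fun i => ?_
    have h2 := congrArg (fun t : Equiv.Perm ι => t (e (Sum.inl i))) h
    simpa [partner] using h2
  · intro s hs
    have hs : ∀ i, A (s (Sum.inl i)) (s (Sum.inr i)) ≠ 0 := fun i =>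
      fun h => hs (prod_eq_zero (mem_univ i) h)
    have hne : ∀ x, A x (partner s x) ≠ 0 := by
      intro x
      obtain ⟨p | p, rfl⟩ := s.surjective x
      · rw [partner_inl]; exact hs p
      · rw [partner_inr, hA]; exact neg_ne_zero.2 (hs p)
    have hex : ∀ i, ∃ j, e (Sum.inr j) = partner s (e (Sum.inl i)) := by
      intro i
      obtain ⟨p | p, hp⟩ := e.surjective (partner s (e (Sum.inl i)))
      · exact absurd (hp ▸ hl i p) (hne _)
      · exact ⟨p, hp⟩
    choose g hg using hex
    have hginj : Function.Injective g := by
      intro i j hij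
      have := (partner s).injective ((hg i).symm.trans ((congrArg _ (congrArg _ hij)).trans (hg j)))
      simpa using this
    refine ⟨Equiv.ofBijective g (Finite.injective_iff_bijective.1 hginj), ?_⟩
    have hinv : ∀ x, partner s (partner s x) = x := by
      intro x
      simp [partner]
    ext x
    obtain ⟨p | p, rfl⟩ := e.surjective x
    · rw [← hg]
      simp [partner]
    · obtain ⟨i, rfl⟩ := (Finite.injective_iff_bijective.1 hginj).2 p
      rw [hg i, hinv, ← hg i]
      simp only [partner, Equiv.trans_apply, Equiv.symm_trans_apply, Equiv.symm_apply_apply,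
        Equiv.sumCongr_symm, Equiv.sumCongr_apply, Sum.map_inr, Equiv.sumComm_apply, Sum.swap_inr,
        Sum.map_inl, Equiv.refl_apply]
      congr 2
      exact Equiv.ofBijective_symm_apply_apply g _ i

end Matching

section MultiAffine

variable {ι F : Type*} [DecidableEq ι] [CommRing F]

/-- Functions of several variables which are affine in each of them. -/
def IsMultiAffine (G : (ι → F) → F) : Prop :=
  ∀ a i t, G (Function.update a i t) =
    (1 - t) * G (Function.update a i 0) + t * G (Function.update a i 1)

theorem IsMultiAffine.const_mul {G : (ι → F) → F} (hG : IsMultiAffine G) (c : F) :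
    IsMultiAffine fun a => c * G a := by
  intro a i t
  simp only [hG a i t]
  ring

theorem IsMultiAffine.sum {κ : Type*} {s : Finset κ} {G : κ → (ι → F) → F}
    (hG : ∀ k ∈ s, IsMultiAffine (G k)) : IsMultiAffine fun a => ∑ k ∈ s, G k a := by
  intro a i t
  simp only [mul_sum, ← sum_add_distrib]
  exact sum_congr rfl fun k hk => hG k hk a i t

theorem IsMultiAffine.ext [Fintype ι] {G H : (ι → F) → F} (hG : IsMultiAffine G)
    (hH : IsMultiAffine H) (h : ∀ a, (∀ i, a i = 0 ∨ a i = 1) → G a = H a) (a : ι → F) :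
    G a = H a := by
  have key : ∀ s : Finset ι, ∀ a, (∀ i ∉ s, a i = 0 ∨ a i = 1) → G a = H a := by
    intro s
    induction s using Finset.induction_on with
    | empty => exact fun a ha => h a fun i => ha i (notMem_empty i)
    | insert i s hi ih =>
      intro a ha
      have hupd : ∀ t : F, t = 0 ∨ t = 1 →
          G (Function.update a i t) = H (Function.update a i t) := by
        intro t ht
        refine ih _ fun j hj => ?_
        rcases eq_or_ne j i with rfl | hji
        · simpa using ht
        · rw [Function.update_of_ne hji]
          exact ha j (by simp [hji, hj])
      rw [← Function.update_eq_self i a, hG, hH, hupd 0 (Or.inl rfl), hupd 1 (Or.inr rfl)]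
  exact key univ a (by simp)

theorem isMultiAffine_det_twoVandermonde {m : ℕ} (z : Fin m ⊕ Fin m → F) (b : Fin m ⊕ Fin m ≃ ι) :
    IsMultiAffine fun a => (twoVandermonde z (a ∘ b)).det := by
  intro a i t
  obtain ⟨p, rfl⟩ := b.surjective i
  have hupd : ∀ t, twoVandermonde z (Function.update a (b p) t ∘ b) =
      (twoVandermonde z (a ∘ b)).updateRow p
        (Sum.elim (fun k => z p ^ (k : ℕ)) (fun k => t * z p ^ (k : ℕ))) := by
    intro t
    ext q k
    rcases eq_or_ne q p with rfl | hqp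
    · simp [twoVandermonde]
    · rw [Matrix.updateRow_ne hqp]
      simp [twoVandermonde, Function.update_of_ne (b.injective.ne hqp)]
  simp only [hupd]
  rw [← Matrix.det_updateRow_smul, ← Matrix.det_updateRow_smul, ← Matrix.det_updateRow_add]
  congr 2
  ext (k | k)
  · simp; ring
  · simp

theorem isMultiAffine_prod_sub_mul {m : ℕ} (s : Fin m ⊕ Fin m ≃ ι) (d : Fin m → F) :
    IsMultiAffine fun a => ∏ k, (a (s (Sum.inr k)) - a (s (Sum.inl k))) * d k := by
  intro a i t
  obtain ⟨p, rfl⟩ := s.surjective i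
  obtain ⟨k, hk⟩ : ∃ k, p = Sum.inl k ∨ p = Sum.inr k := by
    rcases p with k | k
    · exact ⟨k, Or.inl rfl⟩
    · exact ⟨k, Or.inr rfl⟩
  have hrest : ∀ t, ∏ l ∈ univ.erase k, (Function.update a (s p) t (s (Sum.inr l)) -
      Function.update a (s p) t (s (Sum.inl l))) * d l =
      ∏ l ∈ univ.erase k, (a (s (Sum.inr l)) - a (s (Sum.inl l))) * d l := by
    intro t
    refine prod_congr rfl fun l hl => ?_
    have hl : l ≠ k := (mem_erase.1 hl).1
    rw [Function.update_of_ne, Function.update_of_ne] <;>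
      rcases hk with rfl | rfl <;> simp [hl]
  simp only [← mul_prod_erase univ _ (mem_univ k), hrest]
  rcases hk with rfl | rfl <;> simp <;> ring

end MultiAffine

theorem det_twoVandermonde_eq_sign_mul {ι R : Type*} [CommRing R] {m : ℕ}
    (z a : ι → R) (b e : Fin m ⊕ Fin m ≃ ι) :
    (twoVandermonde (z ∘ e) (a ∘ e)).det =
      (Equiv.Perm.sign (e.trans b.symm) : ℤ) * (twoVandermonde (z ∘ b) (a ∘ b)).det := by
  rw [← Matrix.det_permute]
  congr 1
  ext p q
  simp [twoVandermonde]

theorem det_twoVandermonde_eq_zero {F : Type*} [Field F] {m : ℕ} (z a : Fin m ⊕ Fin m → F)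
    (q : Polynomial F) (hq : q.Monic) (hdeg : q.natDegree < m) (c : F)
    (h : ∀ p, (c + a p) * q.eval (z p) = 0) : (twoVandermonde z a).det = 0 := by
  rw [← Matrix.exists_mulVec_eq_zero_iff]
  refine ⟨Sum.elim (fun k => c * q.coeff k) (fun k => q.coeff k), fun h0 => ?_, ?_⟩
  · have h1 := congrFun h0 (Sum.inr ⟨q.natDegree, hdeg⟩)
    simp only [Sum.elim_inr, Pi.zero_apply] at h1
    rw [Polynomial.coeff_natDegree, hq.leadingCoeff] at h1
    exact one_ne_zero h1
  · ext p
    rw [Pi.zero_apply, ← h p, Polynomial.eval_eq_sum_range' hdeg, ← Fin.sum_univ_eq_sum_range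
      (fun k => q.coeff k * z p ^ k), Matrix.mulVec, dotProduct, Fintype.sum_sum_type, add_mul,
      mul_sum, mul_sum]
    congr 1 <;> refine sum_congr rfl fun k _ => ?_ <;> simp [twoVandermonde] <;> ring

theorem card_filter_eq_one_of_prod_ne_zero {ι F : Type*} [Field F] [DecidableEq F] [Fintype ι]
    {m : ℕ} {a : ι → F} (ha : ∀ i, a i = 0 ∨ a i = 1) (s : Fin m ⊕ Fin m ≃ ι)
    (hs : ∀ i, a (s (Sum.inr i)) ≠ a (s (Sum.inl i))) : #{x | a x = 1} = m := by
  rw [card_filter, ← Equiv.sum_comp s, Fintype.sum_sum_type, ← sum_add_distrib]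
  have h1 : ∀ i : Fin m, ((if a (s (Sum.inl i)) = 1 then 1 else 0) +
      if a (s (Sum.inr i)) = 1 then 1 else 0) = 1 := by
    intro i
    have := hs i
    rcases ha (s (Sum.inl i)) with h | h <;> rcases ha (s (Sum.inr i)) with h' | h' <;>
      simp_all
  simp [h1]

theorem det_vandermonde_sq {R : Type*} [CommRing R] {m : ℕ} (x : Fin m → R) :
    (Matrix.vandermonde fun i => x i ^ 2).det =
      (∏ i, ∏ j ∈ Ioi i, (x i + x j)) * (Matrix.vandermonde x).det := by
  rw [Matrix.det_vandermonde, Matrix.det_vandermonde, ← prod_mul_distrib]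
  refine prod_congr rfl fun i _ => ?_
  rw [← prod_mul_distrib]
  exact prod_congr rfl fun j _ => by ring

theorem prod_mul_sum_matchingTerm_eq_det {ι F : Type*} [LinearOrder ι] [Fintype ι] [Field F]
    {m : ℕ} (b : Fin m ⊕ Fin m ≃ ι) (r : ι → F) (hrinj : Function.Injective r)
    (hrs : ∀ i j, i ≠ j → r i + r j ≠ 0)
    (C : Finset (Fin m ⊕ Fin m ≃ ι)) (hC : ∀ s, s ∈ C ↔ IsCanonicalMatching s) (a : ι → F) :
    (∏ p ∈ univ.filter (fun p : ι × ι => p.1 < p.2), (r p.1 + r p.2)) *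
      ∑ s ∈ C, matchingTerm b (fun i j => (a j - a i) / (r j + r i)) s =
      (twoVandermonde (fun p => r (b p) ^ 2) (a ∘ b)).det := by
  classical
  refine IsMultiAffine.ext (G := fun a =>
    (∏ p ∈ univ.filter (fun p : ι × ι => p.1 < p.2), (r p.1 + r p.2)) *
      ∑ s ∈ C, matchingTerm b (fun i j => (a j - a i) / (r j + r i)) s) ?_
    (isMultiAffine_det_twoVandermonde _ b) ?_ a
  · refine IsMultiAffine.const_mul (IsMultiAffine.sum fun s _ => ?_) _
    simp only [matchingTerm, zsmul_eq_mul, div_eq_mul_inv]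
    exact (isMultiAffine_prod_sub_mul s _).const_mul _
  intro a ha
  have hcardι : Fintype.card ι = m + m := by
    rw [← Fintype.card_congr b, Fintype.card_sum, Fintype.card_fin]
  set T : Finset ι := {x | a x = 1} with hT
  have hTc : #Tᶜ = m + m - #T := by rw [card_compl, hcardι]
  by_cases hcard : #T = m
  · let e := finSumEquivOfFinset (s := Tᶜ) (m := m) (n := m) (by omega) (by rwa [compl_compl])
    have hel : StrictMono fun i => e (Sum.inl i) := fun i j hij => by
      simpa [e] using hij
    have her : StrictMono fun i => e (Sum.inr i) := fun i j hij => by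
      simpa [e] using hij
    have hal : ∀ i, a (e (Sum.inl i)) = 0 := fun i => by
      have h : e (Sum.inl i) ∈ Tᶜ := by
        simp only [e, finSumEquivOfFinset_inl, orderEmbOfFin_mem]
      have h2 : ¬ a (e (Sum.inl i)) = 1 := by simpa [hT] using h
      exact (ha _).resolve_right h2
    have har : ∀ i, a (e (Sum.inr i)) = 1 := fun i => by
      have h : e (Sum.inr i) ∈ Tᶜᶜ := by
        simp only [e, finSumEquivOfFinset_inr, orderEmbOfFin_mem]
      simpa [hT] using h
    have hD := det_twoVandermonde_eq_sign_mul (fun x => r x ^ 2) a b e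
    have hsplit : (fun x => r x ^ 2) ∘ e =
        Sum.elim (fun i => r (e (Sum.inl i)) ^ 2) (fun i => r (e (Sum.inr i)) ^ 2) := by
      ext (i | i) <;> rfl
    have hasplit : a ∘ e = Sum.elim (fun _ => 0) (fun _ => 1) := by
      ext (i | i) <;> simp [hal, har]
    rw [hsplit, hasplit, det_twoVandermonde_zero_one, det_vandermonde_sq, det_vandermonde_sq] at hD
    have hcauchy := prod_mul_det_one_div_add (x := fun i => r (e (Sum.inl i)))
      (y := fun i => r (e (Sum.inr i))) (hrinj.comp (e.injective.comp Sum.inl_injective))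
      (fun i j => hrs _ _ (by simp))
    have hprod := prod_lt_eq_of_strictMono e hel her (fun x y => r x + r y) fun x y => add_comm _ _
    have hpf := sum_matchingTerm_eq_sign_mul_det b (A := fun i j => (a j - a i) / (r j + r i))
      (fun x y => by rw [← neg_div, neg_sub, add_comm (r x)]) C hC e
      (fun i j => by rw [hal, hal, sub_zero, zero_div])
    have hunit : ((Equiv.Perm.sign (e.trans b.symm) : ℤ) : F) *
        ((Equiv.Perm.sign (e.trans b.symm) : ℤ) : F) = 1 := by
      rw [← Int.cast_mul, ← Units.val_mul, Int.units_mul_self, Units.val_one, Int.cast_one]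
    simp only [hal, har, sub_zero] at hpf
    simp only [add_comm (r (e (Sum.inr _)))] at hcauchy hpf
    rw [hpf, hprod, zsmul_eq_mul]
    calc _ = ((Equiv.Perm.sign (e.trans b.symm) : ℤ) : F) *
        ((∏ i, ∏ j ∈ Ioi i, (r (e (Sum.inl i)) + r (e (Sum.inl j)))) *
          (∏ i, ∏ j ∈ Ioi i, (r (e (Sum.inr i)) + r (e (Sum.inr j)))) *
          ((∏ i, ∏ j, (r (e (Sum.inl i)) + r (e (Sum.inr j)))) *
            (Matrix.of fun i j => 1 / (r (e (Sum.inl i)) + r (e (Sum.inr j)))).det)) := by ring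
      _ = ((Equiv.Perm.sign (e.trans b.symm) : ℤ) : F) *
          (((Equiv.Perm.sign (e.trans b.symm) : ℤ) : F) *
            (twoVandermonde ((fun x => r x ^ 2) ∘ b) (a ∘ b)).det) := by
        rw [hcauchy, ← hD]; ring
      _ = _ := by rw [← mul_assoc, hunit, one_mul]; rfl
  · have hzero : ∀ s ∈ C, matchingTerm b (fun i j => (a j - a i) / (r j + r i)) s = 0 := by
      intro s _
      by_contra hne
      refine hcard (card_filter_eq_one_of_prod_ne_zero ha s fun i h => hne ?_)
      exact smul_eq_zero_of_right _ (prod_eq_zero (mem_univ i) (by simp [h]))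
    rw [sum_eq_zero hzero, mul_zero]
    symm
    have hle : #T ≤ m + m := hcardι ▸ card_le_univ T
    rcases lt_or_gt_of_ne hcard with h | h
    · refine det_twoVandermonde_eq_zero _ _ (∏ x ∈ T, (Polynomial.X - Polynomial.C (r x ^ 2)))
        (Polynomial.monic_prod_X_sub_C _ _) (by rwa [Polynomial.natDegree_finsetProd_X_sub_C_eq_card]) 0 fun p => ?_
      rcases ha (b p) with h0 | h1
      · simp [h0]
      · rw [Polynomial.eval_prod, prod_eq_zero (i := b p) (by simp [hT, h1]) (by simp), mul_zero]
    · refine det_twoVandermonde_eq_zero _ _ (∏ x ∈ Tᶜ, (Polynomial.X - Polynomial.C (r x ^ 2)))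
        (Polynomial.monic_prod_X_sub_C _ _)
        (by rw [Polynomial.natDegree_finsetProd_X_sub_C_eq_card]; omega) (-1) fun p => ?_
      rcases ha (b p) with h0 | h1
      · rw [Polynomial.eval_prod, prod_eq_zero (i := b p) (by simp [hT, h0]) (by simp), mul_zero]
      · simp [h1]

/-- The enumeration of `Fin (2 * m)` listing even and odd positions separately. -/
def evenOddEquiv (m : ℕ) : Fin m ⊕ Fin m ≃ Fin (2 * m) where
  toFun := Sum.elim (fun i => ⟨2 * (i : ℕ), by omega⟩) (fun i => ⟨2 * (i : ℕ) + 1, by omega⟩)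
  invFun k := if (k : ℕ) % 2 = 0 then Sum.inl ⟨(k : ℕ) / 2, by omega⟩
    else Sum.inr ⟨(k : ℕ) / 2, by omega⟩
  left_inv := by
    rintro (i | i)
    · simp
    · simp [Nat.add_mod, Nat.mul_add_div]
  right_inv := by
    intro k
    by_cases h : (k : ℕ) % 2 = 0
    · simp only [h, if_true, Sum.elim_inl]
      ext
      simp only
      omega
    · simp only [h, if_false, Sum.elim_inr]
      ext
      simp only
      omega

open Classical in
theorem pfaff_eq_sum_matchingTerm {R : Type*} [CommRing R] {m : ℕ}
    (A : Matrix (Fin (2 * m)) (Fin (2 * m)) R) :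
    pfaff A = ∑ s ∈ univ.filter (fun s : Fin m ⊕ Fin m ≃ Fin (2 * m) => IsCanonicalMatching s),
      matchingTerm (evenOddEquiv m) A s := by
  rw [pfaff]
  refine sum_bij (fun σ _ => (evenOddEquiv m).trans σ) ?_ ?_ ?_ ?_
  · intro σ hσ
    exact mem_filter.2 ⟨mem_univ _, (mem_filter.1 hσ).2⟩
  · intro σ _ τ _ h
    ext k
    obtain ⟨p, rfl⟩ := (evenOddEquiv m).surjective k
    exact congrArg _ (congrArg (fun f : Fin m ⊕ Fin m ≃ Fin (2 * m) => f p) h)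
  · intro s hs
    refine ⟨(evenOddEquiv m).symm.trans s, ?_, ?_⟩
    · have hs2 : IsCanonicalMatching ((evenOddEquiv m).trans ((evenOddEquiv m).symm.trans s)) := by
        simpa [← Equiv.trans_assoc] using hs
      exact mem_filter.2 ⟨mem_univ _, hs2⟩
    · simp [← Equiv.trans_assoc]
  · intro σ _
    rw [matchingTerm, Equiv.Perm.sign_trans_trans_symm]
    rfl

theorem sign_trans_evenOddEquiv_symm {m : ℕ} (e : Fin m ⊕ Fin m ≃ Fin (2 * m))
    (hl : StrictMono fun i => e (Sum.inl i)) (hr : StrictMono fun i => e (Sum.inr i)) :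
    Equiv.Perm.sign (e.trans (evenOddEquiv m).symm) = (-1) ^ (∑ i : Fin m, (e (Sum.inl i) : ℕ)) := by
  rw [sign_trans_symm (two_mul m) e (evenOddEquiv m) hl hr, pow_add]
  · have h : ∑ i : Fin m, (evenOddEquiv m (Sum.inl i) : ℕ) = 2 * ∑ i : Fin m, (i : ℕ) :=
      (mul_sum _ _ _).symm
    rw [h, Even.neg_one_pow (even_two_mul _), mul_one]
  · intro i j hij
    simp only [evenOddEquiv, Equiv.coe_fn_mk, Sum.elim_inl, Fin.lt_def] at hij ⊢
    omega
  · intro i j hij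
    simp only [evenOddEquiv, Equiv.coe_fn_mk, Sum.elim_inr, Fin.lt_def] at hij ⊢
    omega

theorem prod_orderEmbOfFin {ι M : Type*} [LinearOrder ι] [CommMonoid M] {k : ℕ} (s : Finset ι)
    (h : s.card = k) (f : ι → M) : ∏ i, f (s.orderEmbOfFin h i) = ∏ x ∈ s, f x := by
  conv_rhs => rw [← map_orderEmbOfFin_univ s h]
  rw [prod_map]
  rfl

theorem sundquist_det_eq_pfaffian_sqrt {F : Type*} [Field F] (m : ℕ)
    (a z r : Fin (2 * m) → F)
    (hr : ∀ i, r i ^ 2 = z i)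
    (hz : ∀ i j, i ≠ j → z i ≠ z j)
    (hrs : ∀ i j, i ≠ j → r i + r j ≠ 0)
    (S : Finset (Fin (2 * m))) (hS : S.card = m) :
    (-1 : F) ^ (m * (m + 1) / 2 + ∑ s ∈ S, ((s : ℕ) + 1)) *
      (∏ i ∈ S, ∏ j ∈ Sᶜ, (z j - z i)) *
      Matrix.det (Matrix.of fun i j : Fin m =>
        (a ((Sᶜ).orderEmbOfFin
              (by rw [Finset.card_compl, hS, Fintype.card_fin]; omega) j) -
         a (S.orderEmbOfFin hS i)) /
        (z ((Sᶜ).orderEmbOfFin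
              (by rw [Finset.card_compl, hS, Fintype.card_fin]; omega) j) -
         z (S.orderEmbOfFin hS i))) =
    (∏ p ∈ Finset.univ.filter (fun p : Fin (2 * m) × Fin (2 * m) => p.1 < p.2),
        (r p.1 + r p.2)) *
      pfaff (fun i j => (a j - a i) / (r j + r i)) := by
  classical
  have hSc : #Sᶜ = m := by rw [card_compl, hS, Fintype.card_fin]; omega
  have hrinj : Function.Injective r := by
    intro i j hij
    by_contra hne
    exact hz i j hne (by rw [← hr, ← hr, hij])
  have hpf := prod_mul_sum_matchingTerm_eq_det (evenOddEquiv m) r hrinj hrs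
    (univ.filter fun s : Fin m ⊕ Fin m ≃ Fin (2 * m) => IsCanonicalMatching s) (by simp) a
  refine Eq.trans ?_ ((congrArg _ (pfaff_eq_sum_matchingTerm _)).trans (Eq.trans (by congr!) hpf)).symm
  set e := finSumEquivOfFinset hS hSc with he
  have hel : ∀ i, e (Sum.inl i) = S.orderEmbOfFin hS i := fun i => finSumEquivOfFinset_inl ..
  have her : ∀ i, e (Sum.inr i) = Sᶜ.orderEmbOfFin hSc i := fun i => finSumEquivOfFinset_inr ..
  have hsign := sign_trans_evenOddEquiv_symm e
    (by simpa only [hel] using (S.orderEmbOfFin hS).strictMono)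
    (by simpa only [her] using (Sᶜ.orderEmbOfFin hSc).strictMono)
  have hzinj : Function.Injective z := fun i j hij => by
    by_contra hne
    exact hz i j hne hij
  have hD := det_twoVandermonde_eq_sign_mul z a (evenOddEquiv m) e
  have hblock := det_twoVandermonde (x := fun i => z (e (Sum.inl i)))
    (y := fun i => z (e (Sum.inr i))) (hzinj.comp (e.injective.comp Sum.inl_injective))
    (fun i j => hz _ _ (by simp)) (fun i => a (e (Sum.inl i))) (fun i => a (e (Sum.inr i)))
  have hsplit : ∀ f : Fin (2 * m) → F,
      f ∘ e = Sum.elim (fun i => f (e (Sum.inl i))) (fun i => f (e (Sum.inr i))) := by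
    intro f
    ext (i | i) <;> rfl
  rw [← hsplit, ← hsplit, hD, hsign] at hblock
  simp only [hel, her] at hblock
  rw [prod_orderEmbOfFin S hS fun x => ∏ j, (z (Sᶜ.orderEmbOfFin hSc j) - z x)] at hblock
  rw [prod_congr rfl fun x _ => prod_orderEmbOfFin Sᶜ hSc fun y => z y - z x] at hblock
  have hsum : ∑ i, (S.orderEmbOfFin hS i : ℕ) = ∑ s ∈ S, (s : ℕ) := by
    conv_rhs => rw [← map_orderEmbOfFin_univ S hS]
    rw [sum_map]
    rfl
  have hexp : m * (m + 1) / 2 + ∑ s ∈ S, ((s : ℕ) + 1) =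
      ∑ s ∈ S, (s : ℕ) + m * (m - 1) / 2 + 2 * m := by
    have h := Nat.triangle_succ m
    rw [Nat.add_sub_cancel, mul_comm] at h
    rw [sum_add_distrib, sum_const, hS, h, smul_eq_mul]
    ring
  have hrz : (fun p => r (evenOddEquiv m p) ^ 2) = z ∘ evenOddEquiv m := by
    ext p
    exact hr _
  rw [hexp, pow_add _ _ (2 * m), Even.neg_one_pow (even_two_mul m), mul_one, pow_add, hrz,
    mul_assoc, mul_assoc, ← mul_assoc _ (∏ i ∈ S, _), ← hblock, ← mul_assoc, hsum]
  push_cast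
  rw [← mul_pow, neg_one_mul, neg_neg, one_pow, one_mul]
end

section
/- For free variables a_1,...,a_{2m} in a field and invertible elements ζ_1,...,ζ_{2m} with 1 − ζ_iζ_j ≠ 0 for i ≠ j, setting z_i = ζ_i + ζ_i^{-1} − 2, and for any m-element subset S ⊆ [2m]: (-1)^{m(m+1)/2 + Σ_{s∈S} s} · Π_{i∈S, j∉S}(z_j − z_i) · det_{i∈S, j∉S}((a_j − a_i)/(z_j − z_i)) = Π_{i=1}^{2m} ζ_i^{1−m} · Π_{1≤i<j≤2m}(1 − ζ_iζ_j) · pfaff_{1≤i,j≤2m}((a_j − a_i)/(1 − ζ_iζ_j)). -/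
open Finset

namespace Pfaffian

/-- The permutation of `Fin (n + 2)` sending `0, 1` to `0, j + 1` and acting on the remaining
indices through `τ`. -/
def insertPair {n : ℕ} (j : Fin (n + 1)) (τ : Equiv.Perm (Fin n)) : Equiv.Perm (Fin (n + 2)) :=
  Equiv.Perm.decomposeFin.symm (0, j.cycleRange.symm * Equiv.Perm.decomposeFin.symm (0, τ))

lemma insertPair_zero {n : ℕ} (j : Fin (n + 1)) (τ : Equiv.Perm (Fin n)) :
    insertPair j τ 0 = 0 := by
  simp [insertPair]

lemma insertPair_one {n : ℕ} (j : Fin (n + 1)) (τ : Equiv.Perm (Fin n)) :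
    insertPair j τ 1 = j.succ := by
  simp [insertPair]

lemma insertPair_succ_succ {n : ℕ} (j : Fin (n + 1)) (τ : Equiv.Perm (Fin n)) (k : Fin n) :
    insertPair j τ k.succ.succ = (j.succAbove (τ k)).succ := by
  simp [insertPair]

lemma sign_insertPair {n : ℕ} (j : Fin (n + 1)) (τ : Equiv.Perm (Fin n)) :
    Equiv.Perm.sign (insertPair j τ) = (-1) ^ (j : ℕ) * Equiv.Perm.sign τ := by
  simp [insertPair, Fin.sign_cycleRange]

lemma insertPair_injective {n : ℕ} {j j' : Fin (n + 1)} {τ τ' : Equiv.Perm (Fin n)}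
    (h : insertPair j τ = insertPair j' τ') : j = j' ∧ τ = τ' := by
  have hj : j = j' := by
    have := congrArg (fun σ => σ 1) h
    simpa [insertPair_one] using this
  subst hj
  refine ⟨rfl, ?_⟩
  simpa [insertPair] using h

lemma exists_insertPair {n : ℕ} (σ : Equiv.Perm (Fin (n + 2))) (h : σ 0 = 0) :
    ∃ j τ, insertPair j τ = σ := by
  obtain ⟨⟨p, π⟩, rfl⟩ := Equiv.Perm.decomposeFin.symm.surjective σ
  obtain rfl : p = 0 := by simpa using h
  obtain ⟨⟨q, τ⟩, hτ⟩ := Equiv.Perm.decomposeFin.symm.surjective ((π 0).cycleRange * π)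
  obtain rfl : q = 0 := by
    have := congrArg (fun σ => σ 0) hτ
    simpa using this
  refine ⟨π 0, τ, ?_⟩
  rw [insertPair, hτ]
  congr 2
  ext x
  simp

/-- The permutations `σ` which list the pairs of a perfect matching in canonical order. -/
def IsCanonical {m : ℕ} (σ : Equiv.Perm (Fin (2 * m))) : Prop :=
  (∀ i : Fin m, σ ⟨2 * (i : ℕ), by omega⟩ < σ ⟨2 * (i : ℕ) + 1, by omega⟩) ∧
    StrictMono (fun i : Fin m => σ ⟨2 * (i : ℕ), by omega⟩)

lemma IsCanonical.apply_zero {m : ℕ} {σ : Equiv.Perm (Fin (2 * m + 2))}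
    (h : IsCanonical (m := m + 1) σ) : σ 0 = 0 := by
  obtain ⟨k, hk⟩ := σ.surjective 0
  have h0 : ∀ i : Fin (m + 1), σ 0 ≤ σ ⟨2 * (i : ℕ), by omega⟩ := fun i =>
    h.2.monotone (Fin.zero_le i)
  rcases Nat.even_or_odd' (k : ℕ) with ⟨c, hc | hc⟩
  · have := h0 ⟨c, by omega⟩
    have e : (⟨2 * c, by omega⟩ : Fin (2 * m + 2)) = k := Fin.ext hc.symm
    simp only [e, hk] at this
    exact Fin.le_zero_iff.1 this
  · have := h.1 ⟨c, by omega⟩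
    have e : (⟨2 * c + 1, by omega⟩ : Fin (2 * m + 2)) = k := Fin.ext hc.symm
    change σ _ < σ _ at this
    simp only [e, hk] at this
    exact absurd this (Fin.not_lt_zero _)

lemma isCanonical_insertPair {m : ℕ} (j : Fin (2 * m + 1)) (τ : Equiv.Perm (Fin (2 * m))) :
    IsCanonical (m := m + 1) (insertPair j τ) ↔ IsCanonical τ := by
  have e0 (i : Fin m) : insertPair j τ ⟨2 * (i.succ : ℕ), by grind⟩ =
      (j.succAbove (τ ⟨2 * i, by omega⟩)).succ := insertPair_succ_succ j τ ⟨2 * i, by omega⟩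
  have e1 (i : Fin m) : insertPair j τ ⟨2 * (i.succ : ℕ) + 1, by grind⟩ =
      (j.succAbove (τ ⟨2 * i + 1, by omega⟩)).succ :=
    insertPair_succ_succ j τ ⟨2 * i + 1, by omega⟩
  have hs : StrictMono fun k => (j.succAbove k).succ :=
    (Fin.strictMono_succ).comp (Fin.strictMono_succAbove j)
  constructor
  · rintro ⟨h1, h2⟩
    refine ⟨fun i => ?_, fun a b hab => ?_⟩
    · exact hs.lt_iff_lt.1 (lt_of_eq_of_lt (e0 i).symm (lt_of_lt_of_eq (h1 i.succ) (e1 i)))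
    · exact hs.lt_iff_lt.1 (lt_of_eq_of_lt (e0 a).symm
        (lt_of_lt_of_eq (h2 (Fin.succ_lt_succ_iff.2 hab)) (e0 b)))
  · rintro ⟨h1, h2⟩
    refine ⟨fun i => ?_, fun a b hab => ?_⟩
    · cases i using Fin.cases with
      | zero =>
        change insertPair j τ 0 < insertPair j τ 1
        rw [insertPair_zero, insertPair_one]
        exact Fin.succ_pos _
      | succ i =>
        exact lt_of_eq_of_lt (e0 i) (lt_of_lt_of_eq (hs (h1 i)) (e1 i).symm)
    · cases b using Fin.cases with
      | zero => exact absurd hab (Fin.not_lt_zero _)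
      | succ b =>
        cases a using Fin.cases with
        | zero =>
          exact lt_of_eq_of_lt (insertPair_zero j τ)
            (lt_of_lt_of_eq (Fin.succ_pos _) (e0 b).symm)
        | succ a =>
          exact lt_of_eq_of_lt (e0 a)
            (lt_of_lt_of_eq (hs (h2 (Fin.succ_lt_succ_iff.1 hab))) (e0 b).symm)

/-- Expansion of the Pfaffian along the first row. -/
theorem pfaff_succ {R : Type*} [CommRing R] {m : ℕ}
    (A : Matrix (Fin (2 * m + 2)) (Fin (2 * m + 2)) R) :
    pfaff (m := m + 1) A = ∑ j : Fin (2 * m + 1), (-1) ^ (j : ℕ) * A 0 j.succ *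
      pfaff (A.submatrix (fun k => (j.succAbove k).succ) (fun k => (j.succAbove k).succ)) := by
  classical
  simp only [pfaff, mul_sum]
  rw [← Finset.sum_product']
  symm
  refine Finset.sum_bij (fun p _ => insertPair p.1 p.2) ?_ ?_ ?_ ?_
  · rintro ⟨j, τ⟩ h
    simp only [mem_product, mem_filter, mem_univ, true_and] at h ⊢
    exact (isCanonical_insertPair j τ).2 h
  · rintro ⟨j, τ⟩ _ ⟨j', τ'⟩ _ h
    exact Prod.ext_iff.2 (insertPair_injective h)
  · intro σ h
    simp only [mem_filter, mem_univ, true_and] at h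
    obtain ⟨j, τ, rfl⟩ := exists_insertPair σ (IsCanonical.apply_zero h)
    refine ⟨(j, τ), ?_, rfl⟩
    simp only [mem_product, mem_filter, mem_univ, true_and]
    exact (isCanonical_insertPair j τ).1 h
  · rintro ⟨j, τ⟩ _
    rw [Fin.prod_univ_succ]
    have e : ∀ i : Fin m, A (insertPair j τ ⟨2 * (i.succ : ℕ), by grind⟩)
        (insertPair j τ ⟨2 * (i.succ : ℕ) + 1, by grind⟩) =
        A (j.succAbove (τ ⟨2 * i, by omega⟩)).succ (j.succAbove (τ ⟨2 * i + 1, by omega⟩)).succ :=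
      fun i => congrArg₂ A (insertPair_succ_succ j τ ⟨2 * i, by omega⟩)
        (insertPair_succ_succ j τ ⟨2 * i + 1, by omega⟩)
    have e0 : A (insertPair j τ ⟨2 * ((0 : Fin (m + 1)) : ℕ), by simp⟩)
        (insertPair j τ ⟨2 * ((0 : Fin (m + 1)) : ℕ) + 1, by simp⟩) = A 0 j.succ :=
      congrArg₂ A (insertPair_zero j τ) (insertPair_one j τ)
    erw [e0, sign_insertPair, Finset.prod_congr rfl fun i _ => e i]
    simp only [Matrix.submatrix_apply, zsmul_eq_mul]
    push_cast
    ring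

lemma pfaff_neg {R : Type*} [CommRing R] {m : ℕ} (A : Matrix (Fin (2 * m)) (Fin (2 * m)) R) :
    pfaff (-A) = (-1) ^ m * pfaff A := by
  simp only [pfaff, mul_sum, Matrix.neg_apply, Finset.prod_neg, card_univ, Fintype.card_fin]
  refine sum_congr rfl fun σ _ => ?_
  rw [mul_smul_comm]

lemma sum_prod_lagrange {F ι : Type*} [Field F] [DecidableEq ι] {s u : Finset ι} {ξ : ι → F}
    (hcard : #s = #u + 1) (hξ : Set.InjOn ξ s) {c : F} (hc : c ≠ 0) :
    ∑ j ∈ s, (∏ k ∈ u, (1 - ξ j * ξ k)) * ∏ i ∈ s.erase j, ((1 - c * ξ i) / (ξ j - ξ i)) =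
      ∏ k ∈ u, (c - ξ k) := by
  let p : Polynomial F := ∏ k ∈ u, (1 - Polynomial.C (ξ k) * Polynomial.X)
  have hp : p.degree < #s := by
    rw [hcard]
    refine lt_of_le_of_lt (Polynomial.degree_prod_le _ _) ?_
    refine lt_of_le_of_lt (Finset.sum_le_card_nsmul _ _ 1 fun k _ => ?_) ?_
    · compute_degree
    · simp only [nsmul_eq_mul, mul_one]
      exact_mod_cast Nat.lt_succ_self _
  have h := congrArg (Polynomial.eval c⁻¹) (Lagrange.eq_interpolate hξ hp)
  have hpe : ∀ x, p.eval x = ∏ k ∈ u, (1 - x * ξ k) := fun x => by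
    simp [p, Polynomial.eval_prod, mul_comm x]
  simp only [Lagrange.interpolate_apply, Polynomial.eval_finsetSum, Polynomial.eval_mul,
    Polynomial.eval_C, hpe, Lagrange.basis, Polynomial.eval_prod, Lagrange.basisDivisor,
    Polynomial.eval_sub, Polynomial.eval_X] at h
  have h2 := congrArg (fun x => c ^ #u * x) h
  simp only [mul_sum] at h2
  rw [← Finset.prod_const, ← Finset.prod_mul_distrib] at h2
  refine (Eq.trans ?_ h2.symm).trans ?_
  · refine sum_congr rfl fun j hj => ?_
    have hcj : #u = #(s.erase j) := by rw [card_erase_of_mem hj, hcard]; rfl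
    rw [Finset.prod_const, hcj, ← Finset.prod_const, mul_left_comm, ← Finset.prod_mul_distrib]
    congr 1
    refine prod_congr rfl fun i hi => ?_
    field_simp
  · refine prod_congr rfl fun i hi => ?_
    field_simp

lemma det_vandermonde_succ {R : Type*} [CommRing R] {n : ℕ} (v : Fin (n + 1) → R) :
    (Matrix.vandermonde v).det =
      (∏ k : Fin n, (v k.succ - v 0)) * (Matrix.vandermonde fun k => v (Fin.succ k)).det := by
  simp [Matrix.det_vandermonde, Fin.prod_univ_succ, Fin.prod_Ioi_succ]

lemma det_vandermonde_comp_perm {R : Type*} [CommRing R] {n : ℕ} (v : Fin n → R)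
    (σ : Equiv.Perm (Fin n)) :
    (Matrix.vandermonde fun k => v (σ k)).det = Equiv.Perm.sign σ * (Matrix.vandermonde v).det :=
  Matrix.det_permute σ (Matrix.vandermonde v)

lemma det_vandermonde_succAbove {R : Type*} [CommRing R] {n : ℕ} (v : Fin (n + 1) → R)
    (j : Fin (n + 1)) :
    (-1) ^ (j : ℕ) * (Matrix.vandermonde v).det = (∏ k : Fin n, (v (j.succAbove k) - v j)) *
      (Matrix.vandermonde fun k => v (j.succAbove k)).det := by
  have h := det_vandermonde_comp_perm v j.cycleRange.symm
  rw [det_vandermonde_succ] at h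
  simp only [Fin.cycleRange_symm_zero, Fin.cycleRange_symm_succ, Equiv.Perm.sign_symm,
    Fin.sign_cycleRange] at h
  rw [h]
  push_cast
  rfl

section Products

variable {M : Type*} [CommMonoid M] {n : ℕ}

lemma prod_preimage_succ (T : Finset (Fin (n + 1))) (h0 : 0 ∉ T) (f : Fin (n + 1) → M) :
    ∏ i ∈ T, f i = ∏ i with Fin.succ i ∈ T, f i.succ := by
  rw [← Finset.prod_ite_mem_eq, Fin.prod_univ_succ, prod_filter]
  simp [h0]

lemma prod_compl_preimage_succ (T : Finset (Fin (n + 1))) (h0 : 0 ∉ T) (f : Fin (n + 1) → M) :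
    ∏ i ∈ Tᶜ, f i = f 0 * ∏ i ∈ ({i | Fin.succ i ∈ T} : Finset (Fin n))ᶜ, f i.succ := by
  rw [← Finset.prod_ite_mem_eq, Fin.prod_univ_succ, compl_filter, prod_filter]
  simp [h0]

lemma prod_preimage_succAbove (T : Finset (Fin (n + 1))) (j : Fin (n + 1)) (f : Fin (n + 1) → M) :
    ∏ k with j.succAbove k ∈ T, f (j.succAbove k) = ∏ i ∈ T.erase j, f i := by
  rw [← Finset.prod_ite_mem_eq (T.erase j), Fin.prod_univ_succAbove _ j, prod_filter]
  simp [Fin.succAbove_ne]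

end Products
section Indicator

variable {F : Type*} [Field F]

/-- The matrix `(1_T(j) - 1_T(i)) / (1 - ζ i ζ j)` attached to a set `T` of indices. -/
def indicatorMatrix {n : ℕ} (ζ : Fin n → F) (T : Finset (Fin n)) : Matrix (Fin n) (Fin n) F :=
  fun i j => ((if j ∈ T then 1 else 0) - (if i ∈ T then 1 else 0)) / (1 - ζ i * ζ j)

lemma indicatorMatrix_compl {n : ℕ} (ζ : Fin n → F) (T : Finset (Fin n)) :
    indicatorMatrix ζ Tᶜ = -indicatorMatrix ζ T := by
  ext i j
  by_cases hi : i ∈ T <;> by_cases hj : j ∈ T <;> simp [indicatorMatrix, hi, hj, neg_div]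

lemma pfaff_indicatorMatrix_term {n : ℕ} (hn : Even n) {ξ : Fin (n + 1) → F} (hξ : ξ.Injective)
    {c : F} (hc : ∀ i, 1 - c * ξ i ≠ 0) (hξξ : ∀ i j, i ≠ j → 1 - ξ i * ξ j ≠ 0)
    {U : Finset (Fin (n + 1))} {j : Fin (n + 1)} (hj : j ∈ U) :
    (-1) ^ (j : ℕ) * (1 / (1 - c * ξ j)) * ((Matrix.vandermonde fun k => ξ (j.succAbove k)).det *
      ∏ i ∈ U.erase j, ∏ k ∈ Uᶜ, ((ξ i - ξ k) * (1 - ξ i * ξ k))⁻¹) =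
    (Matrix.vandermonde ξ).det * (∏ i ∈ U, ∏ k ∈ Uᶜ, ((ξ i - ξ k) * (1 - ξ i * ξ k))⁻¹) *
      (∏ i ∈ U, (1 - c * ξ i)⁻¹) *
      ((∏ k ∈ Uᶜ, (1 - ξ j * ξ k)) * ∏ i ∈ U.erase j, ((1 - c * ξ i) / (ξ j - ξ i))) := by
  have hV := det_vandermonde_succAbove ξ j
  have hprod : (∏ k : Fin n, (ξ (j.succAbove k) - ξ j)) =
      (∏ i ∈ U.erase j, (ξ j - ξ i)) * ∏ k ∈ Uᶜ, (ξ j - ξ k) := by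
    have h1 : (∏ k : Fin n, (ξ (j.succAbove k) - ξ j)) =
        ∏ k : Fin n, (ξ j - ξ (j.succAbove k)) := by
      rw [← Finset.prod_congr rfl fun k _ => neg_sub (ξ (j.succAbove k)) (ξ j), Finset.prod_neg]
      simp [hn.neg_one_pow]
    have h2 := prod_preimage_succAbove Finset.univ j fun i => ξ j - ξ i
    have h3 : univ.erase j = U.erase j ∪ Uᶜ := by
      ext i
      by_cases hij : i = j <;> simp [hij, hj, em]
    rw [h1, ← Finset.prod_union, ← h3, ← h2]
    · simp
    · exact Disjoint.mono_left (erase_subset _ _) disjoint_compl_right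
  rw [hprod] at hV
  have hU : ∀ k ∈ Uᶜ, j ≠ k := fun k hk h => (mem_compl.1 hk) (h ▸ hj)
  have n1 : ∏ i ∈ U.erase j, (ξ j - ξ i) ≠ 0 := Finset.prod_ne_zero_iff.2 fun i hi =>
    sub_ne_zero.2 fun h => (mem_erase.1 hi).1 (hξ h).symm
  have n2 : ∏ k ∈ Uᶜ, (ξ j - ξ k) ≠ 0 := Finset.prod_ne_zero_iff.2 fun k hk =>
    sub_ne_zero.2 fun h => hU k hk (hξ h)
  have n3 : ∏ k ∈ Uᶜ, (1 - ξ j * ξ k) ≠ 0 := Finset.prod_ne_zero_iff.2 fun k hk =>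
    hξξ _ _ (hU k hk)
  have n4 : ∏ i ∈ U.erase j, (1 - c * ξ i) ≠ 0 := Finset.prod_ne_zero_iff.2 fun i _ => hc i
  have n5 := hc j
  rw [← Finset.mul_prod_erase U _ hj, ← Finset.mul_prod_erase U _ hj]
  generalize (∏ i ∈ U.erase j, ∏ k ∈ Uᶜ, ((ξ i - ξ k) * (1 - ξ i * ξ k))⁻¹) = P
  simp only [Finset.prod_inv_distrib, Finset.prod_mul_distrib, Finset.prod_div_distrib]
  have hs : ((-1 : F) ^ (j : ℕ)) * (-1) ^ (j : ℕ) = 1 := by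
    rw [← mul_pow]; simp
  have hV' : (Matrix.vandermonde ξ).det = (-1) ^ (j : ℕ) *
      ((∏ i ∈ U.erase j, (ξ j - ξ i)) * (∏ k ∈ Uᶜ, (ξ j - ξ k)) *
      (Matrix.vandermonde fun k => ξ (j.succAbove k)).det) := by
    rw [← hV, ← mul_assoc, hs, one_mul]
  rw [hV']
  field_simp

theorem pfaff_indicatorMatrix (m : ℕ) (ζ : Fin (2 * m) → F) (hζ : ∀ i, ζ i ≠ 0)
    (hinj : ζ.Injective) (hζζ : ∀ i j, i ≠ j → 1 - ζ i * ζ j ≠ 0) (T : Finset (Fin (2 * m)))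
    (hT : #T = m) :
    pfaff (indicatorMatrix ζ T) = (-1) ^ m.choose 2 * ((Matrix.vandermonde ζ).det *
      ∏ i ∈ T, ∏ k ∈ Tᶜ, ((ζ i - ζ k) * (1 - ζ i * ζ k))⁻¹) := by
  induction m with
  | zero =>
    have : IsEmpty (Fin (2 * 0)) := inferInstanceAs (IsEmpty (Fin 0))
    obtain rfl : T = ∅ := Subsingleton.elim _ _
    simp [pfaff, Matrix.det_isEmpty, StrictMono, filter_true_of_mem]
  | succ m ih =>
    change Fin (2 * m + 2) → F at ζ
    change Finset (Fin (2 * m + 2)) at T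
    have key : ∀ T : Finset (Fin (2 * m + 2)), 0 ∉ T → #T = m + 1 →
        pfaff (m := m + 1) (indicatorMatrix ζ T) =
          (-1) ^ (m + 1).choose 2 * ((Matrix.vandermonde ζ).det *
            ∏ i ∈ T, ∏ k ∈ Tᶜ, ((ζ i - ζ k) * (1 - ζ i * ζ k))⁻¹) := by
      clear T hT
      intro T h0 hT
      set U : Finset (Fin (2 * m + 1)) := {i | Fin.succ i ∈ T} with hUdef
      have hU : #U = m + 1 := by
        have := prod_preimage_succ T h0 (fun _ => Multiplicative.ofAdd 1)
        have h := congrArg Multiplicative.toAdd this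
        simpa [hT] using h.symm
      have hUc : #Uᶜ = m := by
        rw [card_compl, hU, Fintype.card_fin]; omega
      set ξ : Fin (2 * m + 1) → F := fun i => ζ i.succ with hξdef
      have hξ : ξ.Injective := hinj.comp (Fin.succ_injective _)
      have hξξ : ∀ i j, i ≠ j → 1 - ξ i * ξ j ≠ 0 := fun i j hij =>
        hζζ _ _ (fun h => hij (Fin.succ_injective _ h))
      have hc : ∀ i, 1 - ζ 0 * ξ i ≠ 0 := fun i => hζζ _ _ (Fin.succ_ne_zero i).symm
      have hpf : ∀ j ∈ U, pfaff ((indicatorMatrix ζ T).submatrix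
          (fun k => (j.succAbove k).succ) (fun k => (j.succAbove k).succ)) =
          (-1) ^ m.choose 2 * ((Matrix.vandermonde fun k => ξ (j.succAbove k)).det *
            ∏ i ∈ U.erase j, ∏ k ∈ Uᶜ, ((ξ i - ξ k) * (1 - ξ i * ξ k))⁻¹) := by
        intro j hj
        set W : Finset (Fin (2 * m)) := {k | j.succAbove k ∈ U} with hW
        have hWc : Wᶜ = ({k | j.succAbove k ∈ Uᶜ} : Finset (Fin (2 * m))) := by
          ext k; simp [hW]
        have hWcard : #W = m := by
          have := prod_preimage_succAbove U j (fun _ => Multiplicative.ofAdd 1)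
          have h := congrArg Multiplicative.toAdd this
          simpa [hU, card_erase_of_mem hj] using h
        have h := ih (fun k => ξ (j.succAbove k)) (fun k => hζ _)
          (hξ.comp (Fin.succAbove_right_injective))
          (fun a b hab => hξξ _ _ fun h => hab (Fin.succAbove_right_injective h)) W hWcard
        have hM : (indicatorMatrix ζ T).submatrix (fun k => (j.succAbove k).succ)
            (fun k => (j.succAbove k).succ) =
            indicatorMatrix (fun k => ξ (j.succAbove k)) W := by
          ext a b
          simp [indicatorMatrix, hW, hUdef, hξdef]
        rw [hM, h, hWc]
        congr 2
        rw [prod_preimage_succAbove U j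
          (fun i => ∏ k with j.succAbove k ∈ Uᶜ, ((ξ i - ξ (j.succAbove k)) *
            (1 - ξ i * ξ (j.succAbove k)))⁻¹)]
        refine prod_congr rfl fun i _ => ?_
        rw [prod_preimage_succAbove Uᶜ j (fun k => ((ξ i - ξ k) * (1 - ξ i * ξ k))⁻¹),
          erase_eq_of_notMem (by simpa using hj)]
      have hA : ∀ j, indicatorMatrix ζ T 0 j.succ =
          if j ∈ U then 1 / (1 - ζ 0 * ξ j) else 0 := by
        intro j
        by_cases hj : j.succ ∈ T <;> simp [indicatorMatrix, h0, hj, hUdef, hξdef]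
      rw [pfaff_succ]
      simp only [hA, mul_ite, mul_zero, ite_mul, zero_mul]
      rw [← Finset.sum_filter, Finset.filter_mem_eq_inter, univ_inter]
      have hsum := sum_prod_lagrange (hU.trans (congrArg (· + 1) hUc.symm)) hξ.injOn (hζ 0)
      have hterm : ∀ j ∈ U, (-1) ^ (j : ℕ) * (1 / (1 - ζ 0 * ξ j)) *
          pfaff ((indicatorMatrix ζ T).submatrix
          (fun k => (j.succAbove k).succ) (fun k => (j.succAbove k).succ)) =
          (-1) ^ m.choose 2 * ((Matrix.vandermonde ξ).det *
          (∏ i ∈ U, ∏ k ∈ Uᶜ, ((ξ i - ξ k) * (1 - ξ i * ξ k))⁻¹) *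
          (∏ i ∈ U, (1 - ζ 0 * ξ i)⁻¹)) *
          ((∏ k ∈ Uᶜ, (1 - ξ j * ξ k)) *
            ∏ i ∈ U.erase j, ((1 - ζ 0 * ξ i) / (ξ j - ξ i))) := by
        intro j hj
        rw [hpf j hj, mul_left_comm, pfaff_indicatorMatrix_term (even_two_mul m) hξ hc hξξ hj]
        ring
      rw [sum_congr rfl hterm, ← mul_sum, hsum, det_vandermonde_succ ζ, prod_preimage_succ T h0]
      simp only [prod_compl_preimage_succ T h0, ← hUdef]
      rw [← Finset.prod_mul_prod_compl U fun k => ζ k.succ - ζ 0, Nat.choose_succ_succ' m 1,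
        Nat.choose_one_right, pow_add]
      have hflip : ∏ k ∈ Uᶜ, (ζ 0 - ξ k) = (-1) ^ m * ∏ k ∈ Uᶜ, (ζ k.succ - ζ 0) := by
        have h := Finset.prod_neg (s := Uᶜ) (fun k => ζ k.succ - ζ 0)
        rw [hUc] at h
        rw [← h]
        simp [hξdef]
      rw [hflip, Finset.prod_mul_distrib]
      have hcancel : (∏ k ∈ U, (ζ k.succ - ζ 0)) *
          ∏ k ∈ U, ((ζ k.succ - ζ 0) * (1 - ζ k.succ * ζ 0))⁻¹ =
          ∏ i ∈ U, (1 - ζ 0 * ξ i)⁻¹ := by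
        rw [← Finset.prod_mul_distrib]
        refine prod_congr rfl fun k _ => ?_
        have : ζ k.succ - ζ 0 ≠ 0 := sub_ne_zero.2 fun h => Fin.succ_ne_zero k (hinj h)
        rw [mul_inv, mul_inv_cancel_left₀ this, mul_comm (ζ 0)]
      rw [← hcancel]
      simp only [hξdef]
      ring
    by_cases h0 : (0 : Fin (2 * m + 2)) ∈ T
    · have hTc : #Tᶜ = m + 1 := by
        rw [card_compl, hT, Fintype.card_fin]; omega
      have h := key Tᶜ (by simpa using h0) hTc
      rw [indicatorMatrix_compl, pfaff_neg, compl_compl, prod_comm] at h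
      have hflip : ∏ i ∈ T, ∏ k ∈ Tᶜ, ((ζ k - ζ i) * (1 - ζ k * ζ i))⁻¹ =
          (-1) ^ (m + 1) * ∏ i ∈ T, ∏ k ∈ Tᶜ, ((ζ i - ζ k) * (1 - ζ i * ζ k))⁻¹ := by
        have : ∀ i k, ((ζ k - ζ i) * (1 - ζ k * ζ i))⁻¹ =
            -((ζ i - ζ k) * (1 - ζ i * ζ k))⁻¹ := fun i k => by
          rw [← inv_neg]; congr 1; ring
        rw [prod_congr rfl fun i _ => prod_congr rfl fun k _ => this i k]
        simp only [Finset.prod_neg, hTc, Finset.prod_mul_distrib, prod_const, hT]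
        rw [← pow_mul]
        congr 1
        rcases Nat.even_or_odd (m + 1) with he | ho
        · rw [he.neg_one_pow, (he.mul_left _).neg_one_pow]
        · rw [ho.neg_one_pow, (ho.mul ho).neg_one_pow]
      rw [hflip] at h
      have hne : ((-1 : F) ^ (m + 1)) ≠ 0 := pow_ne_zero _ (neg_ne_zero.2 one_ne_zero)
      apply mul_left_cancel₀ hne
      rw [h, mul_left_comm (Matrix.det _), mul_left_comm ((-1 : F) ^ (m + 1).choose 2)]
      rfl
    · exact key T h0 hT

end Indicator
section Multilinear

variable {F ι : Type*} [Field F]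

/-- The functions `(ι → F) → F` that are linear combinations of squarefree monomials of
degree `m`. -/
def squarefreeForms (F ι : Type*) [Field F] (m : ℕ) : Submodule F ((ι → F) → F) :=
  Submodule.span F {f | ∃ T : Finset ι, #T = m ∧ f = fun a => ∏ t ∈ T, a t}

lemma eq_sum_of_mem_squarefreeForms [Fintype ι] [DecidableEq ι] {m : ℕ} {f : (ι → F) → F}
    (hf : f ∈ squarefreeForms F ι m)
    (a : ι → F) :
    f a = ∑ T ∈ powersetCard m univ, f (fun i => if i ∈ T then 1 else 0) * ∏ t ∈ T, a t := by
  induction hf using Submodule.span_induction with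
  | mem f hf =>
    obtain ⟨U, hU, rfl⟩ := hf
    dsimp only
    rw [Finset.sum_eq_single U]
    · rw [Finset.prod_congr rfl fun i hi => if_pos hi]
      simp
    · intro T hT hne
      have hUT : ¬ U ⊆ T := fun h =>
        hne (Finset.eq_of_subset_of_card_le h (by rw [(mem_powersetCard.1 hT).2, hU])).symm
      obtain ⟨i, hi, hiT⟩ := Finset.not_subset.1 hUT
      rw [Finset.prod_eq_zero hi (by simp [hiT]), zero_mul]
    · intro h
      exact absurd (mem_powersetCard.2 ⟨subset_univ _, hU⟩) h
  | zero => simp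
  | add f g _ _ hf hg => simp only [Pi.add_apply, hf, hg, add_mul, sum_add_distrib]
  | smul c f _ hf => simp only [Pi.smul_apply, smul_eq_mul, hf, mul_sum, mul_assoc]

lemma eq_of_mem_squarefreeForms [Fintype ι] [DecidableEq ι] {m : ℕ} {f g : (ι → F) → F}
    (hf : f ∈ squarefreeForms F ι m) (hg : g ∈ squarefreeForms F ι m)
    (h : ∀ T : Finset ι, #T = m →
      f (fun i => if i ∈ T then 1 else 0) = g (fun i => if i ∈ T then 1 else 0)) : f = g := by
  ext a
  rw [eq_sum_of_mem_squarefreeForms hf, eq_sum_of_mem_squarefreeForms hg]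
  exact sum_congr rfl fun T hT => by rw [h T (mem_powersetCard.1 hT).2]

lemma prod_sub_mem_squarefreeForms {m : ℕ} {p q : Fin m → ι} (hp : p.Injective)
    (hq : q.Injective) (hpq : ∀ i j, p i ≠ q j) :
    (fun a : ι → F => ∏ i, (a (q i) - a (p i))) ∈ squarefreeForms F ι m := by
  have h : (fun a : ι → F => ∏ i, (a (q i) - a (p i))) =
      ∑ t ∈ (univ : Finset (Fin m)).powerset,
        (-1 : F) ^ #t • fun a : ι → F => ∏ i, a (t.piecewise p q i) := by
    ext a
    rw [Finset.prod_sub]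
    simp only [Finset.sum_apply, Pi.smul_apply, smul_eq_mul]
    refine sum_congr rfl fun t _ => ?_
    have hpw : ∀ i, a (t.piecewise p q i) = t.piecewise (a ∘ p) (a ∘ q) i := fun i => by
      by_cases hi : i ∈ t <;> simp [hi]
    simp only [hpw, Finset.prod_piecewise, univ_inter, Function.comp]
    ring
  rw [h]
  refine Submodule.sum_mem _ fun t _ => Submodule.smul_mem _ _ (Submodule.subset_span ?_)
  have hinj : Function.Injective (t.piecewise p q) := by
    intro i j hij
    by_cases hi : i ∈ t <;> by_cases hj : j ∈ t <;> simp only [hi, hj, not_false_eq_true,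
      piecewise_eq_of_mem, piecewise_eq_of_notMem] at hij
    · exact hp hij
    · exact absurd hij (hpq _ _)
    · exact absurd hij.symm (hpq _ _)
    · exact hq hij
  refine ⟨univ.map ⟨_, hinj⟩, by simp, ?_⟩
  ext a
  simp

end Multilinear

section PairProducts

variable {R : Type*} [CommRing R]

lemma prod_Ioi_eq_prod_ite {ι M : Type*} [Fintype ι] [LinearOrder ι] [LocallyFiniteOrderTop ι]
    [CommMonoid M] (f : ι → ι → M) :
    ∏ i, ∏ j ∈ Ioi i, f i j = ∏ i, ∏ j, if i < j then f i j else 1 := by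
  refine prod_congr rfl fun i _ => ?_
  rw [← prod_filter]
  congr 1
  ext j
  simp

lemma prod_pairs_neg_one (n : ℕ) : ∏ i : Fin n, ∏ _j ∈ Ioi i, (-1 : R) = (-1) ^ n.choose 2 := by
  induction n with
  | zero => simp
  | succ n ih =>
    rw [Fin.prod_univ_succ, Fin.prod_Ioi_zero]
    simp only [Fin.prod_Ioi_succ, ih]
    rw [Nat.choose_succ_succ' n 1, Nat.choose_one_right, pow_add]
    simp

lemma prod_pairs_mul {n : ℕ} (v : Fin n → R) :
    (∏ i, ∏ j ∈ Ioi i, (v i * v j)) * ∏ i, v i = ∏ i, v i ^ n := by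
  induction n with
  | zero => simp
  | succ n ih =>
    have h0 : ∏ k : Fin n, (v 0 * v k.succ) = v 0 ^ n * ∏ k : Fin n, v k.succ := by
      simp [Finset.prod_mul_distrib]
    rw [Fin.prod_univ_succ, Fin.prod_Ioi_zero, Fin.prod_univ_succ (fun i => v i),
      Fin.prod_univ_succ (fun i => v i ^ (n + 1))]
    simp only [Fin.prod_Ioi_succ, pow_succ, Finset.prod_mul_distrib (f := fun i => _ ^ n)]
    rw [h0, ← ih]
    ring

lemma prod_sub_ne_eq_sq_vandermonde {n : ℕ} (v : Fin n → R) :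
    ∏ i, ∏ k ∈ univ.erase i, (v i - v k) =
      (-1) ^ n.choose 2 * (Matrix.vandermonde v).det ^ 2 := by
  have h1 : ∏ i, ∏ k ∈ univ.erase i, (v i - v k) =
      ∏ i, ∏ k, ((if i < k then v i - v k else 1) * if k < i then v i - v k else 1) := by
    refine prod_congr rfl fun i _ => ?_
    rw [← Finset.prod_ite_mem_eq]
    refine prod_congr rfl fun k _ => ?_
    rcases lt_trichotomy i k with h | h | h
    · simp [h, h.not_gt, h.ne']
    · simp [h]
    · simp [h, h.not_gt, h.ne]
  have h2 : ∏ i, ∏ k, (if k < i then v i - v k else 1) =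
      ∏ k, ∏ i, if k < i then v i - v k else 1 := prod_comm
  have h3 : ∏ i, ∏ k ∈ Ioi i, (v i - v k) = (-1) ^ n.choose 2 * (Matrix.vandermonde v).det := by
    rw [← prod_pairs_neg_one, Matrix.det_vandermonde, ← Finset.prod_mul_distrib]
    refine prod_congr rfl fun i _ => ?_
    rw [← Finset.prod_mul_distrib]
    exact prod_congr rfl fun j _ => by ring
  simp only [h1, Finset.prod_mul_distrib]
  rw [h2, ← prod_Ioi_eq_prod_ite, ← prod_Ioi_eq_prod_ite fun k i => v i - v k, h3,
    ← Matrix.det_vandermonde, sq, mul_assoc]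

end PairProducts

section Split

variable {R : Type*} [CommRing R]

/-- The Vandermonde product of a family split into two halves. -/
noncomputable def splitVandermonde {k l : ℕ} (w : Fin k ⊕ Fin l → R) : R :=
  (Matrix.vandermonde (w ∘ Sum.inl)).det * (Matrix.vandermonde (w ∘ Sum.inr)).det *
    ∏ i, ∏ j, (w (Sum.inr j) - w (Sum.inl i))

lemma splitVandermonde_eq_det {k l : ℕ} (w : Fin k ⊕ Fin l → R) :
    splitVandermonde w = (Matrix.vandermonde (w ∘ finSumFinEquiv.symm)).det := by
  have hlt (i : Fin k) (j : Fin l) : Fin.castAdd l i < Fin.natAdd k j := by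
    simp [Fin.lt_def]; omega
  have hcast (i j : Fin k) : Fin.castAdd l i < Fin.castAdd l j ↔ i < j := Iff.rfl
  rw [splitVandermonde, Matrix.det_vandermonde, Matrix.det_vandermonde, Matrix.det_vandermonde,
    prod_Ioi_eq_prod_ite, prod_Ioi_eq_prod_ite, prod_Ioi_eq_prod_ite]
  simp [Fin.prod_univ_add, hlt, hcast, (hlt _ _).not_gt, Finset.prod_mul_distrib]
  ring

lemma splitVandermonde_comp_perm {k l : ℕ} (w : Fin k ⊕ Fin l → R)
    (σ : Equiv.Perm (Fin k ⊕ Fin l)) :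
    splitVandermonde (w ∘ σ) = Equiv.Perm.sign σ * splitVandermonde w := by
  have h := det_vandermonde_comp_perm (w ∘ finSumFinEquiv.symm)
    ((finSumFinEquiv.symm.trans σ).trans finSumFinEquiv)
  rw [splitVandermonde_eq_det, splitVandermonde_eq_det]
  have hs : Equiv.Perm.sign ((finSumFinEquiv.symm.trans σ).trans finSumFinEquiv) =
      Equiv.Perm.sign σ := Equiv.Perm.sign_symm_trans_trans σ finSumFinEquiv
  rw [hs] at h
  rw [← h]
  congr 2
  ext i
  simp

lemma prod_eq_prod_orderEmbOfFin {n k : ℕ} {M : Type*} [CommMonoid M] {S : Finset (Fin n)}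
    (hS : #S = k) (f : Fin n → M) : ∏ i ∈ S, f i = ∏ a, f (S.orderEmbOfFin hS a) := by
  rw [← Finset.prod_image (f := f) (g := S.orderEmbOfFin hS)
    fun a _ b _ h => (S.orderEmbOfFin hS).injective h]
  simp

lemma splitVandermonde_finSumEquivOfFinset {n k l : ℕ} (z : Fin n → R) {S : Finset (Fin n)}
    (hk : #S = k) (hl : #Sᶜ = l) :
    splitVandermonde (z ∘ finSumEquivOfFinset hk hl) =
      (-1) ^ (k.choose 2 + ∑ s ∈ S, (s : ℕ)) * (Matrix.vandermonde z).det := by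
  have hsq (N : ℕ) : ((-1 : R) ^ N) * (-1) ^ N = 1 := by rw [← mul_pow]; simp
  have hin {k : ℕ} {S : Finset (Fin n)} (hk : #S = k) :
      (Matrix.vandermonde fun a => z (S.orderEmbOfFin hk a)).det =
        ∏ i ∈ S, ∏ j ∈ S, if i < j then z j - z i else 1 := by
    simp only [prod_eq_prod_orderEmbOfFin hk, Matrix.det_vandermonde, prod_Ioi_eq_prod_ite,
      OrderEmbedding.lt_iff_lt]
  have hsign : (∏ i ∈ S, ∏ j ∈ Sᶜ, if j < i then (-1 : R) else 1) =
      (-1) ^ (k.choose 2 + ∑ s ∈ S, (s : ℕ)) := by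
    have h1 : (∏ i ∈ S, ∏ j ∈ S, if j < i then (-1 : R) else 1) = (-1) ^ k.choose 2 := by
      rw [prod_comm, ← prod_pairs_neg_one, prod_Ioi_eq_prod_ite]
      simp only [prod_eq_prod_orderEmbOfFin hk, OrderEmbedding.lt_iff_lt]
    have h2 : (∏ i ∈ S, ∏ j ∈ S, if j < i then (-1 : R) else 1) *
        (∏ i ∈ S, ∏ j ∈ Sᶜ, if j < i then (-1 : R) else 1) = (-1) ^ ∑ s ∈ S, (s : ℕ) := by
      rw [← Finset.prod_mul_distrib, ← Finset.prod_pow_eq_pow_sum]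
      refine prod_congr rfl fun i _ => ?_
      rw [Finset.prod_mul_prod_compl, ← Finset.prod_filter, Finset.filter_gt_eq_Iio]
      simp
    rw [pow_add, ← h2, h1, ← mul_assoc, hsq, one_mul]
  have hcross : (∏ i ∈ S, ∏ j ∈ Sᶜ, if i < j then z j - z i else 1) *
      (∏ i ∈ Sᶜ, ∏ j ∈ S, if i < j then z j - z i else 1) =
      (-1) ^ (k.choose 2 + ∑ s ∈ S, (s : ℕ)) * ∏ i ∈ S, ∏ j ∈ Sᶜ, (z j - z i) := by
    rw [prod_comm (s := Sᶜ), ← hsign, ← Finset.prod_mul_distrib, ← Finset.prod_mul_distrib]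
    refine prod_congr rfl fun i hi => ?_
    rw [← Finset.prod_mul_distrib, ← Finset.prod_mul_distrib]
    refine prod_congr rfl fun j hj => ?_
    rcases lt_trichotomy i j with h | h | h
    · simp [h, h.not_gt]
    · exact absurd (h ▸ hi) (mem_compl.1 hj)
    · simp [h, h.not_gt]
  have hV : (Matrix.vandermonde z).det =
      ((∏ i ∈ S, ∏ j ∈ S, if i < j then z j - z i else 1) *
        ∏ i ∈ Sᶜ, ∏ j ∈ Sᶜ, if i < j then z j - z i else 1) *
      ((∏ i ∈ S, ∏ j ∈ Sᶜ, if i < j then z j - z i else 1) *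
        ∏ i ∈ Sᶜ, ∏ j ∈ S, if i < j then z j - z i else 1) := by
    rw [Matrix.det_vandermonde, prod_Ioi_eq_prod_ite, ← Finset.prod_mul_prod_compl S]
    simp only [← Finset.prod_mul_prod_compl S (fun j => ite _ _ _), Finset.prod_mul_distrib]
    ring
  rw [hV, hcross, ← hin hk, ← hin hl, splitVandermonde, prod_eq_prod_orderEmbOfFin hk]
  simp only [prod_eq_prod_orderEmbOfFin hl, Function.comp_def, finSumEquivOfFinset_inl,
    finSumEquivOfFinset_inr]
  rw [mul_left_comm, ← mul_assoc ((-1 : R) ^ _), hsq, one_mul]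

end Split

section DoubleVandermonde

variable {F ι : Type*} [Field F] {m : ℕ}

/-- The matrix with rows `(1, w i, …, w i ^ (m - 1), a i, a i * w i, …, a i * w i ^ (m - 1))`. -/
def doubleVandermonde (m : ℕ) (w a : ι → F) : Matrix ι (Fin m ⊕ Fin m) F :=
  Matrix.of fun i => Sum.elim (fun k => w i ^ (k : ℕ)) (fun k => a i * w i ^ (k : ℕ))

lemma det_doubleVandermonde_comp_perm (w a : Fin m ⊕ Fin m → F)
    (σ : Equiv.Perm (Fin m ⊕ Fin m)) :
    (doubleVandermonde m (w ∘ σ) (a ∘ σ)).det =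
      Equiv.Perm.sign σ * (doubleVandermonde m w a).det :=
  Matrix.det_permute σ (doubleVandermonde m w a)

lemma doubleVandermonde_eq_fromBlocks (w a : Fin m ⊕ Fin m → F) :
    doubleVandermonde m w a = Matrix.fromBlocks (Matrix.vandermonde (w ∘ Sum.inl))
      (Matrix.diagonal (a ∘ Sum.inl) * Matrix.vandermonde (w ∘ Sum.inl))
      (Matrix.vandermonde (w ∘ Sum.inr))
      (Matrix.diagonal (a ∘ Sum.inr) * Matrix.vandermonde (w ∘ Sum.inr)) := by
  ext (i | i) (j | j) <;> simp [doubleVandermonde, Matrix.vandermonde_apply]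

lemma det_doubleVandermonde_zero_one (w a : Fin m ⊕ Fin m → F) (hl : a ∘ Sum.inl = 0)
    (hr : a ∘ Sum.inr = 1) :
    (doubleVandermonde m w a).det =
      (Matrix.vandermonde (w ∘ Sum.inl)).det * (Matrix.vandermonde (w ∘ Sum.inr)).det := by
  rw [doubleVandermonde_eq_fromBlocks, hl, hr, Matrix.diagonal_zero', Matrix.zero_mul,
    Matrix.det_fromBlocks_zero₁₂, Pi.one_def, Matrix.diagonal_one,
    Matrix.one_mul]

lemma lagrange_mul_vandermonde {x : Fin m → F} (hx : x.Injective) (y : Fin m → F) :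
    (Matrix.of fun j i => (Lagrange.basis univ x i).eval (y j)) * Matrix.vandermonde x =
      Matrix.vandermonde y := by
  ext j p
  have h := Lagrange.eq_interpolate (f := (Polynomial.X : Polynomial F) ^ (p : ℕ))
    (s := univ) hx.injOn (by simp)
  have h' := congrArg (Polynomial.eval (y j)) h
  rw [Lagrange.interpolate_apply, Polynomial.eval_finsetSum] at h'
  simp only [Polynomial.eval_mul, Polynomial.eval_C, Polynomial.eval_pow, Polynomial.eval_X] at h'
  simp [Matrix.mul_apply, Matrix.vandermonde_apply, h', mul_comm]

lemma det_doubleVandermonde {w : Fin m ⊕ Fin m → F} (hw : w.Injective) (a : Fin m ⊕ Fin m → F) :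
    (doubleVandermonde m w a).det =
      (-1) ^ m.choose 2 * (∏ i, ∏ j, (w (Sum.inr j) - w (Sum.inl i))) *
        (Matrix.of fun i j : Fin m => (a (Sum.inr j) - a (Sum.inl i)) /
          (w (Sum.inr j) - w (Sum.inl i))).det := by
  set x := w ∘ Sum.inl with hx
  set y := w ∘ Sum.inr with hy
  have hxinj : x.Injective := hw.comp Sum.inl_injective
  set L : Matrix (Fin m) (Fin m) F := Matrix.of fun j i => (Lagrange.basis univ x i).eval (y j)
    with hL
  set N : Matrix (Fin m) (Fin m) F :=
    Matrix.diagonal (a ∘ Sum.inr) * L - L * Matrix.diagonal (a ∘ Sum.inl) with hN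
  have hLV : L * Matrix.vandermonde x = Matrix.vandermonde y := lagrange_mul_vandermonde hxinj y
  have hfac : doubleVandermonde m w a = Matrix.fromBlocks 1 0 L 1 *
      Matrix.fromBlocks (Matrix.vandermonde x)
        (Matrix.diagonal (a ∘ Sum.inl) * Matrix.vandermonde x) 0 (N * Matrix.vandermonde x) := by
    rw [doubleVandermonde_eq_fromBlocks, Matrix.fromBlocks_multiply, ← hx, ← hy, ← hLV, hN]
    congr 1
    · simp
    · simp
    · simp
    · simp only [Matrix.one_mul, Matrix.sub_mul, Matrix.mul_assoc]
      abel
  have hsub (i j) : y j - x i ≠ 0 := sub_ne_zero.2 fun h => by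
    simpa using hw h
  have hNentry : N = Matrix.of fun j i => (∏ k, (y j - x k)) * (Matrix.of fun j i =>
      (∏ k ∈ univ.erase i, (x i - x k))⁻¹ *
        (Matrix.of fun i j : Fin m => (a (Sum.inr j) - a (Sum.inl i)) /
          (y j - x i)).transpose j i) j i := by
    ext j i
    simp only [hN, hL, Matrix.sub_apply, Matrix.diagonal_mul, Matrix.mul_diagonal,
      Matrix.of_apply, Matrix.transpose_apply, Function.comp_apply, Lagrange.basis,
      Lagrange.basisDivisor, Polynomial.eval_prod, Polynomial.eval_mul, Polynomial.eval_C,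
      Polynomial.eval_sub, Polynomial.eval_X, Finset.prod_mul_distrib, Finset.prod_inv_distrib]
    rw [← Finset.mul_prod_erase univ _ (mem_univ i)]
    field_simp [hsub i j]
  have hV : (Matrix.vandermonde x).det ≠ 0 := Matrix.det_vandermonde_ne_zero_iff.2 hxinj
  have hs : ((-1 : F) ^ m.choose 2)⁻¹ = (-1) ^ m.choose 2 := by rw [← inv_pow, inv_neg_one]
  rw [hfac, Matrix.det_mul, Matrix.det_fromBlocks_zero₁₂, Matrix.det_fromBlocks_zero₂₁,
    Matrix.det_mul, hNentry, Matrix.det_mul_column, Matrix.det_mul_row, Matrix.det_transpose,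
    Finset.prod_inv_distrib, prod_sub_ne_eq_sq_vandermonde, mul_inv, hs, prod_comm]
  simp only [Matrix.det_one, hx, hy, Function.comp_apply] at hV ⊢
  field_simp

lemma det_doubleVandermonde_indicator {n : ℕ} {z : Fin n → F} (hz : z.Injective)
    (e : Fin m ⊕ Fin m ≃ Fin n) {T : Finset (Fin n)} (hT : #T = m) (hTc : #Tᶜ = m) :
    (doubleVandermonde m (z ∘ e) fun i => if e i ∈ T then 1 else 0).det =
      splitVandermonde (z ∘ e) * ∏ i ∈ T, ∏ k ∈ Tᶜ, (z i - z k)⁻¹ := by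
  have hTcc : #Tᶜᶜ = m := (congrArg card (compl_compl T)).trans hT
  set f := finSumEquivOfFinset hTc hTcc with hf
  set σ : Equiv.Perm (Fin m ⊕ Fin m) := f.trans e.symm with hσ
  have heσ : e ∘ σ = f := by ext i; simp [hσ]
  have h1 := det_doubleVandermonde_comp_perm (z ∘ e) (fun i => if e i ∈ T then 1 else 0) σ
  have h2 := splitVandermonde_comp_perm (z ∘ e) σ
  have h3 := det_doubleVandermonde_zero_one (z ∘ f) (fun i => if f i ∈ T then 1 else 0)
    (by ext i; simp [hf, mem_compl.1 (Tᶜ.orderEmbOfFin_mem hTc i)])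
    (by ext i; simp [hf])
  have h4 : ∏ i, ∏ j, ((z ∘ f) (Sum.inr j) - (z ∘ f) (Sum.inl i)) =
      ∏ i ∈ T, ∏ k ∈ Tᶜ, (z i - z k) := by
    rw [prod_comm (s := T), prod_eq_prod_orderEmbOfFin hTc]
    refine prod_congr rfl fun i _ => ?_
    rw [← prod_congr (compl_compl T) fun _ _ => rfl, prod_eq_prod_orderEmbOfFin hTcc]
    simp [hf]
  have hne : ∏ i ∈ T, ∏ k ∈ Tᶜ, (z i - z k) ≠ 0 :=
    prod_ne_zero_iff.2 fun i hi => prod_ne_zero_iff.2 fun k hk =>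
      sub_ne_zero.2 fun h => mem_compl.1 hk (hz h ▸ hi)
  have h5 : (fun i => if e i ∈ T then (1 : F) else 0) ∘ σ = fun i => if f i ∈ T then 1 else 0 := by
    rw [← heσ]; rfl
  rw [Function.comp_assoc, heσ] at h1 h2
  rw [h5, h3] at h1
  rw [splitVandermonde, h4, h1] at h2
  have hs : ((Equiv.Perm.sign σ : ℤ) : F) ≠ 0 := by
    rcases Int.units_eq_one_or (Equiv.Perm.sign σ) with h | h <;> simp [h]
  simp only [prod_inv_distrib]
  rw [eq_mul_inv_iff_mul_eq₀ hne]
  exact mul_left_cancel₀ hs (by rw [← h2, mul_assoc])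

end DoubleVandermonde

section Evaluation

variable {F : Type*} [Field F] {m : ℕ}

lemma det_indicator {z : Fin (2 * m) → F} (hz : z.Injective) {S T : Finset (Fin (2 * m))}
    (hS : #S = m) (hSc : #Sᶜ = m) (hT : #T = m) (hTc : #Tᶜ = m) :
    (-1 : F) ^ (m * (m + 1) / 2 + ∑ s ∈ S, ((s : ℕ) + 1)) * (∏ i ∈ S, ∏ j ∈ Sᶜ, (z j - z i)) *
      (Matrix.of fun i j : Fin m =>
        ((if Sᶜ.orderEmbOfFin hSc j ∈ T then 1 else 0) -
          (if S.orderEmbOfFin hS i ∈ T then 1 else 0)) /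
        (z (Sᶜ.orderEmbOfFin hSc j) - z (S.orderEmbOfFin hS i))).det =
    (-1) ^ m.choose 2 * ((Matrix.vandermonde z).det * ∏ i ∈ T, ∏ k ∈ Tᶜ, (z i - z k)⁻¹) := by
  have h := det_doubleVandermonde_indicator hz (finSumEquivOfFinset hS hSc) hT hTc
  rw [det_doubleVandermonde (hz.comp (finSumEquivOfFinset hS hSc).injective),
    splitVandermonde_finSumEquivOfFinset] at h
  simp only [Function.comp_apply, finSumEquivOfFinset_inl, finSumEquivOfFinset_inr] at h
  have hprod : ∏ i ∈ S, ∏ j ∈ Sᶜ, (z j - z i) =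
      ∏ i, ∏ j, (z (Sᶜ.orderEmbOfFin hSc j) - z (S.orderEmbOfFin hS i)) := by
    simp only [prod_eq_prod_orderEmbOfFin hS, prod_eq_prod_orderEmbOfFin hSc]
  have hexp : m * (m + 1) / 2 + ∑ s ∈ S, ((s : ℕ) + 1) =
      ∑ s ∈ S, (s : ℕ) + (m.choose 2 + (m + m)) := by
    have h2 : m * (m + 1) / 2 = m + m.choose 2 := by
      have h := (m + 1).choose_two_right
      rw [Nat.choose_succ_succ' m 1, Nat.choose_one_right, Nat.add_sub_cancel] at h
      rw [h, mul_comm]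
    rw [h2, sum_add_distrib, sum_const, hS, smul_eq_mul, mul_one]
    ring
  have hsq (N : ℕ) : ((-1 : F) ^ N) * (-1) ^ N = 1 := by rw [← mul_pow]; simp
  rw [hexp, hprod, pow_add _ _ (m.choose 2 + _), pow_add _ (m.choose 2), pow_add _ m, hsq,
    mul_one, mul_assoc, mul_assoc, ← mul_assoc ((-1 : F) ^ m.choose 2)]
  refine (congrArg ((-1) ^ (∑ s ∈ S, (s : ℕ)) * ·) h).trans ?_
  rw [pow_add]
  linear_combination (-1) ^ m.choose 2 * (Matrix.vandermonde z).det *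
    (∏ i ∈ T, ∏ k ∈ Tᶜ, (z i - z k)⁻¹) * hsq (∑ s ∈ S, (s : ℕ))

lemma vandermonde_mul_prod_indicator {ζ z : Fin (2 * m) → F} (hζ : ∀ i, ζ i ≠ 0)
    (hzdef : ∀ i, z i = ζ i + (ζ i)⁻¹ - 2) {T : Finset (Fin (2 * m))} (hT : #T = m)
    (hTc : #Tᶜ = m) :
    (Matrix.vandermonde z).det * ∏ i ∈ T, ∏ k ∈ Tᶜ, (z i - z k)⁻¹ =
      (∏ i, ζ i ^ ((1 : ℤ) - (m : ℤ))) * (∏ i, ∏ j ∈ Ioi i, (1 - ζ i * ζ j)) *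
        ((Matrix.vandermonde ζ).det *
          ∏ i ∈ T, ∏ k ∈ Tᶜ, ((ζ i - ζ k) * (1 - ζ i * ζ k))⁻¹) := by
  have hsub (i k) : z i - z k = -1 * ((ζ i - ζ k) * (1 - ζ i * ζ k)) * (ζ i * ζ k)⁻¹ := by
    have := hζ i
    have := hζ k
    rw [hzdef, hzdef]
    field_simp
    ring
  have hsq (N : ℕ) : ((-1 : F) ^ N) * (-1) ^ N = 1 := by rw [← mul_pow]; simp
  set Z := ∏ i, ζ i with hZ
  have hZ0 : Z ≠ 0 := prod_ne_zero_iff.2 fun i _ => hζ i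
  have hV : (Matrix.vandermonde z).det = (-1) ^ (2 * m).choose 2 *
      ((Matrix.vandermonde ζ).det * ∏ i, ∏ j ∈ Ioi i, (1 - ζ i * ζ j)) * (Z * (Z ^ (2 * m))⁻¹) := by
    have hX : (∏ i, ∏ j ∈ Ioi i, (ζ i * ζ j))⁻¹ = Z * (Z ^ (2 * m))⁻¹ := by
      rw [hZ, ← Finset.prod_pow, ← prod_pairs_mul, mul_inv, mul_left_comm, mul_inv_cancel₀ hZ0,
        mul_one]
    rw [← hX, ← prod_pairs_neg_one, Matrix.det_vandermonde, Matrix.det_vandermonde]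
    simp only [← Finset.prod_mul_distrib, ← Finset.prod_inv_distrib]
    refine prod_congr rfl fun i _ => prod_congr rfl fun j _ => ?_
    rw [hsub, mul_comm (ζ j) (ζ i)]
  have hP : ∏ i ∈ T, ∏ k ∈ Tᶜ, (z i - z k)⁻¹ = (-1) ^ m *
      (∏ i ∈ T, ∏ k ∈ Tᶜ, ((ζ i - ζ k) * (1 - ζ i * ζ k))⁻¹) * Z ^ m := by
    have hterm (i k) : (z i - z k)⁻¹ =
        -1 * ((ζ i - ζ k) * (1 - ζ i * ζ k))⁻¹ * (ζ i * ζ k) := by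
      rw [hsub, mul_inv, mul_inv, inv_inv, inv_neg_one]
    have hZm : ∏ i ∈ T, ∏ k ∈ Tᶜ, (ζ i * ζ k) = Z ^ m := by
      simp only [Finset.prod_mul_distrib, prod_const, hT, hTc, Finset.prod_pow]
      rw [← mul_pow, Finset.prod_mul_prod_compl]
    have hm : ∏ _i ∈ T, ∏ _k ∈ Tᶜ, (-1 : F) = (-1) ^ m := by
      simp only [prod_const, hT, hTc]
      rcases Nat.even_or_odd m with he | ho
      · simp [he.neg_one_pow]
      · simp [ho.neg_one_pow]
    simp only [hterm, Finset.prod_mul_distrib (s := Tᶜ), Finset.prod_mul_distrib (s := T),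
      ← hZm, ← hm]
  have hchoose : (-1 : F) ^ (2 * m).choose 2 = (-1) ^ m := by
    have : (2 * m).choose 2 = m * (2 * m - 1) := by
      rw [Nat.choose_two_right, mul_assoc, Nat.mul_div_cancel_left _ two_pos]
    rcases m with _ | m
    · simp
    · rw [this, mul_comm, pow_mul, Odd.neg_one_pow ⟨m, by omega⟩]
  have hZz : (∏ i, ζ i ^ ((1 : ℤ) - (m : ℤ))) = Z * (Z ^ m)⁻¹ := by
    rw [Finset.prod_zpow, zpow_sub₀ hZ0, zpow_one, zpow_natCast, div_eq_mul_inv]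
  have hcancel : (Z ^ (2 * m))⁻¹ * Z ^ m = (Z ^ m)⁻¹ := by
    rw [two_mul, pow_add, mul_inv, mul_assoc, inv_mul_cancel₀ (pow_ne_zero _ hZ0), mul_one]
  rw [hV, hP, hZz, hchoose, ← hcancel]
  linear_combination (Matrix.vandermonde ζ).det * (∏ i, ∏ j ∈ Ioi i, (1 - ζ i * ζ j)) *
    (∏ i ∈ T, ∏ k ∈ Tᶜ, ((ζ i - ζ k) * (1 - ζ i * ζ k))⁻¹) *
    (Z * (Z ^ (2 * m))⁻¹ * Z ^ m) * hsq m

lemma prod_sub_div_mem_squarefreeForms {ι : Type*} {p q : Fin m → ι} (hp : p.Injective)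
    (hq : q.Injective) (hpq : ∀ i j, p i ≠ q j) (c : Fin m → F) :
    (fun a : ι → F => ∏ i, ((a (q i) - a (p i)) / c i)) ∈ squarefreeForms F ι m := by
  have h : (fun a : ι → F => ∏ i, ((a (q i) - a (p i)) / c i)) =
      (∏ i, c i)⁻¹ • fun a : ι → F => ∏ i, (a (q i) - a (p i)) := by
    ext a
    rw [Finset.prod_div_distrib, div_eq_inv_mul, Pi.smul_apply, smul_eq_mul]
  rw [h]
  exact Submodule.smul_mem _ _ (prod_sub_mem_squarefreeForms hp hq hpq)

lemma det_mem_squarefreeForms {ι : Type*} {p q : Fin m → ι} (hp : p.Injective)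
    (hq : q.Injective) (hpq : ∀ i j, p i ≠ q j) (c : Matrix (Fin m) (Fin m) F) :
    (fun a : ι → F => (Matrix.of fun i j => (a (q j) - a (p i)) / c i j).det) ∈
      squarefreeForms F ι m := by
  have h : (fun a : ι → F => (Matrix.of fun i j => (a (q j) - a (p i)) / c i j).det) =
      ∑ σ : Equiv.Perm (Fin m), ((Equiv.Perm.sign σ : ℤ) : F) • fun a : ι → F =>
        ∏ i, ((a (q i) - a (p (σ i))) / c (σ i) i) := by
    ext a
    simp [Matrix.det_apply']
  rw [h]
  exact Submodule.sum_mem _ fun σ _ => Submodule.smul_mem _ _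
    (prod_sub_div_mem_squarefreeForms (hp.comp σ.injective) hq (fun i j => hpq _ _) _)

lemma pfaff_mem_squarefreeForms (c : Matrix (Fin (2 * m)) (Fin (2 * m)) F) :
    (fun a : Fin (2 * m) → F => pfaff fun i j => (a j - a i) / c i j) ∈
      squarefreeForms F (Fin (2 * m)) m := by
  simp only [pfaff, zsmul_eq_mul]
  rw [← Finset.sum_fn]
  refine Submodule.sum_mem _ fun σ _ => Submodule.smul_mem _ ((Equiv.Perm.sign σ : ℤ) : F)
    (prod_sub_div_mem_squarefreeForms (fun i j hij => ?_) (fun i j hij => ?_)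
      (fun i j hij => ?_) _) <;>
  · have := congrArg Fin.val (σ.injective hij)
    simp only at this
    omega

end Evaluation

end Pfaffian

theorem sundquist_det_eq_pfaffian_zeta {F : Type*} [Field F] (m : ℕ)
    (a ζ z : Fin (2 * m) → F)
    (hζ : ∀ i, ζ i ≠ 0)
    (hζζ : ∀ i j, i ≠ j → 1 - ζ i * ζ j ≠ 0)
    (hzdef : ∀ i, z i = ζ i + (ζ i)⁻¹ - 2)
    (hz : ∀ i j, i ≠ j → z i ≠ z j)
    (S : Finset (Fin (2 * m))) (hS : S.card = m) :
    (-1 : F) ^ (m * (m + 1) / 2 + ∑ s ∈ S, ((s : ℕ) + 1)) *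
      (∏ i ∈ S, ∏ j ∈ Sᶜ, (z j - z i)) *
      Matrix.det (Matrix.of fun i j : Fin m =>
        (a ((Sᶜ).orderEmbOfFin
              (by rw [Finset.card_compl, hS, Fintype.card_fin]; omega) j) -
         a (S.orderEmbOfFin hS i)) /
        (z ((Sᶜ).orderEmbOfFin
              (by rw [Finset.card_compl, hS, Fintype.card_fin]; omega) j) -
         z (S.orderEmbOfFin hS i))) =
    (∏ i : Fin (2 * m), ζ i ^ ((1 : ℤ) - (m : ℤ))) *
      (∏ p ∈ Finset.univ.filter (fun p : Fin (2 * m) × Fin (2 * m) => p.1 < p.2),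
        (1 - ζ p.1 * ζ p.2)) *
      pfaff (fun i j => (a j - a i) / (1 - ζ i * ζ j)) := by
  have hcompl (T : Finset (Fin (2 * m))) (hT : #T = m) : #Tᶜ = m := by
    rw [card_compl, hT, Fintype.card_fin]
    omega
  have hzinj : z.Injective := fun i j h => by_contra fun hij => hz i j hij h
  have hζinj : ζ.Injective := fun i j h => hzinj (by rw [hzdef, hzdef, h])
  have hpairs : ∏ p ∈ Finset.univ.filter (fun p : Fin (2 * m) × Fin (2 * m) => p.1 < p.2),
      (1 - ζ p.1 * ζ p.2) = ∏ i, ∏ j ∈ Ioi i, (1 - ζ i * ζ j) := by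
    rw [Pfaffian.prod_Ioi_eq_prod_ite, prod_filter, Fintype.prod_prod_type]
  rw [hpairs]
  refine congrFun (Pfaffian.eq_of_mem_squarefreeForms
    (Submodule.smul_mem _ _ (Pfaffian.det_mem_squarefreeForms (S.orderEmbOfFin hS).injective
      (Sᶜ.orderEmbOfFin (hcompl S hS)).injective (fun i j h => ?_)
      fun i j => z (Sᶜ.orderEmbOfFin (hcompl S hS) j) - z (S.orderEmbOfFin hS i)))
    (Submodule.smul_mem _ _ (Pfaffian.pfaff_mem_squarefreeForms fun i j => 1 - ζ i * ζ j))
    fun T hT => ?_) a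
  · exact mem_compl.1 (Sᶜ.orderEmbOfFin_mem (hcompl S hS) j) (h ▸ S.orderEmbOfFin_mem hS i)
  · refine (Pfaffian.det_indicator hzinj hS (hcompl S hS) hT (hcompl T hT)).trans ?_
    rw [Pfaffian.vandermonde_mul_prod_indicator hζ hzdef hT (hcompl T hT), mul_left_comm,
      ← Pfaffian.pfaff_indicatorMatrix m ζ hζ hζinj hζζ T hT]
    rfl
end

section
/- Let σ ∈ S_{2m}, let S = {σ(1), σ(3), ..., σ(2m−1)} (assume these are m distinct values), and let τ: S → S^c be the bijection τ(σ(2i−1)) = σ(2i). Identify τ with a permutation in S_m via the increasing enumerations of S and S^c. Then sgn(σ) = (-1)^{χ(S)} sgn(τ), where χ(S) is the number of even elements of S. -/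
open Finset

/-- The interleaving of two copies of `Fin m`: the left copy goes to the even positions of
`Fin (2 * m)`, the right copy to the odd ones. -/
def interleaveEquiv (m : ℕ) : Fin m ⊕ Fin m ≃ Fin (2 * m) where
  toFun := Sum.elim (fun i => ⟨2 * (i : ℕ), by omega⟩) (fun i => ⟨2 * (i : ℕ) + 1, by omega⟩)
  invFun k :=
    if (k : ℕ) % 2 = 0 then Sum.inl ⟨(k : ℕ) / 2, by omega⟩ else Sum.inr ⟨(k : ℕ) / 2, by omega⟩
  left_inv x := by
    rcases x with i | i
    · simp
    · simp [Nat.add_mod, Fin.ext_iff]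
      omega
  right_inv k := by
    by_cases h : (k : ℕ) % 2 = 0
    · simp only [h, if_true, Sum.elim_inl, Fin.ext_iff]
      omega
    · simp only [h, if_false, Sum.elim_inr, Fin.ext_iff]
      omega

theorem interleaveEquiv_inl {m : ℕ} (i : Fin m) :
    interleaveEquiv m (Sum.inl i) = ⟨2 * (i : ℕ), by omega⟩ := rfl

theorem interleaveEquiv_inr {m : ℕ} (i : Fin m) :
    interleaveEquiv m (Sum.inr i) = ⟨2 * (i : ℕ) + 1, by omega⟩ := rfl

theorem Equiv.Perm.sign_eq_prod_prod_ite {n : ℕ} (σ : Equiv.Perm (Fin n)) :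
    Equiv.Perm.sign σ = ∏ j, ∏ i, if i < j then (if σ i < σ j then 1 else -1) else 1 := by
  rw [Equiv.Perm.sign_eq_prod_prod_Iio]
  refine Finset.prod_congr rfl fun j _ => ?_
  rw [← Finset.prod_filter]
  congr 1
  ext i
  simp

/-- The sign of a shuffle, read off from the values at the left summand. -/
theorem sign_interleaveEquiv_symm_trans {m : ℕ} (f : Fin m ⊕ Fin m ≃ Fin (2 * m))
    (hl : StrictMono (f ∘ Sum.inl)) (hr : StrictMono (f ∘ Sum.inr)) :
    Equiv.Perm.sign ((interleaveEquiv m).symm.trans f) =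
      ∏ i, (-1) ^ (f (Sum.inl i) : ℕ) := by
  have hl' (i j : Fin m) : f (Sum.inl i) < f (Sum.inl j) ↔ i < j := hl.lt_iff_lt
  have hr' (i j : Fin m) : f (Sum.inr i) < f (Sum.inr j) ↔ i < j := hr.lt_iff_lt
  rw [Equiv.Perm.sign_eq_prod_prod_ite, ← (interleaveEquiv m).prod_comp]
  simp_rw [← (interleaveEquiv m).prod_comp (fun i => ite (i < _) _ _)]
  simp only [Fintype.prod_sum_type, Equiv.trans_apply, Equiv.symm_apply_apply, hl', hr',
    interleaveEquiv_inl, interleaveEquiv_inr, Fin.mk_lt_mk]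
  have hsame (i j : Fin m) (c : ℕ) :
      (if 2 * (i : ℕ) + c < 2 * (j : ℕ) + c then (if i < j then 1 else -1) else 1 : ℤˣ) = 1 := by
    split_ifs <;> first | rfl | omega
  have hsame₀ (i j : Fin m) := hsame i j 0
  simp only [add_zero] at hsame₀
  simp only [hsame, hsame₀, Finset.prod_const_one, one_mul, mul_one]
  rw [Finset.prod_comm (s := univ) (t := univ)
    (f := fun j i : Fin m => ite (2 * (i : ℕ) < 2 * (j : ℕ) + 1) _ _),
    ← Finset.prod_mul_distrib]
  refine Finset.prod_congr rfl fun i _ => ?_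
  have hcard : (f (Sum.inl i) : ℕ) =
      (univ.filter fun j : Fin m => j < i).card +
        (univ.filter fun j : Fin m => f (Sum.inr j) < f (Sum.inl i)).card := by
    rw [← Fin.card_Iio (f (Sum.inl i)), ← Finset.card_map f.symm.toEmbedding,
      ← Finset.card_disjSum]
    congr 1
    ext (j | j) <;> simp [hl']
  rw [hcard, pow_add, ← Finset.prod_const, ← Finset.prod_const, Finset.prod_filter,
    Finset.prod_filter, ← Finset.prod_mul_distrib, ← Finset.prod_mul_distrib]
  refine Finset.prod_congr rfl fun j _ => ?_
  have hne : f (Sum.inl i) ≠ f (Sum.inr j) := by simp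
  split_ifs <;> first | rfl | omega

theorem prod_neg_one_pow_eq_neg_one_pow_chi {n : ℕ} (S : Finset (Fin n)) :
    ∏ i ∈ S, (-1 : ℤˣ) ^ (i : ℕ) = (-1) ^ chi S := by
  rw [chi, ← Finset.prod_const, Finset.prod_filter]
  refine Finset.prod_congr rfl fun i _ => ?_
  split_ifs with h
  · exact Odd.neg_one_pow (Nat.odd_iff.2 (by omega))
  · exact Even.neg_one_pow (Nat.even_iff.2 (by omega))

theorem sign_of_matching_permutation (m : ℕ) (σ : Equiv.Perm (Fin (2 * m)))
    (S : Finset (Fin (2 * m))) (hS : S.card = m)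
    (hSdef : S = Finset.univ.image (fun i : Fin m => σ ⟨2 * (i : ℕ), by omega⟩))
    (τ : Equiv.Perm (Fin m))
    (hτ : ∀ j : Fin m,
      (Sᶜ).orderEmbOfFin (by rw [Finset.card_compl, hS, Fintype.card_fin]; omega)
          (τ ((S.orderIsoOfFin hS).symm
            ⟨σ ⟨2 * (j : ℕ), by omega⟩,
             by rw [hSdef]; exact Finset.mem_image_of_mem _ (Finset.mem_univ j)⟩)) =
        σ ⟨2 * (j : ℕ) + 1, by omega⟩) :
    (Equiv.Perm.sign σ : ℤ) = (-1) ^ chi S * (Equiv.Perm.sign τ : ℤ) := by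
  have hSc : (Sᶜ).card = m := by
    rw [Finset.card_compl, hS, Fintype.card_fin]
    omega
  let f := finSumEquivOfFinset hS hSc
  have hf : Equiv.Perm.sign ((interleaveEquiv m).symm.trans f) = (-1) ^ chi S := by
    rw [sign_interleaveEquiv_symm_trans f (S.orderEmbOfFin hS).strictMono
      (Sᶜ.orderEmbOfFin hSc).strictMono, ← prod_neg_one_pow_eq_neg_one_pow_chi,
      ← Finset.map_orderEmbOfFin_univ S hS, Finset.prod_map]
    rfl
  have hmem (j : Fin m) : σ ⟨2 * (j : ℕ), by omega⟩ ∈ S :=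
    (Finset.ext_iff.1 hSdef _).2 (Finset.mem_image_of_mem _ (Finset.mem_univ j))
  let r : Fin m → Fin m := fun j => (S.orderIsoOfFin hS).symm ⟨_, hmem j⟩
  have hr : Function.Injective r := by
    intro i j hij
    simpa [r, Fin.ext_iff] using hij
  let ρ : Equiv.Perm (Fin m) := Equiv.ofBijective r (Finite.injective_iff_bijective.1 hr)
  have hl (j : Fin m) : S.orderEmbOfFin hS (r j) = σ ⟨2 * (j : ℕ), by omega⟩ := by
    rw [← Finset.coe_orderIsoOfFin_apply, OrderIso.apply_symm_apply]
  have hσ : σ = (interleaveEquiv m).symm.trans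
      ((Equiv.Perm.sumCongr ρ (τ * ρ)).trans f) := by
    ext1 k
    obtain ⟨j | j, rfl⟩ := (interleaveEquiv m).surjective k
    · simp only [Equiv.trans_apply, Equiv.symm_apply_apply]
      exact (hl j).symm
    · simp only [Equiv.trans_apply, Equiv.symm_apply_apply]
      exact (hτ j).symm
  have hsign : Equiv.Perm.sign σ = (-1) ^ chi S * Equiv.Perm.sign τ := by
    rw [hσ, Equiv.Perm.sign_trans_trans, hf, Equiv.Perm.sign_sumCongr, Equiv.Perm.sign_mul,
      mul_left_comm, Int.units_mul_self, mul_one, mul_comm]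
  simp [hsign]
end
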